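/- (Moment estimate for local time increments in integral form.) Let d ≥ 1 be an integer with αd < 1 + N, let T be a compact interval in (0, ∞) × ℝ^N, and let 0 < γ < min{ (1/2)((1+N)/α − d), 1 }. Then there exist a constant C < ∞ and r₀ > 0 such that for every 0 < r ≤ r₀, every compact subinterval I ⊆ T all of whose side lengths are ≤ r, all v, ṽ ∈ ℝ^d, and every integer n ≥ 2: ∫_{Iⁿ} ∫_{ℝ^{nd}} ( ∏_{j=1}^n | e^{−i⟨ξ^j, v⟩} − e^{−i⟨ξ^j, ṽ⟩} | ) ∏_{k=1}^d exp( −(1/2) Q(ξ̄_k; z¹, …, zⁿ) ) dξ̄ dz¹ ⋯ dzⁿ ≤ Cⁿ |v − ṽ|^{nγ} (n!)^{αd + (1/2 + α)γ} r^{n(1 + N − α(d + γ))}, where ξ̄ = (ξ^j_k)_{1≤j≤n, 1≤k≤d} ∈ ℝ^{nd}, ξ^j = (ξ^j_1, …, ξ^j_d) ∈ ℝ^d, and ξ̄_k = (ξ^1_k, …, ξ^n_k) ∈ ℝⁿ. Consequently E[(L(v, I) − L(ṽ, I))ⁿ] ≤ Cⁿ |v − ṽ|^{nγ} (n!)^{αd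 + (1/2 + α)γ} r^{n(1 + N − α(d + γ))} for even n, where L is the local time of the solution u. -/

import Mathlib

open MeasureTheory Set
open scoped ENNReal

/-- The time–space Fourier transform `𝒢_{t,x}(τ, ξ)` of the wave kernel
`g_{t,x}(s, y) = G(t − s, x − y) 1_{[0,t]}(s)`. -/
noncomputable def Gker (N : ℕ) (t : ℝ) (x : EuclideanSpace ℝ (Fin N)) (τ : ℝ)
    (ξ : EuclideanSpace ℝ (Fin N)) : ℂ :=
  (Complex.exp (-Complex.I * ((inner ℝ x ξ : ℝ) : ℂ)) / (2 * (‖ξ‖ : ℂ))) *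
    ((Complex.exp (-Complex.I * (t : ℂ) * (τ : ℂ)) -
        Complex.exp (Complex.I * (t : ℂ) * (‖ξ‖ : ℂ))) / ((τ : ℂ) + (‖ξ‖ : ℂ)) -
      (Complex.exp (-Complex.I * (t : ℂ) * (τ : ℂ)) -
        Complex.exp (-Complex.I * (t : ℂ) * (‖ξ‖ : ℂ))) / ((τ : ℂ) - (‖ξ‖ : ℂ)))

/-- The quadratic form
`Q(c; z¹, …, zⁿ) = ∫_ℝ ∫_{ℝ^N} |Σ_j c_j 𝒢_{z^j}(τ,ξ)|² |τ|^{1−2H} h_β(ξ) dξ dτ`, which (up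
to a positive constant) is the variance `Var(Σ_j c_j u₁(z^j))`. -/
noncomputable def Qvar (N : ℕ) (H : ℝ) (hfun : EuclideanSpace ℝ (Fin N) → ℝ) {n : ℕ}
    (z : Fin n → ℝ × EuclideanSpace ℝ (Fin N)) (c : Fin n → ℝ) : ℝ :=
  ∫ τ : ℝ, ∫ ξ : EuclideanSpace ℝ (Fin N),
    ‖∑ j, (c j : ℂ) * Gker N (z j).1 (z j).2 τ ξ‖ ^ 2 *
      |τ| ^ (1 - 2 * H) * hfun ξ

/-- `α = (2H + 1 − N + β)/2`. -/
noncomputable def alphaExp (N : ℕ) (H β : ℝ) : ℝ := (2 * H + 1 - N + β) / 2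

open MeasureTheory Set
open scoped ENNReal

open scoped FourierTransform in
lemma exists_eta : ∃ η : ℝ → ℂ, Continuous η ∧ (∀ u, η (-u) = η u) ∧
    (∀ k : ℕ, ∃ C : ℝ, 0 < C ∧ ∀ u, (1 + |u|) ^ k * ‖η u‖ ≤ C) ∧
    (∫ u, η u = 1) ∧
    ∀ x : ℝ, 1 ≤ |x| → ∫ u : ℝ, Complex.exp (Complex.I * ((u * x : ℝ) : ℂ)) * η u = 0 := by
  let bb : ContDiffBump (0:ℝ) := ⟨1/2, 1, by norm_num, by norm_num⟩
  let f : ℝ → ℂ := fun x => ((bb x : ℝ) : ℂ)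
  have hf1 : HasCompactSupport f := bb.hasCompactSupport.comp_left (g := fun x : ℝ => (x:ℂ)) (by simp)
  have hf2 : ContDiff ℝ ((⊤ : ℕ∞) : WithTop ℕ∞) f := Complex.ofRealCLM.contDiff.comp bb.contDiff
  let S : SchwartzMap ℝ ℂ := hf1.toSchwartzMap hf2
  have hS : ∀ x, S x = f x := fun x => rfl
  let G : SchwartzMap ℝ ℂ := 𝓕 S
  have heven : ∀ u, G (-u) = G u := by
    intro u
    have h1 : ∀ u, G u = 𝓕 (S : ℝ → ℂ) u := fun u => rfl
    rw [h1, h1, Real.fourier_eq', Real.fourier_eq']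
    rw [← integral_neg_eq_self]
    refine integral_congr_ae (Filter.Eventually.of_forall fun v => ?_)
    have : S (-v) = S v := by
      rw [hS, hS]; simp only [f]; rw [bb.neg]
    simp [this]
  have hinv : ∀ x : ℝ, ∫ v : ℝ, Complex.exp (((2 * Real.pi * (v * x) : ℝ) : ℂ) * Complex.I) * G v = f x := by
    intro x
    have h : (𝓕⁻ G : SchwartzMap ℝ ℂ) = S := by simp [G]
    have h2 : (𝓕⁻ G : SchwartzMap ℝ ℂ) x = f x := by rw [h]; rfl
    rw [SchwartzMap.fourierInv_coe, Real.fourierInv_eq'] at h2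
    rw [← h2]
    refine integral_congr_ae (Filter.Eventually.of_forall fun v => ?_)
    simp [mul_comm]
  have hpi : (0:ℝ) < 2 * Real.pi := by positivity
  have hinv2 : ∀ x : ℝ, ∫ u : ℝ, Complex.exp (Complex.I * ((u * x : ℝ) : ℂ)) *
      (((2 * Real.pi)⁻¹ : ℝ) * G ((2 * Real.pi)⁻¹ * u)) = f x := by
    intro x
    have := Measure.integral_comp_mul_left (fun v : ℝ => Complex.exp (((2 * Real.pi * (v * x) : ℝ) : ℂ) * Complex.I) * G v) ((2 * Real.pi)⁻¹)
    rw [hinv] at this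
    have h3 : ∀ u : ℝ, Complex.exp (Complex.I * ((u * x : ℝ) : ℂ)) *
      (((2 * Real.pi)⁻¹ : ℝ) * G ((2 * Real.pi)⁻¹ * u)) = (((2 * Real.pi)⁻¹ : ℝ) : ℂ) * (Complex.exp (((2 * Real.pi * ((2 * Real.pi)⁻¹ * u * x) : ℝ) : ℂ) * Complex.I) * G ((2 * Real.pi)⁻¹ * u)) := by
      intro u
      have : 2 * Real.pi * ((2 * Real.pi)⁻¹ * u * x) = u * x := by field_simp
      rw [this]; ring_nf
    simp_rw [h3]
    rw [integral_const_mul, this]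
    rw [inv_inv, abs_of_pos hpi, Complex.real_smul, ← mul_assoc, ← Complex.ofReal_mul, inv_mul_cancel₀ hpi.ne']
    simp
  refine ⟨fun u => ((2 * Real.pi)⁻¹ : ℝ) * G ((2 * Real.pi)⁻¹ * u), ?_, ?_, ?_, ?_, ?_⟩
  · have := G.continuous
    fun_prop
  · intro u; simp only; rw [mul_neg, heven]
  · intro k
    let T : SchwartzMap ℝ ℂ := G
    have h := fun u => SchwartzMap.one_add_le_sup_seminorm_apply (𝕜 := ℝ) (m := (k, 0)) (k := k) (n := 0) le_rfl le_rfl G u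
    set Cc := 2 ^ (k, 0).1 * ((Finset.Iic (k, 0)).sup fun m => SchwartzMap.seminorm ℝ m.1 m.2) G with hC
    have hC0 : 0 ≤ Cc := le_trans (by positivity) (h 0)
    refine ⟨(2 * Real.pi) ^ k * (Cc + 1) , by positivity, fun u => ?_⟩
    have h1 := h ((2 * Real.pi)⁻¹ * u)
    simp only [norm_iteratedFDeriv_zero, Real.norm_eq_abs, abs_mul, abs_inv, abs_of_pos hpi] at h1
    have h2 : 1 + |u| ≤ (2 * Real.pi) * (1 + (2 * Real.pi)⁻¹ * |u|) := by
      rw [mul_add, ← mul_assoc, mul_inv_cancel₀ hpi.ne']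
      nlinarith [Real.pi_gt_three]
    have h3 : (1 + |u|) ^ k ≤ (2 * Real.pi) ^ k * (1 + (2 * Real.pi)⁻¹ * |u|) ^ k := by
      rw [← mul_pow]; gcongr
    have h4 : ‖(((2 * Real.pi)⁻¹ : ℝ) : ℂ) * G ((2 * Real.pi)⁻¹ * u)‖ ≤ ‖G ((2 * Real.pi)⁻¹ * u)‖ := by
      rw [norm_mul, Complex.norm_real, Real.norm_eq_abs, abs_inv, abs_of_pos hpi]
      apply mul_le_of_le_one_left (norm_nonneg _)
      apply inv_le_one_of_one_le₀
      linarith [Real.pi_gt_three]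
    calc _ ≤ ((2 * Real.pi) ^ k * (1 + (2 * Real.pi)⁻¹ * |u|) ^ k) * ‖G ((2 * Real.pi)⁻¹ * u)‖ := by gcongr
      _ = (2 * Real.pi) ^ k * ((1 + (2 * Real.pi)⁻¹ * |u|) ^ k * ‖G ((2 * Real.pi)⁻¹ * u)‖) := by ring
      _ ≤ (2 * Real.pi) ^ k * (Cc + 1) := by gcongr; linarith
  · have := hinv2 0
    simp only [mul_zero, Complex.ofReal_zero, Complex.exp_zero, one_mul] at this
    rw [this]
    simp only [f]
    rw [bb.one_of_mem_closedBall (by simp [bb])]; simp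
  · intro x hx
    rw [hinv2]
    simp only [f]
    rw [bb.zero_of_le_dist (by simpa [bb] using hx)]; simp

open MeasureTheory Set
open scoped ENNReal

/-- weighted Cauchy-Schwarz -/
lemma cs_weight {X : Type*} [MeasurableSpace X] (μ : Measure X) (F P : X → ℂ) (W : X → ℝ)
    (hF : AEStronglyMeasurable F μ) (hP : AEStronglyMeasurable P μ) (hWm : AEMeasurable W μ)
    (hW : ∀ᵐ x ∂μ, 0 < W x) :
    ENNReal.ofReal (‖∫ x, F x * P x ∂μ‖ ^ 2) ≤
      (∫⁻ x, ENNReal.ofReal (‖F x‖ ^ 2 * W x) ∂μ) * (∫⁻ x, ENNReal.ofReal (‖P x‖ ^ 2 / W x) ∂μ) := by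
  have h1 : ENNReal.ofReal ‖∫ x, F x * P x ∂μ‖ ≤
      ∫⁻ x, ENNReal.ofReal (‖F x‖ * √(W x)) * ENNReal.ofReal (‖P x‖ / √(W x)) ∂μ := by
    rw [ofReal_norm]
    refine (enorm_integral_le_lintegral_enorm _).trans (lintegral_mono_ae ?_)
    filter_upwards [hW] with x hx
    rw [← ENNReal.ofReal_mul (by positivity), ← ofReal_norm, norm_mul]
    apply le_of_eq; congr 1
    have : √(W x) ≠ 0 := (Real.sqrt_pos.2 hx).ne'
    field_simp
  have h2 := ENNReal.lintegral_mul_le_Lp_mul_Lq μ (p := 2) (q := 2) (by constructor <;> norm_num)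
    (f := fun x => ENNReal.ofReal (‖F x‖ * √(W x))) (g := fun x => ENNReal.ofReal (‖P x‖ / √(W x)))
    (by have := hF.norm.aemeasurable; have := hWm.sqrt; fun_prop)
    (by have := hP.norm.aemeasurable; have := hWm.sqrt; fun_prop)
  have h3 := h1.trans h2
  rw [ENNReal.ofReal_pow (norm_nonneg _)]
  refine (pow_le_pow_left' h3 2).trans ?_
  rw [mul_pow]
  have e : ∀ y : ℝ≥0∞, (y ^ (1/2:ℝ)) ^ 2 = y := by
    intro y
    rw [← ENNReal.rpow_natCast, ← ENNReal.rpow_mul]; norm_num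
  rw [e, e]
  refine mul_le_mul' (lintegral_mono_ae ?_) (lintegral_mono_ae ?_)
  · filter_upwards [hW] with x hx
    rw [show (2:ℝ) = ((2:ℕ):ℝ) by norm_num, ENNReal.rpow_natCast, ← ENNReal.ofReal_pow (by positivity), mul_pow, Real.sq_sqrt hx.le]
  · filter_upwards [hW] with x hx
    rw [show (2:ℝ) = ((2:ℕ):ℝ) by norm_num, ENNReal.rpow_natCast, ← ENNReal.ofReal_pow (by positivity), div_pow, Real.sq_sqrt hx.le]

/-- the one-dimensional spectral weight -/
noncomputable def mw (α ρ : ℝ) : ℝ := min (ρ ^ 2) (|ρ| ^ (-1 - 2 * α))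

lemma mw_measurable (α : ℝ) : Measurable (mw α) := by
  unfold mw; fun_prop

lemma mw_nonneg (α ρ : ℝ) : 0 ≤ mw α ρ := by unfold mw; positivity

lemma mw_pos (α ρ : ℝ) (h : ρ ≠ 0) : 0 < mw α ρ := by
  unfold mw
  have := abs_pos.2 h
  apply lt_min <;> positivity

lemma mw_neg (α ρ : ℝ) : mw α (-ρ) = mw α ρ := by simp [mw]

lemma mw_integrable (α : ℝ) (hα : 0 < α) : Integrable (mw α) := by
  have h := (integrable_one_add_norm (E := ℝ) (μ := volume) (r := 1 + 2 * α) (by simp; linarith)).const_mul (2 ^ (1 + 2 * α))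
  refine h.mono' (mw_measurable α).aestronglyMeasurable (Filter.Eventually.of_forall fun ρ => ?_)
  rw [Real.norm_eq_abs, abs_of_nonneg (mw_nonneg _ _), Real.norm_eq_abs]
  have h0 := abs_nonneg ρ
  have e : (2:ℝ) ^ (1 + 2 * α) * (1 + |ρ|) ^ (-(1 + 2 * α)) = ((1 + |ρ|) / 2) ^ (-(1 + 2 * α)) := by
    rw [Real.div_rpow (by positivity) (by positivity), Real.rpow_neg (x := 2) (by positivity)]
    field_simp
  rw [e]
  unfold mw
  rcases le_total |ρ| 1 with h1 | h1
  · calc _ ≤ ρ ^ 2 := min_le_left _ _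
      _ = |ρ| ^ 2 := (sq_abs _).symm
      _ ≤ 1 := by nlinarith
      _ ≤ _ := Real.one_le_rpow_of_pos_of_le_one_of_nonpos (by positivity) (by linarith) (by linarith)
  · calc _ ≤ |ρ| ^ (-1 - 2 * α) := min_le_right _ _
      _ = |ρ| ^ (-(1 + 2 * α)) := by ring_nf
      _ ≤ _ := Real.rpow_le_rpow_of_nonpos (by positivity) (by linarith) (by linarith)

/-- covariance kernel -/
noncomputable def Kc (α x : ℝ) : ℝ := ∫ ρ : ℝ, Real.cos (ρ * x) * mw α ρ

lemma Kc_continuous (α : ℝ) (hα : 0 < α) : Continuous (Kc α) := by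
  unfold Kc
  refine continuous_of_dominated (bound := mw α) (fun x => ?_) (fun x => ?_) (mw_integrable α hα) ?_
  · have := mw_measurable α
    apply Measurable.aestronglyMeasurable; fun_prop
  · refine Filter.Eventually.of_forall fun ρ => ?_
    rw [norm_mul, Real.norm_eq_abs, Real.norm_eq_abs, abs_of_nonneg (mw_nonneg _ _)]
    exact mul_le_of_le_one_left (mw_nonneg _ _) (Real.abs_cos_le_one _)
  · refine Filter.Eventually.of_forall fun ρ => ?_
    fun_prop

lemma Kc_integrable (α : ℝ) (hα : 0 < α) (x : ℝ) : Integrable (fun ρ : ℝ => Real.cos (ρ * x) * mw α ρ) := by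
  refine (mw_integrable α hα).mono' ?_ ?_
  · have := mw_measurable α
    apply Measurable.aestronglyMeasurable; fun_prop
  · refine Filter.Eventually.of_forall fun ρ => ?_
    rw [norm_mul, Real.norm_eq_abs, Real.norm_eq_abs, abs_of_nonneg (mw_nonneg _ _)]
    exact mul_le_of_le_one_left (mw_nonneg _ _) (Real.abs_cos_le_one _)

/-- one-dimensional quadratic form -/
noncomputable def qf (α : ℝ) {n : ℕ} (p c : Fin n → ℝ) : ℝ :=
  ∑ j, ∑ l, c j * c l * Kc α (p j - p l)

/-- exponential sum -/
noncomputable def es {n : ℕ} (p c : Fin n → ℝ) (ρ : ℝ) : ℂ :=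
  ∑ j, (c j : ℂ) * Complex.exp (Complex.I * ((ρ * p j : ℝ) : ℂ))

lemma es_continuous {n : ℕ} (p c : Fin n → ℝ) : Continuous (es p c) := by
  unfold es; fun_prop

lemma es_normsq {n : ℕ} (p c : Fin n → ℝ) (ρ : ℝ) :
    ‖es p c ρ‖ ^ 2 = ∑ j, ∑ l, c j * c l * Real.cos (ρ * (p j - p l)) := by
  have h1 : es p c ρ = ((∑ j, c j * Real.cos (ρ * p j) : ℝ) : ℂ) + ((∑ j, c j * Real.sin (ρ * p j) : ℝ) : ℂ) * Complex.I := by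
    unfold es
    push_cast
    rw [Finset.sum_mul, ← Finset.sum_add_distrib]
    refine Finset.sum_congr rfl fun j _ => ?_
    rw [mul_comm Complex.I, Complex.exp_mul_I]; ring
  rw [h1, ← Complex.normSq_eq_norm_sq, Complex.normSq_add_mul_I, sq, sq, Finset.sum_mul_sum, Finset.sum_mul_sum, ← Finset.sum_add_distrib]
  refine Finset.sum_congr rfl fun j _ => ?_
  rw [← Finset.sum_add_distrib]
  refine Finset.sum_congr rfl fun l _ => ?_
  rw [mul_sub, Real.cos_sub]; ring

lemma qf_integrable (α : ℝ) (hα : 0 < α) {n : ℕ} (p c : Fin n → ℝ) :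
    Integrable (fun ρ => ‖es p c ρ‖ ^ 2 * mw α ρ) := by
  simp_rw [es_normsq, Finset.sum_mul]
  refine integrable_finsetSum _ fun j _ => integrable_finsetSum _ fun l _ => ?_
  simp_rw [mul_assoc]
  exact ((Kc_integrable α hα _).const_mul _).const_mul _

lemma qf_eq (α : ℝ) (hα : 0 < α) {n : ℕ} (p c : Fin n → ℝ) :
    qf α p c = ∫ ρ, ‖es p c ρ‖ ^ 2 * mw α ρ := by
  simp_rw [es_normsq, Finset.sum_mul]
  rw [integral_finsetSum]
  swap
  · intro j _
    refine integrable_finsetSum _ fun l _ => ?_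
    simp_rw [mul_assoc]
    exact ((Kc_integrable α hα _).const_mul _).const_mul _
  unfold qf
  refine Finset.sum_congr rfl fun j _ => ?_
  rw [integral_finsetSum]
  swap
  · intro l _
    simp_rw [mul_assoc]
    exact ((Kc_integrable α hα _).const_mul _).const_mul _
  refine Finset.sum_congr rfl fun l _ => ?_
  simp_rw [mul_assoc]
  rw [integral_const_mul, integral_const_mul, Kc]

lemma qf_nonneg (α : ℝ) (hα : 0 < α) {n : ℕ} (p c : Fin n → ℝ) : 0 ≤ qf α p c := by
  rw [qf_eq α hα]
  exact integral_nonneg fun ρ => mul_nonneg (by positivity) (mw_nonneg _ _)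

lemma qf_lintegral (α : ℝ) (hα : 0 < α) {n : ℕ} (p c : Fin n → ℝ) :
    ∫⁻ ρ, ENNReal.ofReal (‖es p c ρ‖ ^ 2 * mw α ρ) = ENNReal.ofReal (qf α p c) := by
  rw [qf_eq α hα, ofReal_integral_eq_lintegral_ofReal (qf_integrable α hα p c)]
  exact Filter.Eventually.of_forall fun ρ => mul_nonneg (by positivity) (mw_nonneg _ _)

open MeasureTheory Set
open scoped ENNReal

lemma decay_integrable (η : ℝ → ℂ) (hc : Continuous η)
    (hd : ∀ k : ℕ, ∃ C : ℝ, 0 < C ∧ ∀ u, (1 + |u|) ^ k * ‖η u‖ ≤ C) (k : ℕ) :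
    Integrable (fun u => (1 + |u|) ^ k * ‖η u‖) := by
  obtain ⟨C, hC, h⟩ := hd (k + 2)
  have hi := (integrable_one_add_norm (E := ℝ) (μ := volume) (r := 2) (by simp)).const_mul C
  refine hi.mono' (by apply Continuous.aestronglyMeasurable; fun_prop) (Filter.Eventually.of_forall fun u => ?_)
  have h0 := abs_nonneg u
  rw [Real.norm_eq_abs, abs_of_nonneg (by positivity), Real.norm_eq_abs, Real.rpow_neg (by positivity),
    ← div_eq_mul_inv, le_div_iff₀ (by positivity)]
  have := h u
  rw [show (2:ℝ) = ((2:ℕ):ℝ) by norm_num, Real.rpow_natCast]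
  calc _ = (1 + |u|) ^ (k + 2) * ‖η u‖ := by ring
    _ ≤ C := this

lemma decay_integrable_sq (η : ℝ → ℂ) (hc : Continuous η)
    (hd : ∀ k : ℕ, ∃ C : ℝ, 0 < C ∧ ∀ u, (1 + |u|) ^ k * ‖η u‖ ≤ C) (k : ℕ) :
    Integrable (fun u => (1 + |u|) ^ k * ‖η u‖ ^ 2) := by
  obtain ⟨C, hC, h⟩ := hd 0
  have hi := (decay_integrable η hc hd k).const_mul C
  refine hi.mono' (by apply Continuous.aestronglyMeasurable; fun_prop) (Filter.Eventually.of_forall fun u => ?_)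
  have h0 := abs_nonneg u
  rw [Real.norm_eq_abs, abs_of_nonneg (by positivity)]
  have := h u
  simp only [pow_zero, one_mul] at this
  calc _ = ‖η u‖ * ((1 + |u|) ^ k * ‖η u‖) := by ring
    _ ≤ C * ((1 + |u|) ^ k * ‖η u‖) := by gcongr

lemma eta_integrable (η : ℝ → ℂ) (hc : Continuous η)
    (hd : ∀ k : ℕ, ∃ C : ℝ, 0 < C ∧ ∀ u, (1 + |u|) ^ k * ‖η u‖ ≤ C) : Integrable η := by
  have := decay_integrable η hc hd 0
  simp only [pow_zero, one_mul] at this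
  exact (integrable_norm_iff hc.aestronglyMeasurable).1 this

lemma norm_exp_I_real (x : ℝ) : ‖Complex.exp (Complex.I * (x : ℂ))‖ = 1 := by
  rw [mul_comm]; exact Complex.norm_exp_ofReal_mul_I x

lemma slnd1 (α : ℝ) (hα : 0 < α) (hα1 : α < 1) (D : ℝ) (hD : 0 < D) :
    ∃ κ : ℝ, 0 < κ ∧ ∀ (n : ℕ) (p c : Fin n → ℝ) (j : Fin n) (δ : ℝ), 0 < δ → δ ≤ D →
      (∀ l, |p l - p j| ≤ D) → (∀ l, l ≠ j → c l ≠ 0 → δ ≤ |p l - p j|) →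
      κ * (c j ^ 2 * δ ^ (2 * α)) ≤ qf α p c := by
  obtain ⟨η, hc, -, hd, h1, hsupp⟩ := exists_eta
  have hηi := eta_integrable η hc hd
  set L := 2 * D with hL
  have hI := decay_integrable_sq η hc hd 3
  set M := ∫ u, (1 + |u|) ^ 3 * ‖η u‖ ^ 2 with hM
  have hM0 : 0 ≤ M := integral_nonneg fun u => by positivity
  set C0 := L ^ 2 * D ^ (1 + 2 * α) + 4 with hC0
  have hC0p : 0 < C0 := by positivity
  refine ⟨(C0 * (M + 1))⁻¹, by positivity, ?_⟩
  intro n p c j δ hδ hδD hp hcl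
  -- the scaled pairing
  have hpsi : ∀ y : ℝ, ∫ ρ : ℝ, Complex.exp (Complex.I * ((ρ * y : ℝ) : ℂ)) * ((δ : ℂ) * η (δ * ρ)) =
      ∫ u : ℝ, Complex.exp (Complex.I * ((u * (y / δ) : ℝ) : ℂ)) * η u := by
    intro y
    have := Measure.integral_comp_mul_left (fun u : ℝ => Complex.exp (Complex.I * ((u * (y / δ) : ℝ) : ℂ)) * η u) δ
    rw [abs_of_pos (by positivity)] at this
    have e : (∫ ρ : ℝ, Complex.exp (Complex.I * ((ρ * y : ℝ) : ℂ)) * ((δ : ℂ) * η (δ * ρ))) =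
        (δ : ℂ) * ∫ ρ : ℝ, Complex.exp (Complex.I * ((δ * ρ * (y / δ) : ℝ) : ℂ)) * η (δ * ρ) := by
      rw [← integral_const_mul]
      congr 1; ext ρ
      have : δ * ρ * (y / δ) = ρ * y := by field_simp
      rw [this]; ring
    rw [e, this, Complex.real_smul, ← mul_assoc, ← Complex.ofReal_mul, mul_inv_cancel₀ hδ.ne']
    simp
  have hpsi0 : ∫ ρ : ℝ, Complex.exp (Complex.I * ((ρ * 0 : ℝ) : ℂ)) * ((δ : ℂ) * η (δ * ρ)) = 1 := by
    rw [hpsi]; simpa using h1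
  have hpsiz : ∀ y : ℝ, δ ≤ |y| → ∫ ρ : ℝ, Complex.exp (Complex.I * ((ρ * y : ℝ) : ℂ)) * ((δ : ℂ) * η (δ * ρ)) = 0 := by
    intro y hy
    rw [hpsi]; apply hsupp
    rw [abs_div, abs_of_pos hδ, le_div_iff₀ hδ]; linarith
  have hInt0 : ∀ y : ℝ, Integrable (fun ρ : ℝ => Complex.exp (Complex.I * ((ρ * y : ℝ) : ℂ)) * ((δ : ℂ) * η (δ * ρ))) := by
    intro y
    refine ((hηi.comp_mul_left' hδ.ne').const_mul (δ:ℂ)).norm.mono' (by apply Continuous.aestronglyMeasurable; fun_prop) (Filter.Eventually.of_forall fun ρ => ?_)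
    rw [norm_mul, norm_exp_I_real, one_mul]
  set P : ℝ → ℂ := fun ρ => Complex.exp (Complex.I * ((ρ * (-(p j)) : ℝ) : ℂ)) * ((δ : ℂ) * η (δ * ρ)) *
    (1 - Complex.exp (Complex.I * ((ρ * (-L) : ℝ) : ℂ))) with hP
  have hpair : ∫ ρ, es p c ρ * P ρ = (c j : ℂ) := by
    have e : ∀ ρ, es p c ρ * P ρ = ∑ l, (c l : ℂ) * (Complex.exp (Complex.I * ((ρ * (p l - p j) : ℝ) : ℂ)) * ((δ : ℂ) * η (δ * ρ)) -
        Complex.exp (Complex.I * ((ρ * (p l - p j - L) : ℝ) : ℂ)) * ((δ : ℂ) * η (δ * ρ))) := by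
      intro ρ
      simp only [es, hP]
      rw [Finset.sum_mul]
      refine Finset.sum_congr rfl fun l _ => ?_
      have e1 : Complex.exp (Complex.I * ((ρ * (p l - p j) : ℝ) : ℂ)) = Complex.exp (Complex.I * ((ρ * p l : ℝ) : ℂ)) * Complex.exp (Complex.I * ((ρ * (-(p j)) : ℝ) : ℂ)) := by
        rw [← Complex.exp_add]; push_cast; ring_nf
      have e2 : Complex.exp (Complex.I * ((ρ * (p l - p j - L) : ℝ) : ℂ)) = Complex.exp (Complex.I * ((ρ * p l : ℝ) : ℂ)) * Complex.exp (Complex.I * ((ρ * (-(p j)) : ℝ) : ℂ)) * Complex.exp (Complex.I * ((ρ * (-L) : ℝ) : ℂ)) := by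
        rw [← Complex.exp_add, ← Complex.exp_add]; push_cast; ring_nf
      rw [e1, e2]; ring
    simp_rw [e]
    rw [integral_finsetSum]
    swap
    · intro l _
      exact ((hInt0 _).sub (hInt0 _)).const_mul _
    rw [Finset.sum_eq_single j]
    · rw [integral_const_mul, integral_sub (hInt0 _) (hInt0 _), sub_self, hpsi0, hpsiz]
      · simp
      · rw [zero_sub, abs_neg, abs_of_pos (by positivity)]; linarith
    · intro l _ hl
      by_cases hcl0 : c l = 0
      · simp [hcl0]
      · rw [integral_const_mul, integral_sub (hInt0 _) (hInt0 _), hpsiz _ (hcl l hl hcl0), hpsiz]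
        · simp
        · have := (abs_le.1 (hp l)).2
          rw [abs_of_nonpos (by linarith)]; linarith
    · simp
  have hcs := cs_weight volume (es p c) P (mw α) (es_continuous p c).aestronglyMeasurable
    (by apply Continuous.aestronglyMeasurable; fun_prop) (mw_measurable α).aemeasurable
    (by
      have : ∀ᵐ x : ℝ, x ≠ 0 := by simp [ae_iff]
      filter_upwards [this] with x hx using mw_pos α x hx)
  rw [hpair, qf_lintegral α hα] at hcs
  have hbound : ∫⁻ ρ, ENNReal.ofReal (‖P ρ‖ ^ 2 / mw α ρ) ≤ ENNReal.ofReal (C0 * δ ^ (-2 * α) * M) := by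
    have hpt : ∀ ρ, ‖P ρ‖ ^ 2 / mw α ρ ≤ C0 * δ ^ (1 - 2 * α) * ((1 + |δ * ρ|) ^ 3 * ‖η (δ * ρ)‖ ^ 2) := by
      intro ρ
      by_cases hρ : ρ = 0
      · have : mw α ρ = 0 := by
          simp only [mw, hρ, ne_eq, OfNat.ofNat_ne_zero, not_false_eq_true, zero_pow, abs_zero, min_eq_left_iff]
          positivity
        rw [this, div_zero]; positivity
      have hρ' := abs_pos.2 hρ
      have hn : ‖P ρ‖ = δ * ‖η (δ * ρ)‖ * ‖1 - Complex.exp (Complex.I * ((ρ * (-L) : ℝ) : ℂ))‖ := by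
        simp only [hP]
        rw [norm_mul, norm_mul, norm_exp_I_real, norm_mul, Complex.norm_real, Real.norm_eq_abs, abs_of_pos hδ, one_mul]
      set E := ‖1 - Complex.exp (Complex.I * ((ρ * (-L) : ℝ) : ℂ))‖ with hE
      have hE2 : E ≤ 2 := by
        refine (norm_sub_le _ _).trans ?_
        rw [norm_exp_I_real]; norm_num
      have hE1 : E ≤ L * |ρ| := by
        rw [hE, norm_sub_rev]
        refine (Real.norm_exp_I_mul_ofReal_sub_one_le).trans ?_
        rw [Real.norm_eq_abs, abs_mul, abs_neg, abs_of_pos (by positivity : 0 < L), mul_comm]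
      have hE0 : 0 ≤ E := norm_nonneg _
      have key : E ^ 2 / mw α ρ ≤ L ^ 2 + 4 * |ρ| ^ (1 + 2 * α) := by
        rw [div_le_iff₀ (mw_pos α ρ hρ)]
        unfold mw
        have hinv : |ρ| ^ (1 + 2 * α) * |ρ| ^ (-1 - 2 * α) = 1 := by
          rw [← Real.rpow_add hρ']; simp
        rcases min_choice (ρ ^ 2) (|ρ| ^ (-1 - 2 * α)) with h | h
        · rw [h]
          have : 0 ≤ |ρ| ^ (1 + 2 * α) := by positivity
          calc E ^ 2 ≤ (L * |ρ|) ^ 2 := by gcongr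
            _ = L ^ 2 * ρ ^ 2 := by rw [mul_pow, sq_abs]
            _ ≤ _ := by gcongr; linarith
        · rw [h, add_mul, mul_assoc, hinv]
          have : 0 ≤ L ^ 2 * |ρ| ^ (-1 - 2 * α) := by positivity
          nlinarith
      have hscale : L ^ 2 + 4 * |ρ| ^ (1 + 2 * α) ≤ δ ^ (-1 - 2 * α) * (C0 * (1 + |δ * ρ|) ^ 3) := by
        have e1 : |ρ| ^ (1 + 2 * α) = δ ^ (-1 - 2 * α) * |δ * ρ| ^ (1 + 2 * α) := by
          rw [abs_mul, abs_of_pos hδ, Real.mul_rpow hδ.le hρ'.le, ← mul_assoc, ← Real.rpow_add hδ]; simp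
        have e2 : 1 ≤ δ ^ (-1 - 2 * α) * D ^ (1 + 2 * α) := by
          calc 1 = δ ^ (-1 - 2 * α) * δ ^ (1 + 2 * α) := by rw [← Real.rpow_add hδ]; simp
            _ ≤ _ := by gcongr
        have e3 : |δ * ρ| ^ (1 + 2 * α) ≤ (1 + |δ * ρ|) ^ 3 := by
          have h0 := abs_nonneg (δ * ρ)
          calc _ ≤ (1 + |δ * ρ|) ^ (1 + 2 * α) := by gcongr; linarith
            _ ≤ (1 + |δ * ρ|) ^ (3:ℝ) := by apply Real.rpow_le_rpow_of_exponent_le <;> linarith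
            _ = _ := by norm_cast
        have e4 : 1 ≤ (1 + |δ * ρ|) ^ 3 := one_le_pow₀ (by linarith [abs_nonneg (δ * ρ)])
        have e5 : 0 < δ ^ (-1 - 2 * α) := by positivity
        rw [e1, hC0, add_mul, mul_add]
        apply add_le_add
        · calc L ^ 2 = L ^ 2 * 1 * 1 := by ring
            _ ≤ L ^ 2 * (δ ^ (-1 - 2 * α) * D ^ (1 + 2 * α)) * (1 + |δ * ρ|) ^ 3 := by gcongr
            _ = _ := by ring
        · rw [mul_left_comm]; gcongr
      calc ‖P ρ‖ ^ 2 / mw α ρ = δ ^ 2 * ‖η (δ * ρ)‖ ^ 2 * (E ^ 2 / mw α ρ) := by rw [hn]; ring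
        _ ≤ δ ^ 2 * ‖η (δ * ρ)‖ ^ 2 * (δ ^ (-1 - 2 * α) * (C0 * (1 + |δ * ρ|) ^ 3)) := by
          gcongr; exact key.trans hscale
        _ = C0 * (δ ^ 2 * δ ^ (-1 - 2 * α)) * ((1 + |δ * ρ|) ^ 3 * ‖η (δ * ρ)‖ ^ 2) := by ring
        _ = _ := by
          congr 2
          rw [← Real.rpow_natCast, ← Real.rpow_add hδ]; congr 1; push_cast; ring
    refine (lintegral_mono fun ρ => ENNReal.ofReal_le_ofReal (hpt ρ)).trans ?_
    have hi2 := (hI.comp_mul_left' hδ.ne').const_mul (C0 * δ ^ (1 - 2 * α))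
    rw [← ofReal_integral_eq_lintegral_ofReal hi2 (Filter.Eventually.of_forall fun ρ => by positivity)]
    apply ENNReal.ofReal_le_ofReal
    rw [integral_const_mul, Measure.integral_comp_mul_left (fun u => (1 + |u|) ^ 3 * ‖η u‖ ^ 2) δ, ← hM, abs_of_pos (by positivity), smul_eq_mul]
    apply le_of_eq
    rw [show (1 - 2 * α) = (-2 * α) + 1 by ring, Real.rpow_add hδ, Real.rpow_one]
    field_simp
  have hfin := hcs.trans (mul_le_mul_right hbound _)
  have hq := qf_nonneg α hα p c
  rw [← ENNReal.ofReal_mul hq, ENNReal.ofReal_le_ofReal_iff (by positivity), Complex.norm_real, Real.norm_eq_abs, sq_abs] at hfin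
  have hdd : δ ^ (-2 * α) * δ ^ (2 * α) = 1 := by rw [← Real.rpow_add hδ]; simp
  rw [inv_mul_le_iff₀ (by positivity)]
  calc c j ^ 2 * δ ^ (2 * α) ≤ (qf α p c * (C0 * δ ^ (-2 * α) * M)) * δ ^ (2 * α) := by gcongr
    _ = qf α p c * (C0 * M) * (δ ^ (-2 * α) * δ ^ (2 * α)) := by ring
    _ = qf α p c * (C0 * M) := by rw [hdd, mul_one]
    _ ≤ qf α p c * (C0 * (M + 1)) := by gcongr; linarith
    _ = _ := by ring

open MeasureTheory Set
open scoped ENNReal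

lemma gauss_one (A s : ℝ) (hA : 0 < A) :
    ∫⁻ x : ℝ, ENNReal.ofReal (Real.exp (-(A * (x + s) ^ 2))) = ENNReal.ofReal (√(Real.pi / A)) := by
  rw [lintegral_add_right_eq_self (fun x : ℝ => ENNReal.ofReal (Real.exp (-(A * x ^ 2)))) s]
  have h1 := integrable_exp_neg_mul_sq hA
  have h2 := integral_gaussian A
  simp only [neg_mul] at h1 h2
  rw [← ofReal_integral_eq_lintegral_ofReal h1 (Filter.Eventually.of_forall fun ρ => by positivity), h2]

lemma gauss_det (n : ℕ) : ∀ (M : Fin n → Fin n → ℝ) (a : Fin n → ℝ), (∀ i j, M i j = M j i) →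
    (∀ j, 0 < a j) →
    (∀ (j : Fin n) (c : Fin n → ℝ), (∀ l, j < l → c l = 0) → a j * c j ^ 2 ≤ ∑ i, ∑ l, c i * c l * M i l) →
    ∫⁻ c : Fin n → ℝ, ENNReal.ofReal (Real.exp (-(∑ i, ∑ l, c i * c l * M i l))) ≤
      ∏ j, ENNReal.ofReal (√(Real.pi / a j)) := by
  induction n with
  | zero =>
    intro M a _ _ _
    simp [lintegral_unique, volume_pi, Measure.pi_of_empty]
  | succ n ih =>
    intro M a hs ha hM
    set A := M 0 0 with hA
    have hA0 : a 0 ≤ A := by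
      have := hM 0 (Pi.single 0 1) (fun l hl => by simp [hl.ne'])
      simpa [Fin.sum_univ_succ, Pi.single_apply, Fin.succ_ne_zero] using this
    have hApos : 0 < A := (ha 0).trans_le hA0
    let M' : Fin n → Fin n → ℝ := fun i l => M i.succ l.succ - M i.succ 0 * M 0 l.succ / A
    let ell : (Fin n → ℝ) → ℝ := fun c => (∑ i, c i * M 0 i.succ) / A
    have hq : ∀ (x : ℝ) (c : Fin n → ℝ), ∑ i, ∑ l, (Fin.cons x c : Fin (n+1) → ℝ) i * (Fin.cons x c : Fin (n+1) → ℝ) l * M i l =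
        A * (x + ell c) ^ 2 + ∑ i, ∑ l, c i * c l * M' i l := by
      intro x c
      rw [Fin.sum_univ_succ]
      simp_rw [Fin.sum_univ_succ]
      simp only [Fin.cons_zero, Fin.cons_succ]
      have e1 : ∑ i, ∑ l, c i * c l * M' i l = ∑ i, ∑ l, c i * c l * M i.succ l.succ - A * (ell c) ^ 2 := by
        have : A * (ell c) ^ 2 = (∑ i, c i * M 0 i.succ) * (∑ i, c i * M 0 i.succ) / A := by
          simp only [ell]; field_simp
        rw [this, Finset.sum_mul_sum, Finset.sum_div, ← Finset.sum_sub_distrib]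
        refine Finset.sum_congr rfl fun i _ => ?_
        rw [Finset.sum_div, ← Finset.sum_sub_distrib]
        refine Finset.sum_congr rfl fun l _ => ?_
        simp only [M']
        rw [hs i.succ 0]; ring
      have e2 : ∑ i : Fin n, x * c i * M 0 i.succ = x * (A * ell c) := by
        have : A * ell c = ∑ i, c i * M 0 i.succ := by simp only [ell]; field_simp
        rw [this, Finset.mul_sum]
        refine Finset.sum_congr rfl fun i _ => by ring
      have e3 : ∑ i : Fin n, (c i * x * M i.succ 0 + ∑ l : Fin n, c i * c l * M i.succ l.succ) = x * (A * ell c) + ∑ i, ∑ l, c i * c l * M i.succ l.succ := by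
        rw [Finset.sum_add_distrib, ← e2]
        congr 1
        refine Finset.sum_congr rfl fun i _ => by rw [hs i.succ 0]; ring
      rw [e1, e2, e3, ← hA]; ring
    have hmp := (volume_preserving_piFinSuccAbove (fun _ : Fin (n + 1) => ℝ) 0).symm
    rw [← hmp.lintegral_comp_emb (MeasurableEquiv.measurableEmbedding _)]
    have hcons : ∀ y : ℝ × (Fin n → ℝ), (MeasurableEquiv.piFinSuccAbove (fun _ : Fin (n + 1) => ℝ) 0).symm y = Fin.cons y.1 y.2 := by
      intro y; simp [MeasurableEquiv.piFinSuccAbove, Fin.insertNthEquiv, Fin.insertNth_zero']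
    simp_rw [hcons, hq]
    have hprod : (volume : Measure (ℝ × ((i : Fin n) → ℝ))) = (volume : Measure ℝ).prod volume := rfl
    rw [hprod, lintegral_prod_symm]
    swap
    · apply Measurable.aemeasurable
      simp only [ell]
      fun_prop
    have : ∀ y : Fin n → ℝ, ∫⁻ x : ℝ, ENNReal.ofReal (Real.exp (-(A * (x + ell y) ^ 2 + ∑ i, ∑ l, y i * y l * M' i l))) =
        ENNReal.ofReal (√(Real.pi / A)) * ENNReal.ofReal (Real.exp (-(∑ i, ∑ l, y i * y l * M' i l))) := by
      intro y
      rw [← gauss_one A (ell y) hApos, ← lintegral_mul_const _ (by fun_prop)]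
      congr 1; ext x
      rw [← ENNReal.ofReal_mul (by positivity), ← Real.exp_add]; congr 2; ring
    simp only [this]
    rw [lintegral_const_mul _ (by fun_prop), Fin.prod_univ_succ]
    refine mul_le_mul' (ENNReal.ofReal_le_ofReal (Real.sqrt_le_sqrt ?_)) (ih M' (fun i => a i.succ) ?_ (fun j => ha _) ?_)
    · have := ha 0
      gcongr
    · intro i j
      simp only [M']
      rw [hs i.succ j.succ, hs i.succ 0, hs 0 j.succ]; ring
    · intro j c hc
      have h1 := hM j.succ (Fin.cons (-(ell c)) c) (by
        intro l hl
        refine Fin.cases ?_ (fun l => ?_) l hl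
        · intro h; exact absurd h (Fin.not_lt_zero _)
        · intro h; simpa using hc l (Fin.succ_lt_succ_iff.1 h))
      rw [hq] at h1
      simpa using h1

open MeasureTheory Set
open scoped ENNReal

/-- scaled bump -/
lemma exists_eta_scaled (a : ℝ) (ha : 0 < a) : ∃ η : ℝ → ℂ, Continuous η ∧ (∀ u, η (-u) = η u) ∧
    (∀ k : ℕ, ∃ C : ℝ, 0 < C ∧ ∀ u, (1 + |u|) ^ k * ‖η u‖ ≤ C) ∧ (∫ u, η u = 1) ∧
    ∀ x : ℝ, a ≤ |x| → ∫ u : ℝ, Complex.exp (Complex.I * ((u * x : ℝ) : ℂ)) * η u = 0 := by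
  obtain ⟨η, hc, he, hd, h1, hsupp⟩ := exists_eta
  have hpsi : ∀ y : ℝ, ∫ ρ : ℝ, Complex.exp (Complex.I * ((ρ * y : ℝ) : ℂ)) * ((a : ℂ) * η (a * ρ)) =
      ∫ u : ℝ, Complex.exp (Complex.I * ((u * (y / a) : ℝ) : ℂ)) * η u := by
    intro y
    have := Measure.integral_comp_mul_left (fun u : ℝ => Complex.exp (Complex.I * ((u * (y / a) : ℝ) : ℂ)) * η u) a
    rw [abs_of_pos (by positivity)] at this
    have e : (∫ ρ : ℝ, Complex.exp (Complex.I * ((ρ * y : ℝ) : ℂ)) * ((a : ℂ) * η (a * ρ))) =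
        (a : ℂ) * ∫ ρ : ℝ, Complex.exp (Complex.I * ((a * ρ * (y / a) : ℝ) : ℂ)) * η (a * ρ) := by
      rw [← integral_const_mul]
      congr 1; ext ρ
      have : a * ρ * (y / a) = ρ * y := by field_simp
      rw [this]; ring
    rw [e, this, Complex.real_smul, ← mul_assoc, ← Complex.ofReal_mul, mul_inv_cancel₀ ha.ne']
    simp
  refine ⟨fun u => (a : ℂ) * η (a * u), by fun_prop, ?_, ?_, ?_, ?_⟩
  · intro u; simp only [mul_neg, he]
  · intro k
    obtain ⟨C, hC, h⟩ := hd k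
    refine ⟨(1 + a⁻¹) ^ k * a * C, by positivity, fun u => ?_⟩
    have h0 := abs_nonneg u
    have h2 := h (a * u)
    have h3 : 1 + |u| ≤ (1 + a⁻¹) * (1 + |a * u|) := by
      rw [abs_mul, abs_of_pos ha]
      have : (1 + a⁻¹) * (1 + a * |u|) = 1 + a⁻¹ + a * |u| + (a⁻¹ * a) * |u| := by ring
      rw [this, inv_mul_cancel₀ ha.ne']
      have : 0 < a⁻¹ := by positivity
      have : 0 ≤ a * |u| := by positivity
      linarith
    rw [norm_mul, Complex.norm_real, Real.norm_eq_abs, abs_of_pos ha]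
    calc (1 + |u|) ^ k * (a * ‖η (a * u)‖) ≤ ((1 + a⁻¹) * (1 + |a * u|)) ^ k * (a * ‖η (a * u)‖) := by gcongr
      _ = (1 + a⁻¹) ^ k * a * ((1 + |a * u|) ^ k * ‖η (a * u)‖) := by rw [mul_pow]; ring
      _ ≤ _ := by gcongr
  · have := hpsi 0
    simp only [mul_zero, zero_div, Complex.ofReal_zero, Complex.exp_zero, one_mul] at this
    rw [this, h1]
  · intro x hx
    rw [hpsi]; apply hsupp
    rw [abs_div, abs_of_pos ha, le_div_iff₀ ha]; linarith

lemma Gker_mul (N : ℕ) (t : ℝ) (x : EuclideanSpace ℝ (Fin N)) (τ : ℝ)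
    (ξ : EuclideanSpace ℝ (Fin N)) (hξ : ξ ≠ 0) (h1 : τ ≠ ‖ξ‖) (h2 : τ ≠ -‖ξ‖) :
    Gker N t x τ ξ * ((τ : ℂ) ^ 2 - (‖ξ‖ : ℂ) ^ 2) =
      (Complex.exp (-Complex.I * ((inner ℝ x ξ : ℝ) : ℂ)) / (2 * (‖ξ‖ : ℂ))) *
      (- 2 * ‖ξ‖ * Complex.exp (-Complex.I * (t : ℂ) * (τ : ℂ))
       - Complex.exp (Complex.I * (t : ℂ) * (‖ξ‖ : ℂ)) * ((τ : ℂ) - ‖ξ‖)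
       + Complex.exp (-Complex.I * (t : ℂ) * (‖ξ‖ : ℂ)) * ((τ : ℂ) + ‖ξ‖)) := by
  have hn : (‖ξ‖ : ℂ) ≠ 0 := by simpa using hξ
  have e1 : (τ : ℂ) - ‖ξ‖ ≠ 0 := by
    rw [sub_ne_zero]; exact_mod_cast h1
  have e2 : (τ : ℂ) + ‖ξ‖ ≠ 0 := by
    intro h; apply h2
    have := eq_neg_of_add_eq_zero_left h
    exact_mod_cast this
  unfold Gker
  field_simp
  ring

lemma exp_smul_integrable (η : ℝ → ℂ) (hη : Integrable η) (s : ℝ) :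
    Integrable (fun u : ℝ => Complex.exp (Complex.I * ((u * s : ℝ) : ℂ)) * η u) := by
  refine hη.norm.mono' ((Continuous.aestronglyMeasurable (by fun_prop)).mul hη.aestronglyMeasurable)
    (Filter.Eventually.of_forall fun ρ => ?_)
  rw [norm_mul, norm_exp_I_real, one_mul]

/-- pairing of the kernel with the test function -/
lemma Gker_pair (N : ℕ) (a : ℝ) (η : ℝ → ℂ) (hc : Continuous η) (he : ∀ u, η (-u) = η u)
    (hd : ∀ k : ℕ, ∃ C : ℝ, 0 < C ∧ ∀ u, (1 + |u|) ^ k * ‖η u‖ ≤ C) (h1 : ∫ u, η u = 1)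
    (hs : ∀ x : ℝ, a ≤ |x| → ∫ u : ℝ, Complex.exp (Complex.I * ((u * x : ℝ) : ℂ)) * η u = 0)
    (t : ℝ) (ha : 0 < a) (ht : a ≤ t) (x ξ : EuclideanSpace ℝ (Fin N)) (hξ : ξ ≠ 0) :
    Integrable (fun τ : ℝ => Gker N t x τ ξ * (((τ : ℂ) ^ 2 - (‖ξ‖ : ℂ) ^ 2) * η (τ + ‖ξ‖))) ∧
    ∫ τ : ℝ, Gker N t x τ ξ * (((τ : ℂ) ^ 2 - (‖ξ‖ : ℂ) ^ 2) * η (τ + ‖ξ‖)) =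
      Complex.exp (-Complex.I * ((inner ℝ x ξ : ℝ) : ℂ)) * Complex.exp (Complex.I * (t : ℂ) * (‖ξ‖ : ℂ)) := by
  have hη := eta_integrable η hc hd
  have hn : (‖ξ‖ : ℂ) ≠ 0 := by simpa using hξ
  have hiu : Integrable (fun u : ℝ => (u : ℂ) * η u) := by
    refine (decay_integrable η hc hd 1).mono' (by apply Continuous.aestronglyMeasurable; fun_prop)
      (Filter.Eventually.of_forall fun u => ?_)
    rw [norm_mul, Complex.norm_real, Real.norm_eq_abs, pow_one]
    gcongr; linarith
  have hu0 : ∫ u : ℝ, (u : ℂ) * η u = 0 := by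
    have := integral_neg_eq_self (fun u : ℝ => (u : ℂ) * η u) volume
    simp only [he, Complex.ofReal_neg, neg_mul] at this
    rw [integral_neg] at this
    have h2 : (2:ℂ) * ∫ u : ℝ, (u : ℂ) * η u = 0 := by linear_combination -this
    simpa using h2
  set c0 : ℂ := Complex.exp (-Complex.I * ((inner ℝ x ξ : ℝ) : ℂ)) / (2 * (‖ξ‖ : ℂ)) with hc0
  set ep := Complex.exp (Complex.I * (t : ℂ) * (‖ξ‖ : ℂ)) with hep
  set em := Complex.exp (-Complex.I * (t : ℂ) * (‖ξ‖ : ℂ)) with hem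
  set G : ℝ → ℂ := fun u => c0 * (-2 * ‖ξ‖ * ep * (Complex.exp (Complex.I * ((u * (-t) : ℝ) : ℂ)) * η u)
    + (em - ep) * ((u : ℂ) * η u) + 2 * ‖ξ‖ * ep * η u) with hG
  have hGi : Integrable G :=
    ((((exp_smul_integrable η hη (-t)).const_mul _).add (hiu.const_mul _)).add (hη.const_mul _)).const_mul _
  have hae : (fun τ : ℝ => Gker N t x τ ξ * (((τ : ℂ) ^ 2 - (‖ξ‖ : ℂ) ^ 2) * η (τ + ‖ξ‖))) =ᵐ[volume] fun τ => G (τ + ‖ξ‖) := by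
    have q1 : ∀ᵐ x : ℝ, x ≠ ‖ξ‖ := by simp [ae_iff]
    have q2 : ∀ᵐ x : ℝ, x ≠ -‖ξ‖ := by simp [ae_iff]
    filter_upwards [q1, q2] with τ h1 h2
    rw [← mul_assoc, Gker_mul N t x τ ξ hξ h1 h2]
    have e1 : Complex.exp (-Complex.I * (t : ℂ) * (τ : ℂ)) = ep * Complex.exp (Complex.I * (((τ + ‖ξ‖) * (-t) : ℝ) : ℂ)) := by
      rw [hep, ← Complex.exp_add]; congr 1; push_cast; ring
    simp only [hG]
    rw [e1, ← hc0]; push_cast; ring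
  refine ⟨(integrable_congr hae).2 (hGi.comp_add_right _), ?_⟩
  rw [integral_congr_ae hae, integral_add_right_eq_self G ‖ξ‖]
  simp only [hG]
  have h12 : Integrable (fun u : ℝ => -2 * ‖ξ‖ * ep * (Complex.exp (Complex.I * ((u * (-t) : ℝ) : ℂ)) * η u)
    + (em - ep) * ((u : ℂ) * η u)) := ((exp_smul_integrable η hη (-t)).const_mul _).add (hiu.const_mul _)
  rw [integral_const_mul, integral_add h12 (hη.const_mul _),
    integral_add ((exp_smul_integrable η hη (-t)).const_mul _) (hiu.const_mul _), integral_const_mul, integral_const_mul, integral_const_mul,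
    hs _ (by rw [abs_neg, abs_of_pos (by linarith)]; exact ht), hu0, h1, hc0]
  field_simp
  ring

lemma Gker_measurable (N : ℕ) (t : ℝ) (x : EuclideanSpace ℝ (Fin N)) :
    Measurable (fun q : ℝ × EuclideanSpace ℝ (Fin N) => Gker N t x q.1 q.2) := by
  unfold Gker
  have : Measurable (fun q : ℝ × EuclideanSpace ℝ (Fin N) => inner ℝ x q.2) := by fun_prop
  fun_prop

lemma B1_bound (H : ℝ) (hH1 : 1 / 2 ≤ H) (hH2 : H < 1) (η : ℝ → ℂ) (ρ M : ℝ) (hρ : 0 < ρ)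
    (hI : Integrable (fun u => (1 + |u|) ^ 5 * ‖η u‖ ^ 2)) (hM : M = ∫ u, (1 + |u|) ^ 5 * ‖η u‖ ^ 2) :
    ∫⁻ τ : ℝ, ENNReal.ofReal (‖((τ : ℂ) ^ 2 - (ρ : ℂ) ^ 2) * η (τ + ρ)‖ ^ 2 / |τ| ^ (1 - 2 * H)) ≤
      ENNReal.ofReal (4 * (M + 1) * (1 + ρ) ^ (1 + 2 * H)) := by
  set P : ℝ → ℂ := fun τ => ((τ : ℂ) ^ 2 - (ρ : ℂ) ^ 2) * η (τ + ρ) with hP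
  have hpt : ∀ᵐ τ : ℝ, ‖P τ‖ ^ 2 / |τ| ^ (1 - 2 * H) ≤ 4 * (1 + ρ) ^ (1 + 2 * H) * ((1 + |τ + ρ|) ^ 5 * ‖η (τ + ρ)‖ ^ 2) := by
    have : ∀ᵐ x : ℝ, x ≠ 0 := by simp [ae_iff]
    filter_upwards [this] with τ hτ
    have hτ' := abs_pos.2 hτ
    set u := τ + ρ with hu
    have hu0 := abs_nonneg u
    have e1 : ‖P τ‖ = |u| * |τ - ρ| * ‖η u‖ := by
      simp only [hP]
      rw [norm_mul, show (τ : ℂ) ^ 2 - (ρ : ℂ) ^ 2 = ((u * (τ - ρ) : ℝ) : ℂ) by rw [hu]; push_cast; ring, Complex.norm_real, Real.norm_eq_abs, abs_mul]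
    have e2 : |τ - ρ| ≤ 2 * ((1 + |u|) * (1 + ρ)) := by
      have : |τ - ρ| ≤ |u| + 2 * ρ := by
        rw [show τ - ρ = u - 2 * ρ by rw [hu]; ring]
        refine (abs_sub _ _).trans ?_
        rw [abs_of_pos (by positivity : 0 < 2 * ρ)]
      nlinarith [mul_nonneg hu0 hρ.le]
    have e3 : |τ| ≤ (1 + |u|) * (1 + ρ) := by
      have : |τ| ≤ |u| + ρ := by
        rw [show τ = u - ρ by rw [hu]; ring]
        refine (abs_sub _ _).trans ?_
        rw [abs_of_pos hρ]
      nlinarith [mul_nonneg hu0 hρ.le]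
    have e4 : (|τ| ^ (1 - 2 * H))⁻¹ ≤ (1 + |u|) * (1 + ρ) ^ (2 * H - 1) := by
      rw [← Real.rpow_neg hτ'.le, show -(1 - 2 * H) = 2 * H - 1 by ring]
      calc |τ| ^ (2 * H - 1) ≤ ((1 + |u|) * (1 + ρ)) ^ (2 * H - 1) := Real.rpow_le_rpow hτ'.le e3 (by linarith)
        _ = (1 + |u|) ^ (2 * H - 1) * (1 + ρ) ^ (2 * H - 1) := Real.mul_rpow (by positivity) (by positivity)
        _ ≤ (1 + |u|) ^ (1:ℝ) * (1 + ρ) ^ (2 * H - 1) := by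
          gcongr
          · linarith
          · linarith
        _ = _ := by rw [Real.rpow_one]
    have e5 : (1 + ρ) ^ (1 + 2 * H) = (1 + ρ) ^ 2 * (1 + ρ) ^ (2 * H - 1) := by
      rw [← Real.rpow_natCast, ← Real.rpow_add (by positivity)]; congr 1; push_cast; ring
    rw [e1, e5, div_eq_mul_inv]
    calc (|u| * |τ - ρ| * ‖η u‖) ^ 2 * (|τ| ^ (1 - 2 * H))⁻¹ ≤
        ((1 + |u|) * (2 * ((1 + |u|) * (1 + ρ))) * ‖η u‖) ^ 2 * ((1 + |u|) * (1 + ρ) ^ (2 * H - 1)) := by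
          gcongr
          linarith
      _ = _ := by ring
  refine (lintegral_mono_ae (hpt.mono fun τ h => ENNReal.ofReal_le_ofReal h)).trans ?_
  have hi2 := (hI.comp_add_right ρ).const_mul (4 * (1 + ρ) ^ (1 + 2 * H))
  rw [← ofReal_integral_eq_lintegral_ofReal hi2 (Filter.Eventually.of_forall fun ρ => by positivity)]
  apply ENNReal.ofReal_le_ofReal
  rw [integral_const_mul, integral_add_right_eq_self (fun u => (1 + |u|) ^ 5 * ‖η u‖ ^ 2) ρ, ← hM]
  have : 0 < (1 + ρ) ^ (1 + 2 * H) := by positivity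
  nlinarith

lemma B1 (H : ℝ) (hH1 : 1 / 2 ≤ H) (hH2 : H < 1) (a : ℝ) (ha : 0 < a) :
    ∃ κ : ℝ, 0 < κ ∧ ∀ (N n : ℕ) (z : Fin n → ℝ × EuclideanSpace ℝ (Fin N)) (c : Fin n → ℝ)
      (ξ : EuclideanSpace ℝ (Fin N)), ξ ≠ 0 → (∀ j, a ≤ (z j).1) →
      ENNReal.ofReal (κ * (‖∑ j, (c j : ℂ) * (Complex.exp (-Complex.I * ((inner ℝ (z j).2 ξ : ℝ) : ℂ)) *
        Complex.exp (Complex.I * ((z j).1 : ℂ) * (‖ξ‖ : ℂ)))‖ ^ 2 * (1 + ‖ξ‖) ^ (-1 - 2 * H))) ≤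
      ∫⁻ τ : ℝ, ENNReal.ofReal (‖∑ j, (c j : ℂ) * Gker N (z j).1 (z j).2 τ ξ‖ ^ 2 * |τ| ^ (1 - 2 * H)) := by
  obtain ⟨η, hc, he, hd, h1, hs⟩ := exists_eta_scaled a ha
  have hI := decay_integrable_sq η hc hd 5
  set M := ∫ u, (1 + |u|) ^ 5 * ‖η u‖ ^ 2 with hM
  have hM0 : 0 ≤ M := integral_nonneg fun u => by positivity
  refine ⟨(4 * (M + 1))⁻¹, by positivity, ?_⟩
  intro N n z c ξ hξ hz
  set ρ := ‖ξ‖ with hρdef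
  have hρ : 0 < ρ := norm_pos_iff.2 hξ
  set A := ∑ j, (c j : ℂ) * (Complex.exp (-Complex.I * ((inner ℝ (z j).2 ξ : ℝ) : ℂ)) *
        Complex.exp (Complex.I * ((z j).1 : ℂ) * (ρ : ℂ))) with hA
  set P : ℝ → ℂ := fun τ => ((τ : ℂ) ^ 2 - (ρ : ℂ) ^ 2) * η (τ + ρ) with hP
  have hpair : ∫ τ, (∑ j, (c j : ℂ) * Gker N (z j).1 (z j).2 τ ξ) * P τ = A := by
    simp_rw [Finset.sum_mul, mul_assoc]
    rw [integral_finsetSum _ (fun j _ => ((Gker_pair N a η hc he hd h1 hs (z j).1 ha (hz j) (z j).2 ξ hξ).1.const_mul _))]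
    refine Finset.sum_congr rfl fun j _ => ?_
    rw [integral_const_mul, (Gker_pair N a η hc he hd h1 hs (z j).1 ha (hz j) (z j).2 ξ hξ).2]
  have hFm : AEStronglyMeasurable (fun τ : ℝ => ∑ j, (c j : ℂ) * Gker N (z j).1 (z j).2 τ ξ) volume := by
    refine (Finset.measurable_fun_sum _ fun j _ => ?_).aestronglyMeasurable
    have := (Gker_measurable N (z j).1 (z j).2).comp (measurable_prodMk_right (y := ξ))
    exact Measurable.const_mul this _
  have hcs := cs_weight volume (fun τ : ℝ => ∑ j, (c j : ℂ) * Gker N (z j).1 (z j).2 τ ξ) P (fun τ => |τ| ^ (1 - 2 * H))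
    hFm
    (by apply Continuous.aestronglyMeasurable; fun_prop) (by fun_prop)
    (by
      have : ∀ᵐ x : ℝ, x ≠ 0 := by simp [ae_iff]
      filter_upwards [this] with x hx
      have := abs_pos.2 hx
      positivity)
  rw [hpair] at hcs
  have hbound : ∫⁻ τ, ENNReal.ofReal (‖P τ‖ ^ 2 / |τ| ^ (1 - 2 * H)) ≤ ENNReal.ofReal (4 * (M + 1) * (1 + ρ) ^ (1 + 2 * H)) :=
    B1_bound H hH1 hH2 η ρ M hρ hI hM
  have hfin := hcs.trans (mul_le_mul_right hbound _)
  have hpos : 0 < 4 * (M + 1) * (1 + ρ) ^ (1 + 2 * H) := by positivity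
  rw [← ENNReal.div_le_iff_le_mul (Or.inl (by simpa using hpos)) (Or.inl (by simp)), ← ENNReal.ofReal_div_of_pos hpos] at hfin
  refine le_trans (le_of_eq ?_) hfin
  congr 1
  rw [show -1 - 2 * H = -(1 + 2 * H) by ring, Real.rpow_neg (by positivity)]
  field_simp

open MeasureTheory Set
open scoped ENNReal

lemma small_rpow_integrable (θ : ℝ) (hθ : θ < 1) :
    Integrable (fun τ : ℝ => if |τ| ≤ 1 then |τ| ^ (-θ) else 0) := by
  have := (integrable_fun_norm_addHaar (E := ℝ) (F := ℝ) volume (f := fun y => if y ≤ 1 then y ^ (-θ) else 0)).2 (by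
    simp only [Module.finrank_self, tsub_self, pow_zero, one_smul]
    have h1 : IntegrableOn (fun y : ℝ => y ^ (-θ)) (Ioc 0 1) := by
      have := intervalIntegral.intervalIntegrable_rpow' (a := 0) (b := 1) (r := -θ) (by linarith)
      rwa [intervalIntegrable_iff_integrableOn_Ioc_of_le zero_le_one] at this
    have h2 : IntegrableOn (fun y : ℝ => if y ≤ 1 then y ^ (-θ) else 0) (Ioc 0 1) :=
      h1.congr_fun (fun y hy => by simp [hy.2]) measurableSet_Ioc
    have h3 : IntegrableOn (fun y : ℝ => if y ≤ 1 then y ^ (-θ) else 0) (Ioi 1) :=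
      (integrableOn_zero (ε' := ℝ)).congr_fun (fun y hy => by
        have : ¬ y ≤ 1 := not_le.2 hy
        simp [this]) measurableSet_Ioi
    rw [← Ioc_union_Ioi_eq_Ioi zero_le_one]
    exact h2.union h3)
  simpa using this

lemma tau_bound (θ : ℝ) (h0 : 0 ≤ θ) (h1 : θ < 1) : ∃ C : ℝ, 0 < C ∧ ∀ ρ : ℝ,
    ∫⁻ τ : ℝ, ENNReal.ofReal (((1 + |τ - ρ|) ^ 2)⁻¹ * |τ| ^ (-θ)) ≤ ENNReal.ofReal (C * (1 + |ρ|) ^ (-θ)) := by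
  have i1 := small_rpow_integrable θ h1
  have i2 := integrable_one_add_norm (E := ℝ) (μ := volume) (r := 2 - θ) (by simp; linarith)
  have i3 := integrable_one_add_norm (E := ℝ) (μ := volume) (r := 2) (by simp)
  set A1 := ∫ τ : ℝ, (if |τ| ≤ 1 then |τ| ^ (-θ) else 0)
  set A2 := ∫ x : ℝ, (1 + ‖x‖) ^ (-(2 - θ))
  set A3 := ∫ x : ℝ, (1 + ‖x‖) ^ (-2 : ℝ)
  have p1 : 0 ≤ A1 := integral_nonneg fun τ => by dsimp only; split_ifs <;> positivity
  have p2 : 0 ≤ A2 := integral_nonneg fun τ => by dsimp only; positivity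
  have p3 : 0 ≤ A3 := integral_nonneg fun τ => by dsimp only; positivity
  refine ⟨A1 + A2 + A3 + 1, by linarith, fun ρ => ?_⟩
  have hR : 0 < (1 + |ρ|) ^ (-θ) := by positivity
  have hpt : ∀ᵐ τ : ℝ, ((1 + |τ - ρ|) ^ 2)⁻¹ * |τ| ^ (-θ) ≤ (1 + |ρ|) ^ (-θ) *
      ((if |τ| ≤ 1 then |τ| ^ (-θ) else 0) + (1 + ‖τ - ρ‖) ^ (-(2 - θ)) + (1 + ‖τ - ρ‖) ^ (-2 : ℝ)) := by
    have : ∀ᵐ x : ℝ, x ≠ 0 := by simp [ae_iff]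
    filter_upwards [this] with τ hτ
    have hτ' := abs_pos.2 hτ
    rw [Real.norm_eq_abs]
    set s := 1 + |τ - ρ| with hs
    have hs1 : 1 ≤ s := by rw [hs]; linarith [abs_nonneg (τ - ρ)]
    have hsp : 0 < s := by linarith
    have e0 : 1 + |ρ| ≤ s + |τ| := by
      rw [hs]
      have : |ρ| ≤ |τ - ρ| + |τ| := by
        have := abs_sub τ (τ - ρ)
        rw [sub_sub_cancel] at this; linarith
      linarith
    have e1 : (1 + |ρ|) ^ θ ≤ s ^ θ + |τ| ^ θ :=
      (Real.rpow_le_rpow (by positivity) e0 h0).trans (Real.rpow_add_le_add_rpow hsp.le hτ'.le h0 h1.le)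
    have e2 : |τ| ^ θ * |τ| ^ (-θ) = 1 := by rw [← Real.rpow_add hτ']; simp
    have e3 : (1 + |ρ|) ^ θ * (1 + |ρ|) ^ (-θ) = 1 := by rw [← Real.rpow_add (by positivity)]; simp
    have e4 : (s ^ 2)⁻¹ = s ^ (-2 : ℝ) := by
      rw [Real.rpow_neg hsp.le]; norm_cast
    have e5 : s ^ (-2:ℝ) * s ^ θ = s ^ (-(2 - θ)) := by rw [← Real.rpow_add hsp]; ring_nf
    have e6 : s ^ (-(2 - θ)) * |τ| ^ (-θ) ≤ (if |τ| ≤ 1 then |τ| ^ (-θ) else 0) + s ^ (-(2 - θ)) := by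
      split_ifs with h
      · have : s ^ (-(2 - θ)) ≤ 1 := Real.rpow_le_one_of_one_le_of_nonpos hs1 (by linarith)
        have q : 0 < |τ| ^ (-θ) := by positivity
        have q' : 0 < s ^ (-(2 - θ)) := by positivity
        nlinarith
      · have : |τ| ^ (-θ) ≤ 1 := Real.rpow_le_one_of_one_le_of_nonpos (by linarith) (by linarith)
        have q' : 0 < s ^ (-(2 - θ)) := by positivity
        nlinarith
    rw [e4]
    calc s ^ (-2:ℝ) * |τ| ^ (-θ) = (1 + |ρ|) ^ (-θ) * (s ^ (-2:ℝ) * |τ| ^ (-θ) * (1 + |ρ|) ^ θ) := by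
          linear_combination (-(s ^ (-2:ℝ) * |τ| ^ (-θ))) * e3
      _ ≤ (1 + |ρ|) ^ (-θ) * (s ^ (-2:ℝ) * |τ| ^ (-θ) * (s ^ θ + |τ| ^ θ)) := by gcongr
      _ = (1 + |ρ|) ^ (-θ) * (s ^ (-(2 - θ)) * |τ| ^ (-θ) + s ^ (-2:ℝ)) := by
          rw [← e5]; linear_combination ((1 + |ρ|) ^ (-θ) * s ^ (-2:ℝ)) * e2
      _ ≤ _ := by gcongr
  refine (lintegral_mono_ae (hpt.mono fun τ h => ENNReal.ofReal_le_ofReal h)).trans ?_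
  have j2 := i2.comp_sub_right ρ
  have j3 := i3.comp_sub_right ρ
  have j12 : Integrable (fun τ : ℝ => (if |τ| ≤ 1 then |τ| ^ (-θ) else 0) + (1 + ‖τ - ρ‖) ^ (-(2 - θ))) := i1.add j2
  have j123 : Integrable (fun τ : ℝ => (if |τ| ≤ 1 then |τ| ^ (-θ) else 0) + (1 + ‖τ - ρ‖) ^ (-(2 - θ)) + (1 + ‖τ - ρ‖) ^ (-2 : ℝ)) := j12.add j3
  rw [← ofReal_integral_eq_lintegral_ofReal (j123.const_mul _) (Filter.Eventually.of_forall fun τ => by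
    dsimp only [Pi.zero_apply]; split_ifs <;> positivity)]
  apply ENNReal.ofReal_le_ofReal
  rw [integral_const_mul, integral_add j12 j3, integral_add i1 j2, mul_comm]
  have q2 : ∫ τ : ℝ, (1 + ‖τ - ρ‖) ^ (-(2 - θ)) = A2 := integral_sub_right_eq_self (fun x : ℝ => (1 + ‖x‖) ^ (-(2 - θ))) ρ
  have q3 : ∫ τ : ℝ, (1 + ‖τ - ρ‖) ^ (-2 : ℝ) = A3 := integral_sub_right_eq_self (fun x : ℝ => (1 + ‖x‖) ^ (-2:ℝ)) ρ
  rw [q2, q3]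
  refine mul_le_mul_of_nonneg_right ?_ hR.le
  change A1 + A2 + A3 ≤ _
  linarith

lemma exp_diff_le (a b : ℝ) : ‖Complex.exp (Complex.I * (a : ℂ)) - Complex.exp (Complex.I * (b : ℂ))‖ ≤ |a - b| := by
  have e : Complex.exp (Complex.I * (a : ℂ)) - Complex.exp (Complex.I * (b : ℂ)) =
      Complex.exp (Complex.I * (b : ℂ)) * (Complex.exp (Complex.I * ((a - b : ℝ) : ℂ)) - 1) := by
    rw [mul_sub, ← Complex.exp_add]; push_cast; ring_nf
  rw [e, norm_mul, norm_exp_I_real, one_mul]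
  exact Real.norm_exp_I_mul_ofReal_sub_one_le

lemma exp_diff_le_two (a b : ℝ) : ‖Complex.exp (Complex.I * (a : ℂ)) - Complex.exp (Complex.I * (b : ℂ))‖ ≤ 2 := by
  refine (norm_sub_le _ _).trans ?_
  rw [norm_exp_I_real, norm_exp_I_real]; norm_num

lemma quot_bound (t : ℝ) (ht : 0 ≤ t) (a b u : ℝ) (hu : |a - b| = t * |u|) :
    ‖(Complex.exp (Complex.I * (a : ℂ)) - Complex.exp (Complex.I * (b : ℂ))) / (u : ℂ)‖ ≤ (t + 2) * (1 + |u|)⁻¹ := by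
  rw [norm_div, Complex.norm_real, Real.norm_eq_abs]
  by_cases h : u = 0
  · rw [h]; simp; linarith
  have hu' := abs_pos.2 h
  rw [div_le_iff₀ hu', mul_assoc, mul_comm _ |u|, ← mul_assoc, ← div_eq_mul_inv, le_div_iff₀ (by positivity)]
  have h1 := exp_diff_le a b
  have h2 := exp_diff_le_two a b
  rw [hu] at h1
  nlinarith [norm_nonneg (Complex.exp (Complex.I * (a : ℂ)) - Complex.exp (Complex.I * (b : ℂ)))]

lemma Gker_eq (N : ℕ) (t : ℝ) (x : EuclideanSpace ℝ (Fin N)) (τ : ℝ) (ξ : EuclideanSpace ℝ (Fin N)) :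
    Gker N t x τ ξ = (Complex.exp (Complex.I * ((-inner ℝ x ξ : ℝ) : ℂ)) / (2 * (‖ξ‖ : ℂ))) *
    ((Complex.exp (Complex.I * ((-(t * τ) : ℝ) : ℂ)) - Complex.exp (Complex.I * ((t * ‖ξ‖ : ℝ) : ℂ))) / ((τ + ‖ξ‖ : ℝ) : ℂ) -
      (Complex.exp (Complex.I * ((-(t * τ) : ℝ) : ℂ)) -
        Complex.exp (Complex.I * ((-(t * ‖ξ‖) : ℝ) : ℂ))) / ((τ - ‖ξ‖ : ℝ) : ℂ)) := by
  unfold Gker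
  push_cast
  ring_nf

lemma Gker_big (N : ℕ) (t : ℝ) (ht : 0 ≤ t) (x : EuclideanSpace ℝ (Fin N)) (τ : ℝ) (ξ : EuclideanSpace ℝ (Fin N)) :
    ‖Gker N t x τ ξ‖ ≤ (t + 2) / (2 * ‖ξ‖) * ((1 + |τ + ‖ξ‖|)⁻¹ + (1 + |τ - ‖ξ‖|)⁻¹) := by
  rw [Gker_eq, norm_mul, norm_div, norm_exp_I_real]
  have e : ‖(2 : ℂ) * (‖ξ‖ : ℂ)‖ = 2 * ‖ξ‖ := by simp
  rw [e, div_mul_eq_mul_div, div_mul_eq_mul_div, one_mul]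
  gcongr
  refine (norm_sub_le _ _).trans ?_
  rw [mul_add]
  apply add_le_add
  · apply quot_bound t ht
    rw [show -(t * τ) - t * ‖ξ‖ = -(t * (τ + ‖ξ‖)) by ring, abs_neg, abs_mul, abs_of_nonneg ht]
  · apply quot_bound t ht
    rw [show -(t * τ) - -(t * ‖ξ‖) = -(t * (τ - ‖ξ‖)) by ring, abs_neg, abs_mul, abs_of_nonneg ht]

lemma psi_eq (t u : ℝ) (hu : u ≠ 0) :
    (1 - Complex.exp (Complex.I * ((t * u : ℝ) : ℂ))) / (u : ℂ) =
      -Complex.I * ∫ s in (0:ℝ)..t, Complex.exp (Complex.I * ((s * u : ℝ) : ℂ)) := by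
  have hu' : (u : ℂ) ≠ 0 := by exact_mod_cast hu
  have e : ∀ s : ℝ, Complex.exp (Complex.I * ((s * u : ℝ) : ℂ)) = Complex.exp ((Complex.I * u) * (s : ℂ)) := by
    intro s; congr 1; push_cast; ring
  simp_rw [e]
  rw [integral_exp_mul_complex (mul_ne_zero Complex.I_ne_zero hu')]
  field_simp
  simp only [Complex.ofReal_zero, mul_zero, Complex.exp_zero]
  ring

lemma Gker_small (N : ℕ) (t : ℝ) (ht : 0 ≤ t) (x : EuclideanSpace ℝ (Fin N)) (τ : ℝ) (ξ : EuclideanSpace ℝ (Fin N))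
    (hξ : ξ ≠ 0) (h1 : τ ≠ ‖ξ‖) (h2 : τ ≠ -‖ξ‖) :
    ‖Gker N t x τ ξ‖ ≤ t ^ 2 := by
  have hρ : 0 < ‖ξ‖ := norm_pos_iff.2 hξ
  rw [Gker_eq]
  have e : ‖(2 : ℂ) * (‖ξ‖ : ℂ)‖ = 2 * ‖ξ‖ := by simp
  have e1 : (Complex.exp (Complex.I * ((-(t * τ) : ℝ) : ℂ)) - Complex.exp (Complex.I * ((t * ‖ξ‖ : ℝ) : ℂ))) / ((τ + ‖ξ‖ : ℝ) : ℂ)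
      = Complex.exp (Complex.I * ((-(t * τ) : ℝ) : ℂ)) * ((1 - Complex.exp (Complex.I * ((t * (τ + ‖ξ‖) : ℝ) : ℂ))) / ((τ + ‖ξ‖ : ℝ) : ℂ)) := by
    rw [mul_div_assoc', mul_sub, ← Complex.exp_add, mul_one]
    congr 3
    push_cast; ring_nf
  have e2 : (Complex.exp (Complex.I * ((-(t * τ) : ℝ) : ℂ)) - Complex.exp (Complex.I * ((-(t * ‖ξ‖) : ℝ) : ℂ))) / ((τ - ‖ξ‖ : ℝ) : ℂ)
      = Complex.exp (Complex.I * ((-(t * τ) : ℝ) : ℂ)) * ((1 - Complex.exp (Complex.I * ((t * (τ - ‖ξ‖) : ℝ) : ℂ))) / ((τ - ‖ξ‖ : ℝ) : ℂ)) := by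
    rw [mul_div_assoc', mul_sub, ← Complex.exp_add, mul_one]
    congr 3
    push_cast; ring_nf
  rw [e1, e2, psi_eq t _ (by intro h; apply h2; linarith), psi_eq t _ (by intro h; apply h1; linarith), ← mul_sub, ← mul_sub,
    ← intervalIntegral.integral_sub (by apply Continuous.intervalIntegrable; fun_prop) (by apply Continuous.intervalIntegrable; fun_prop),
    norm_mul, norm_div, norm_exp_I_real, e, norm_mul, norm_exp_I_real, norm_mul]
  have hb := intervalIntegral.norm_integral_le_of_norm_le_const (a := 0) (b := t) (C := t * (2 * ‖ξ‖))
    (f := fun s : ℝ => Complex.exp (Complex.I * ((s * (τ + ‖ξ‖) : ℝ) : ℂ)) - Complex.exp (Complex.I * ((s * (τ - ‖ξ‖) : ℝ) : ℂ))) (by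
      intro s hs
      rw [uIoc_of_le ht] at hs
      refine (exp_diff_le _ _).trans ?_
      rw [show s * (τ + ‖ξ‖) - s * (τ - ‖ξ‖) = s * (2 * ‖ξ‖) by ring, abs_of_nonneg (by have := hs.1.le; positivity)]
      gcongr
      exact hs.2)
  rw [sub_zero, abs_of_nonneg ht] at hb
  rw [norm_neg, Complex.norm_I, one_mul, one_mul, one_div, inv_mul_le_iff₀ (by positivity)]
  refine hb.trans (le_of_eq (by ring))

lemma Gker_low (N : ℕ) (t : ℝ) (ht : 0 ≤ t) (x : EuclideanSpace ℝ (Fin N)) (τ : ℝ) (ξ : EuclideanSpace ℝ (Fin N))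
    (hξ : ξ ≠ 0) (hξ1 : ‖ξ‖ ≤ 1) (h1 : τ ≠ ‖ξ‖) (h2 : τ ≠ -‖ξ‖) :
    ‖Gker N t x τ ξ‖ ≤ 4 * (1 + t) ^ 2 * (1 + |τ|)⁻¹ := by
  have hρ : 0 < ‖ξ‖ := norm_pos_iff.2 hξ
  have h0 := abs_nonneg τ
  rw [← div_eq_mul_inv, le_div_iff₀ (by positivity)]
  rcases le_or_gt |τ| 2 with h | h
  · have := Gker_small N t ht x τ ξ hξ h1 h2
    calc _ ≤ t ^ 2 * (1 + 2) := by gcongr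
      _ ≤ _ := by nlinarith
  · have hm := Gker_mul N t x τ ξ hξ h1 h2
    have hm2 : ‖Gker N t x τ ξ‖ * (τ ^ 2 - ‖ξ‖ ^ 2) ≤ 2 + t * |τ| := by
      have e0 : ‖(τ : ℂ) ^ 2 - (‖ξ‖ : ℂ) ^ 2‖ = τ ^ 2 - ‖ξ‖ ^ 2 := by
        rw [show (τ : ℂ) ^ 2 - (‖ξ‖ : ℂ) ^ 2 = ((τ ^ 2 - ‖ξ‖ ^ 2 : ℝ) : ℂ) by push_cast; ring, Complex.norm_real, Real.norm_eq_abs, abs_of_nonneg]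
        nlinarith [sq_abs τ]
      have hm' := congrArg norm hm
      rw [norm_mul, e0] at hm'
      rw [hm', norm_mul, norm_div]
      have q1 : ‖Complex.exp (-Complex.I * ((inner ℝ x ξ : ℝ) : ℂ))‖ = 1 := by
        rw [show -Complex.I * ((inner ℝ x ξ : ℝ) : ℂ) = Complex.I * ((-inner ℝ x ξ : ℝ) : ℂ) by push_cast; ring, norm_exp_I_real]
      have q2 : ‖(2 : ℂ) * (‖ξ‖ : ℂ)‖ = 2 * ‖ξ‖ := by simp
      rw [q1, q2, one_div, inv_mul_le_iff₀ (by positivity)]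
      have a1 : Complex.exp (-Complex.I * (t : ℂ) * (τ : ℂ)) = Complex.exp (Complex.I * ((-(t * τ) : ℝ) : ℂ)) := by
        congr 1; push_cast; ring
      have a2 : Complex.exp (Complex.I * (t : ℂ) * (‖ξ‖ : ℂ)) = Complex.exp (Complex.I * ((t * ‖ξ‖ : ℝ) : ℂ)) := by
        congr 1; push_cast; ring
      have a3 : Complex.exp (-Complex.I * (t : ℂ) * (‖ξ‖ : ℂ)) = Complex.exp (Complex.I * ((-(t * ‖ξ‖) : ℝ) : ℂ)) := by
        congr 1; push_cast; ring
      rw [a1, a2, a3]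
      have hdiff := exp_diff_le (t * ‖ξ‖) (-(t * ‖ξ‖))
      rw [show t * ‖ξ‖ - -(t * ‖ξ‖) = 2 * t * ‖ξ‖ by ring, abs_of_nonneg (by positivity)] at hdiff
      set E := Complex.exp (Complex.I * ((-(t * τ) : ℝ) : ℂ)) with hE
      set ep := Complex.exp (Complex.I * ((t * ‖ξ‖ : ℝ) : ℂ)) with hep
      set em := Complex.exp (Complex.I * ((-(t * ‖ξ‖) : ℝ) : ℂ)) with hem
      have n1 : ‖E‖ = 1 := norm_exp_I_real _
      have n2 : ‖ep‖ = 1 := norm_exp_I_real _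
      have n3 : ‖em‖ = 1 := norm_exp_I_real _
      have e4 : -2 * (‖ξ‖ : ℂ) * E - ep * ((τ : ℂ) - ‖ξ‖) + em * ((τ : ℂ) + ‖ξ‖) = (‖ξ‖ : ℂ) * (ep + em - 2 * E) - (τ : ℂ) * (ep - em) := by ring
      rw [e4]
      refine (norm_sub_le _ _).trans ?_
      rw [norm_mul, norm_mul, Complex.norm_real, Complex.norm_real, norm_norm, Real.norm_eq_abs]
      have e5 : ‖ep + em - 2 * E‖ ≤ 4 := by
        refine (norm_sub_le _ _).trans ?_
        have := norm_add_le ep em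
        rw [norm_mul, n1]
        norm_num
        linarith
      calc ‖ξ‖ * ‖ep + em - 2 * E‖ + |τ| * ‖ep - em‖ ≤ ‖ξ‖ * 4 + |τ| * (2 * t * ‖ξ‖) := by gcongr
        _ = _ := by ring
    have e6 : τ ^ 2 - ‖ξ‖ ^ 2 ≥ 3 / 4 * |τ| ^ 2 := by
      rw [← sq_abs τ]; nlinarith
    have e7 : ‖Gker N t x τ ξ‖ * (3 / 4 * |τ| ^ 2) ≤ 2 + t * |τ| := le_trans (by gcongr) hm2
    set g := ‖Gker N t x τ ξ‖
    have hg : 0 ≤ g := norm_nonneg _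
    have e8 : g * |τ| * (3 / 4) ≤ 1 + t := by
      have : (g * |τ| * (3/4)) * |τ| ≤ (1 + t) * |τ| := by nlinarith
      exact le_of_mul_le_mul_right this (by linarith)
    nlinarith [mul_nonneg hg h0]

lemma Gker_tau (H : ℝ) (hH1 : 1 / 2 ≤ H) (hH2 : H < 1) (t : ℝ) (ht : 0 ≤ t) : ∃ C : ℝ, 0 < C ∧
    ∀ (N : ℕ) (x ξ : EuclideanSpace ℝ (Fin N)), ξ ≠ 0 →
      ∫⁻ τ : ℝ, ENNReal.ofReal (‖Gker N t x τ ξ‖ ^ 2 * |τ| ^ (1 - 2 * H)) ≤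
        ENNReal.ofReal (C * (1 + ‖ξ‖) ^ (-1 - 2 * H)) := by
  obtain ⟨C0, hC0, hC⟩ := tau_bound (2 * H - 1) (by linarith) (by linarith)
  set K := 4 * (1 + t) ^ 2 with hK
  have hKp : 0 < K := by positivity
  refine ⟨8 * K ^ 2 * C0 + 4 * (t + 2) ^ 2 * C0, by positivity, ?_⟩
  intro N x ξ hξ
  have hρ : 0 < ‖ξ‖ := norm_pos_iff.2 hξ
  set ρ := ‖ξ‖ with hρdef
  have hexp : -(2 * H - 1) = 1 - 2 * H := by ring
  rw [hexp] at hC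
  have hR : 0 < (1 + ρ) ^ (-1 - 2 * H) := by positivity
  rcases le_or_gt ρ 1 with h | h
  · have q1 : ∀ᵐ x : ℝ, x ≠ ρ := by simp [ae_iff]
    have q2 : ∀ᵐ x : ℝ, x ≠ -ρ := by simp [ae_iff]
    have : ∀ᵐ τ : ℝ, ENNReal.ofReal (‖Gker N t x τ ξ‖ ^ 2 * |τ| ^ (1 - 2 * H)) ≤
        ENNReal.ofReal (K ^ 2) * ENNReal.ofReal (((1 + |τ - 0|) ^ 2)⁻¹ * |τ| ^ (1 - 2 * H)) := by
      filter_upwards [q1, q2] with τ h1 h2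
      rw [← ENNReal.ofReal_mul (by positivity)]
      apply ENNReal.ofReal_le_ofReal
      have := Gker_low N t ht x τ ξ hξ h h1 h2
      rw [← mul_assoc]
      refine mul_le_mul_of_nonneg_right ?_ (by positivity)
      refine (pow_le_pow_left₀ (norm_nonneg _) this 2).trans (le_of_eq ?_)
      rw [sub_zero, mul_pow, inv_pow]
    refine (lintegral_mono_ae this).trans ?_
    rw [lintegral_const_mul' _ _ (by simp)]
    refine (mul_le_mul_right (hC 0) _).trans ?_
    rw [← ENNReal.ofReal_mul (by positivity)]
    apply ENNReal.ofReal_le_ofReal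
    simp only [abs_zero, add_zero, Real.one_rpow, mul_one]
    have e1 : (1:ℝ) ≤ 8 * (1 + ρ) ^ (-1 - 2 * H) := by
      have : (8:ℝ)⁻¹ ≤ (1 + ρ) ^ (-1 - 2 * H) := by
        calc (8:ℝ)⁻¹ = (2:ℝ) ^ (-3:ℝ) := by
              rw [Real.rpow_neg (by norm_num)]; norm_num
          _ ≤ (1 + ρ) ^ (-3:ℝ) := Real.rpow_le_rpow_of_nonpos (by positivity) (by linarith) (by norm_num)
          _ ≤ _ := Real.rpow_le_rpow_of_exponent_le (by linarith) (by linarith)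
      linarith
    calc K ^ 2 * C0 = K ^ 2 * C0 * 1 := by ring
      _ ≤ K ^ 2 * C0 * (8 * (1 + ρ) ^ (-1 - 2 * H)) := by gcongr
      _ = 8 * K ^ 2 * C0 * (1 + ρ) ^ (-1 - 2 * H) := by ring
      _ ≤ _ := by gcongr; linarith [show 0 < 4 * (t + 2) ^ 2 * C0 by positivity]
  · have : ∀ τ : ℝ, ENNReal.ofReal (‖Gker N t x τ ξ‖ ^ 2 * |τ| ^ (1 - 2 * H)) ≤
        ENNReal.ofReal ((t + 2) ^ 2 / (2 * ρ ^ 2)) * (ENNReal.ofReal (((1 + |τ - (-ρ)|) ^ 2)⁻¹ * |τ| ^ (1 - 2 * H)) +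
         ENNReal.ofReal (((1 + |τ - ρ|) ^ 2)⁻¹ * |τ| ^ (1 - 2 * H))) := by
      intro τ
      rw [← ENNReal.ofReal_add (by positivity) (by positivity), ← ENNReal.ofReal_mul (by positivity)]
      apply ENNReal.ofReal_le_ofReal
      have := Gker_big N t ht x τ ξ
      rw [← hρdef] at this
      rw [← add_mul, ← mul_assoc]
      refine mul_le_mul_of_nonneg_right ?_ (by positivity)
      refine (pow_le_pow_left₀ (norm_nonneg _) this 2).trans ?_
      rw [sub_neg_eq_add, ← inv_pow, ← inv_pow]
      set A := (1 + |τ + ρ|)⁻¹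
      set B := (1 + |τ - ρ|)⁻¹
      rw [mul_pow, show ((t + 2) / (2 * ρ)) ^ 2 = (t + 2) ^ 2 / (2 * ρ ^ 2) * (1 / 2) by field_simp, mul_assoc]
      gcongr
      nlinarith [sq_nonneg (A - B)]
    refine (lintegral_mono this).trans ?_
    rw [lintegral_const_mul' _ _ (by simp), lintegral_add_left (by fun_prop)]
    refine (mul_le_mul_right (add_le_add (hC (-ρ)) (hC ρ)) _).trans ?_
    rw [← ENNReal.ofReal_add (by positivity) (by positivity), ← ENNReal.ofReal_mul (by positivity)]
    apply ENNReal.ofReal_le_ofReal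
    rw [abs_neg, abs_of_pos hρ]
    have e1 : (1 + ρ) ^ (-1 - 2 * H) = (1 + ρ) ^ (1 - 2 * H) * ((1 + ρ) ^ 2)⁻¹ := by
      rw [← Real.rpow_natCast, ← Real.rpow_neg (by positivity), ← Real.rpow_add (by positivity)]
      congr 1; push_cast; ring
    have e2 : (ρ ^ 2)⁻¹ ≤ 4 * ((1 + ρ) ^ 2)⁻¹ := by
      rw [← div_eq_mul_inv, inv_le_comm₀ (by positivity) (by positivity), inv_div, div_le_iff₀ (by positivity)]
      nlinarith
    have hS : 0 < (1 + ρ) ^ (1 - 2 * H) := by positivity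
    calc (t + 2) ^ 2 / (2 * ρ ^ 2) * (C0 * (1 + ρ) ^ (1 - 2 * H) + C0 * (1 + ρ) ^ (1 - 2 * H))
        = (t + 2) ^ 2 * C0 * (1 + ρ) ^ (1 - 2 * H) * (ρ ^ 2)⁻¹ := by field_simp; ring
      _ ≤ (t + 2) ^ 2 * C0 * (1 + ρ) ^ (1 - 2 * H) * (4 * ((1 + ρ) ^ 2)⁻¹) := by gcongr
      _ = 4 * (t + 2) ^ 2 * C0 * (1 + ρ) ^ (-1 - 2 * H) := by rw [e1]; ring
      _ ≤ _ := by gcongr; linarith [show 0 < 8 * K ^ 2 * C0 by positivity]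

lemma xi_integrable (N : ℕ) (hN : 1 ≤ N) (H β : ℝ) (hβN : β < N) (hβlow : (N : ℝ) - 2 * H - 1 < β) (hH : 0 ≤ H) :
    Integrable (fun ξ : EuclideanSpace ℝ (Fin N) => (1 + ‖ξ‖) ^ (-1 - 2 * H) * ‖ξ‖ ^ (-β)) := by
  have : Nonempty (Fin N) := ⟨⟨0, hN⟩⟩
  refine (integrable_fun_norm_addHaar (E := EuclideanSpace ℝ (Fin N)) volume
    (f := fun y : ℝ => (1 + y) ^ (-1 - 2 * H) * y ^ (-β))).2 ?_
  simp only [finrank_euclideanSpace, Fintype.card_fin, smul_eq_mul]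
  have hmeas : Measurable (fun y : ℝ => y ^ (N - 1) * ((1 + y) ^ (-1 - 2 * H) * y ^ (-β))) := by fun_prop
  have hpow : ∀ y : ℝ, 0 < y → y ^ (N - 1) * y ^ (-β) = y ^ ((N : ℝ) - 1 - β) := by
    intro y hy
    rw [← Real.rpow_natCast, ← Real.rpow_add hy]; congr 1
    rw [Nat.cast_sub hN]; push_cast; ring
  rw [← Ioc_union_Ioi_eq_Ioi zero_le_one]
  refine IntegrableOn.union ?_ ?_
  · have h1 : IntegrableOn (fun y : ℝ => y ^ ((N : ℝ) - 1 - β)) (Ioc 0 1) := by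
      have := intervalIntegral.intervalIntegrable_rpow' (a := 0) (b := 1) (r := (N : ℝ) - 1 - β) (by linarith)
      rwa [intervalIntegrable_iff_integrableOn_Ioc_of_le zero_le_one] at this
    refine h1.mono' hmeas.aestronglyMeasurable ?_
    refine (ae_restrict_iff' measurableSet_Ioc).2 (Filter.Eventually.of_forall fun y hy => ?_)
    have hy0 := hy.1
    rw [Real.norm_eq_abs, abs_of_nonneg (by positivity), mul_left_comm, hpow y hy0]
    have : (1 + y) ^ (-1 - 2 * H) ≤ 1 := Real.rpow_le_one_of_one_le_of_nonpos (by linarith) (by linarith)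
    have h3 : 0 < y ^ ((N : ℝ) - 1 - β) := by positivity
    nlinarith
  · have h1 := integrableOn_Ioi_rpow_of_lt (a := (N : ℝ) - 2 - β - 2 * H) (c := 1) (by linarith) one_pos
    refine h1.mono' hmeas.aestronglyMeasurable ?_
    refine (ae_restrict_iff' measurableSet_Ioi).2 (Filter.Eventually.of_forall fun y hy => ?_)
    have hy1 : 1 < y := hy
    have hy0 : 0 < y := by linarith
    rw [Real.norm_eq_abs, abs_of_nonneg (by positivity), mul_left_comm, hpow y hy0]
    have : (1 + y) ^ (-1 - 2 * H) ≤ y ^ (-1 - 2 * H) := Real.rpow_le_rpow_of_nonpos hy0 (by linarith) (by linarith)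
    calc (1 + y) ^ (-1 - 2 * H) * y ^ ((N : ℝ) - 1 - β) ≤ y ^ (-1 - 2 * H) * y ^ ((N : ℝ) - 1 - β) := by gcongr
      _ = _ := by rw [← Real.rpow_add hy0]; congr 1; ring

open MeasureTheory Set
open scoped ENNReal

lemma ae_ne_zero_euclid (N : ℕ) (hN : 1 ≤ N) : ∀ᵐ ξ : EuclideanSpace ℝ (Fin N), ξ ≠ 0 := by
  have : Nonempty (Fin N) := ⟨⟨0, hN⟩⟩
  simp [ae_iff]

lemma sum_Gker_measurable (N n : ℕ) (z : Fin n → ℝ × EuclideanSpace ℝ (Fin N)) (c : Fin n → ℝ) :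
    Measurable (fun q : ℝ × EuclideanSpace ℝ (Fin N) => ∑ j, (c j : ℂ) * Gker N (z j).1 (z j).2 q.1 q.2) := by
  refine Finset.measurable_fun_sum _ fun j _ => ?_
  exact Measurable.const_mul (Gker_measurable N (z j).1 (z j).2) _

lemma Gker_measurable_tau (N : ℕ) (t : ℝ) (x ξ : EuclideanSpace ℝ (Fin N)) :
    Measurable (fun τ : ℝ => Gker N t x τ ξ) := by
  unfold Gker
  fun_prop

set_option maxHeartbeats 1000000 in
lemma Q_ge (N : ℕ) (hN : 1 ≤ N) (H β : ℝ) (hH1 : 1 / 2 ≤ H) (hH2 : H < 1)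
    (hβN : β < N) (hβlow : (N : ℝ) - 2 * H - 1 < β)
    (hfun : EuclideanSpace ℝ (Fin N) → ℝ) (hmeas : Measurable hfun)
    (c₁ c₂ : ℝ) (hc₁ : 0 < c₁) (hc₁₂ : c₁ ≤ c₂)
    (hflow : ∀ ξ : EuclideanSpace ℝ (Fin N), ξ ≠ 0 → c₁ * ‖ξ‖ ^ (-β) ≤ hfun ξ)
    (hfup : ∀ ξ : EuclideanSpace ℝ (Fin N), ξ ≠ 0 → hfun ξ ≤ c₂ * ‖ξ‖ ^ (-β))
    (n : ℕ) (z : Fin n → ℝ × EuclideanSpace ℝ (Fin N)) (hz : ∀ j, 0 ≤ (z j).1) (c : Fin n → ℝ) :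
    ENNReal.ofReal (Qvar N H hfun z c) = ∫⁻ ξ : EuclideanSpace ℝ (Fin N), ENNReal.ofReal (hfun ξ) *
      ∫⁻ τ : ℝ, ENNReal.ofReal (‖∑ j, (c j : ℂ) * Gker N (z j).1 (z j).2 τ ξ‖ ^ 2 * |τ| ^ (1 - 2 * H)) := by
  have hne := ae_ne_zero_euclid N hN
  set h' : EuclideanSpace ℝ (Fin N) → ℝ := fun ξ => max (hfun ξ) 0 with hh'
  have hQ : Qvar N H hfun z c = ∫ τ : ℝ, ∫ ξ : EuclideanSpace ℝ (Fin N),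
      ‖∑ j, (c j : ℂ) * Gker N (z j).1 (z j).2 τ ξ‖ ^ 2 * |τ| ^ (1 - 2 * H) * h' ξ := by
    unfold Qvar
    congr 1; ext τ
    apply integral_congr_ae
    filter_upwards [hne] with ξ hξ
    have : 0 ≤ hfun ξ := le_trans (by positivity) (hflow ξ hξ)
    simp only [hh', max_eq_left this]
  set f : ℝ × EuclideanSpace ℝ (Fin N) → ℝ := fun q =>
    ‖∑ j, (c j : ℂ) * Gker N (z j).1 (z j).2 q.1 q.2‖ ^ 2 * |q.1| ^ (1 - 2 * H) * h' q.2 with hf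
  have hfm : Measurable f := by
    have := sum_Gker_measurable N n z c
    fun_prop
  have hf0 : ∀ q, 0 ≤ f q := fun q => by
    have : 0 ≤ h' q.2 := le_max_right _ _
    simp only [hf]; positivity
  have hlin : ∫⁻ q, ENNReal.ofReal (f q) ∂((volume : Measure ℝ).prod (volume : Measure (EuclideanSpace ℝ (Fin N)))) =
      ∫⁻ ξ : EuclideanSpace ℝ (Fin N), ENNReal.ofReal (hfun ξ) *
      ∫⁻ τ : ℝ, ENNReal.ofReal (‖∑ j, (c j : ℂ) * Gker N (z j).1 (z j).2 τ ξ‖ ^ 2 * |τ| ^ (1 - 2 * H)) := by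
    rw [lintegral_prod_symm _ (by fun_prop)]
    refine lintegral_congr_ae ?_
    filter_upwards [hne] with ξ hξ
    have h0 : 0 ≤ hfun ξ := le_trans (by positivity) (hflow ξ hξ)
    rw [← lintegral_const_mul' _ _ (by simp)]
    congr 1; ext τ
    rw [← ENNReal.ofReal_mul h0]
    simp only [hf, hh', max_eq_left h0]
    rw [mul_comm]
  have hfin : ∫⁻ q, ENNReal.ofReal (f q) ∂((volume : Measure ℝ).prod (volume : Measure (EuclideanSpace ℝ (Fin N)))) ≠ ∞ := by
    rw [hlin]
    choose C hC hCb using fun j => Gker_tau H hH1 hH2 (z j).1 (hz j)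
    have hx := (xi_integrable N hN H β hβN hβlow (by linarith)).const_mul (c₂ * ∑ j, n * c j ^ 2 * C j)
    refine ne_top_of_le_ne_top hx.lintegral_lt_top.ne ?_
    refine lintegral_mono_ae ?_
    filter_upwards [hne] with ξ hξ
    have h0 : 0 ≤ hfun ξ := le_trans (by positivity) (hflow ξ hξ)
    have hin : ∫⁻ τ : ℝ, ENNReal.ofReal (‖∑ j, (c j : ℂ) * Gker N (z j).1 (z j).2 τ ξ‖ ^ 2 * |τ| ^ (1 - 2 * H)) ≤
        ENNReal.ofReal ((∑ j, n * c j ^ 2 * C j) * (1 + ‖ξ‖) ^ (-1 - 2 * H)) := by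
      have hpt : ∀ τ : ℝ, ENNReal.ofReal (‖∑ j, (c j : ℂ) * Gker N (z j).1 (z j).2 τ ξ‖ ^ 2 * |τ| ^ (1 - 2 * H)) ≤
          ∑ j, ENNReal.ofReal (n * c j ^ 2) * ENNReal.ofReal (‖Gker N (z j).1 (z j).2 τ ξ‖ ^ 2 * |τ| ^ (1 - 2 * H)) := by
        intro τ
        have : ∀ j ∈ Finset.univ, ENNReal.ofReal (n * c j ^ 2) * ENNReal.ofReal (‖Gker N (z j).1 (z j).2 τ ξ‖ ^ 2 * |τ| ^ (1 - 2 * H)) =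
            ENNReal.ofReal (n * c j ^ 2 * (‖Gker N (z j).1 (z j).2 τ ξ‖ ^ 2 * |τ| ^ (1 - 2 * H))) := fun j _ =>
          (ENNReal.ofReal_mul (by positivity)).symm
        rw [Finset.sum_congr rfl this, ← ENNReal.ofReal_sum_of_nonneg (fun j _ => by positivity)]
        apply ENNReal.ofReal_le_ofReal
        calc ‖∑ j, (c j : ℂ) * Gker N (z j).1 (z j).2 τ ξ‖ ^ 2 * |τ| ^ (1 - 2 * H) ≤
            (∑ j, ‖(c j : ℂ) * Gker N (z j).1 (z j).2 τ ξ‖) ^ 2 * |τ| ^ (1 - 2 * H) := by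
              gcongr; exact norm_sum_le _ _
          _ ≤ ((n : ℝ) * ∑ j, ‖(c j : ℂ) * Gker N (z j).1 (z j).2 τ ξ‖ ^ 2) * |τ| ^ (1 - 2 * H) := by
              gcongr
              have := sq_sum_le_card_mul_sum_sq (s := (Finset.univ : Finset (Fin n))) (f := fun j => ‖(c j : ℂ) * Gker N (z j).1 (z j).2 τ ξ‖)
              simpa using this
          _ = _ := by
              rw [Finset.mul_sum, Finset.sum_mul]
              refine Finset.sum_congr rfl fun j _ => ?_
              rw [norm_mul, Complex.norm_real, Real.norm_eq_abs, mul_pow, sq_abs]; ring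
      refine (lintegral_mono hpt).trans ?_
      rw [lintegral_finsetSum' _ (fun j _ => by
        exact AEMeasurable.const_mul (ENNReal.measurable_ofReal.comp
          (((Gker_measurable_tau N (z j).1 (z j).2 ξ).norm.pow_const 2).mul (by fun_prop))).aemeasurable _)]
      rw [Finset.sum_mul, ENNReal.ofReal_sum_of_nonneg (fun j _ => by have := hC j; positivity)]
      refine Finset.sum_le_sum fun j _ => ?_
      rw [lintegral_const_mul' _ _ ENNReal.ofReal_ne_top, mul_assoc, ENNReal.ofReal_mul (p := n * c j ^ 2) (by positivity)]
      exact mul_le_mul_right (hCb j N _ ξ hξ) _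
    calc _ ≤ ENNReal.ofReal (c₂ * ‖ξ‖ ^ (-β)) * ENNReal.ofReal ((∑ j, n * c j ^ 2 * C j) * (1 + ‖ξ‖) ^ (-1 - 2 * H)) := by
          gcongr
          exact hfup ξ hξ
      _ = _ := by
          have : 0 < c₂ := by linarith
          rw [← ENNReal.ofReal_mul (by positivity)]
          congr 1; ring
  have hfi : Integrable f ((volume : Measure ℝ).prod (volume : Measure (EuclideanSpace ℝ (Fin N)))) := by
    refine ⟨hfm.aestronglyMeasurable, ?_⟩
    rw [hasFiniteIntegral_iff_ofReal (Filter.Eventually.of_forall hf0)]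
    exact lt_top_iff_ne_top.2 hfin
  have e1 : Qvar N H hfun z c = ∫ q, f q ∂((volume : Measure ℝ).prod (volume : Measure (EuclideanSpace ℝ (Fin N)))) := by
    rw [hQ, integral_prod f hfi]
  rw [e1, ofReal_integral_eq_lintegral_ofReal hfi (Filter.Eventually.of_forall hf0), hlin]

open MeasureTheory Set
open scoped ENNReal

lemma lintegral_polar {E : Type*} [NormedAddCommGroup E] [NormedSpace ℝ E] [MeasurableSpace E] [BorelSpace E]
    [FiniteDimensional ℝ E] [Nontrivial E] (μ : Measure E) [μ.IsAddHaarMeasure] (G : E → ℝ≥0∞) (hG : Measurable G) :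
    ∫⁻ x, G x ∂μ = ∫⁻ w : Metric.sphere (0 : E) 1, (∫⁻ r in Ioi (0:ℝ), ENNReal.ofReal (r ^ (Module.finrank ℝ E - 1)) * G (r • (w : E))) ∂μ.toSphere := by
  have h1 : ∫⁻ x, G x ∂μ = ∫⁻ x : ({0}ᶜ : Set E), G x ∂(μ.comap (↑)) := by
    rw [lintegral_subtype_comap (measurableSet_singleton _).compl, restrict_compl_singleton]
  have h2 : ∀ x : ({0}ᶜ : Set E), G x = (fun q : Metric.sphere (0 : E) 1 × Ioi (0:ℝ) => G ((q.2 : ℝ) • (q.1 : E))) (homeomorphUnitSphereProd E x) := by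
    intro x
    have hx : ‖(x : E)‖ ≠ 0 := norm_ne_zero_iff.2 x.2
    simp [smul_smul, hx]
  have hGm : Measurable (fun q : Metric.sphere (0 : E) 1 × Ioi (0:ℝ) => G ((q.2 : ℝ) • (q.1 : E))) := by
    apply hG.comp
    apply Continuous.measurable
    fun_prop
  rw [h1]
  simp_rw [h2]
  rw [μ.measurePreserving_homeomorphUnitSphereProd.lintegral_comp hGm, lintegral_prod _ hGm.aemeasurable]
  congr 1; ext w
  have hGw : Measurable (fun r : ℝ => G (r • (w : E))) := by
    apply hG.comp; apply Continuous.measurable; fun_prop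
  rw [Measure.volumeIoiPow, lintegral_withDensity_eq_lintegral_mul _ (by fun_prop) (by exact hGw.comp measurable_subtype_coe)]
  exact lintegral_subtype_comap measurableSet_Ioi (fun r : ℝ => ENNReal.ofReal (r ^ (Module.finrank ℝ E - 1)) * G (r • (w : E)))

lemma lintegral_even (f : ℝ → ℝ≥0∞) (he : ∀ x, f (-x) = f x) :
    ∫⁻ x, f x ≤ 2 * ∫⁻ x in Ioi (0:ℝ), f x := by
  have h := lintegral_add_compl f (measurableSet_Ioi (a := (0:ℝ))) (μ := volume)
  rw [← h, two_mul]
  refine add_le_add le_rfl ?_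
  rw [compl_Ioi, setLIntegral_congr (f := f) (Ioi_ae_eq_Ici (a := (0:ℝ)))]
  have := (Measure.measurePreserving_neg (volume : Measure ℝ)).setLIntegral_comp_preimage_emb (MeasurableEquiv.neg ℝ).measurableEmbedding f (Iic 0)
  simp only [he] at this
  rw [← this]
  have e : (Neg.neg ⁻¹' Iic (0:ℝ)) = Ici 0 := by ext x; simp
  rw [e]

lemma es_neg {n : ℕ} (p c : Fin n → ℝ) (ρ : ℝ) : ‖es p c (-ρ)‖ = ‖es p c ρ‖ := by
  have : es p c (-ρ) = (starRingEnd ℂ) (es p c ρ) := by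
    unfold es
    rw [map_sum]
    refine Finset.sum_congr rfl fun j _ => ?_
    rw [map_mul, Complex.conj_ofReal, ← Complex.exp_conj, map_mul, Complex.conj_I, Complex.conj_ofReal]
    congr 2; push_cast; ring
  rw [this, Complex.norm_conj]

lemma weight_cmp (N : ℕ) (hN : 1 ≤ N) (H β : ℝ) (hH1 : 1 / 2 ≤ H) (hH2 : H < 1)
    (hβlow : (N : ℝ) - 2 * H - 1 < β) (r : ℝ) (hr : 0 < r) :
    8⁻¹ * mw (alphaExp N H β) r ≤ r ^ (N - 1) * (r ^ (-β) * (1 + r) ^ (-1 - 2 * H)) := by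
  have hpow : r ^ (N - 1) * r ^ (-β) = r ^ ((N : ℝ) - 1 - β) := by
    rw [← Real.rpow_natCast, ← Real.rpow_add hr]; congr 1
    rw [Nat.cast_sub hN]; push_cast; ring
  rw [← mul_assoc, hpow]
  unfold mw
  have h8 : (8:ℝ)⁻¹ = (2:ℝ) ^ (-3:ℝ) := by
    rw [Real.rpow_neg (by norm_num)]; norm_num
  rcases le_or_gt r 1 with h | h
  · have e1 : r ^ 2 ≤ r ^ ((N : ℝ) - 1 - β) := by
      rw [← Real.rpow_natCast]
      apply Real.rpow_le_rpow_of_exponent_ge hr h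
      push_cast; linarith
    have e2 : (8:ℝ)⁻¹ ≤ (1 + r) ^ (-1 - 2 * H) := by
      calc (8:ℝ)⁻¹ = (2:ℝ) ^ (-3:ℝ) := h8
        _ ≤ (1 + r) ^ (-3:ℝ) := Real.rpow_le_rpow_of_nonpos (by positivity) (by linarith) (by norm_num)
        _ ≤ _ := Real.rpow_le_rpow_of_exponent_le (by linarith) (by linarith)
    calc _ ≤ 8⁻¹ * r ^ 2 := by gcongr; exact min_le_left _ _
      _ ≤ (1 + r) ^ (-1 - 2 * H) * r ^ ((N : ℝ) - 1 - β) := by gcongr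
      _ = _ := mul_comm _ _
  · have e2 : 8⁻¹ * r ^ (-1 - 2 * H) ≤ (1 + r) ^ (-1 - 2 * H) := by
      calc 8⁻¹ * r ^ (-1 - 2 * H) ≤ 2 ^ (-1 - 2 * H) * r ^ (-1 - 2 * H) := by
            rw [h8]; gcongr
            · norm_num
            · linarith
        _ = (2 * r) ^ (-1 - 2 * H) := (Real.mul_rpow (by norm_num) hr.le).symm
        _ ≤ _ := Real.rpow_le_rpow_of_nonpos (by positivity) (by linarith) (by linarith)
    calc _ ≤ 8⁻¹ * |r| ^ (-1 - 2 * alphaExp N H β) := by gcongr; exact min_le_right _ _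
      _ = r ^ ((N : ℝ) - 1 - β) * (8⁻¹ * r ^ (-1 - 2 * H)) := by
        rw [abs_of_pos hr, mul_left_comm, ← Real.rpow_add hr]
        congr 2; unfold alphaExp; ring
      _ ≤ _ := by gcongr

/-- projected points -/
noncomputable def pr {N n : ℕ} (w : EuclideanSpace ℝ (Fin N)) (z : Fin n → ℝ × EuclideanSpace ℝ (Fin N)) : Fin n → ℝ :=
  fun j => (z j).1 - inner ℝ (z j).2 w

lemma Q_polar (N : ℕ) (hN : 1 ≤ N) (H β : ℝ) (hH1 : 1 / 2 ≤ H) (hH2 : H < 1)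
    (hβN : β < N) (hβlow : (N : ℝ) - 2 * H - 1 < β)
    (hfun : EuclideanSpace ℝ (Fin N) → ℝ) (hmeas : Measurable hfun)
    (c₁ c₂ : ℝ) (hc₁ : 0 < c₁) (hc₁₂ : c₁ ≤ c₂)
    (hflow : ∀ ξ : EuclideanSpace ℝ (Fin N), ξ ≠ 0 → c₁ * ‖ξ‖ ^ (-β) ≤ hfun ξ)
    (hfup : ∀ ξ : EuclideanSpace ℝ (Fin N), ξ ≠ 0 → hfun ξ ≤ c₂ * ‖ξ‖ ^ (-β)) (Ta : ℝ) (hTa : 0 < Ta) :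
    ∃ κ : ℝ, 0 < κ ∧ ∀ (n : ℕ) (z : Fin n → ℝ × EuclideanSpace ℝ (Fin N)) (c : Fin n → ℝ), (∀ j, Ta ≤ (z j).1) →
      ENNReal.ofReal κ * ∫⁻ w : Metric.sphere (0 : EuclideanSpace ℝ (Fin N)) 1,
        ENNReal.ofReal (qf (alphaExp N H β) (pr (w : EuclideanSpace ℝ (Fin N)) z) c) ∂(volume : Measure (EuclideanSpace ℝ (Fin N))).toSphere
        ≤ ENNReal.ofReal (Qvar N H hfun z c) := by
  obtain ⟨κ₁, hκ₁, hB⟩ := B1 H hH1 hH2 Ta hTa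
  have hα : 0 < alphaExp N H β := by unfold alphaExp; linarith
  have : Nonempty (Fin N) := ⟨⟨0, hN⟩⟩
  refine ⟨c₁ * κ₁ * 8⁻¹ * 2⁻¹, by positivity, ?_⟩
  intro n z c hz
  rw [Q_ge N hN H β hH1 hH2 hβN hβlow hfun hmeas c₁ c₂ hc₁ hc₁₂ hflow hfup n z (fun j => hTa.le.trans (hz j)) c]
  set G : EuclideanSpace ℝ (Fin N) → ℝ≥0∞ := fun ξ => ENNReal.ofReal (c₁ * ‖ξ‖ ^ (-β)) *
    ENNReal.ofReal (κ₁ * (‖∑ j, (c j : ℂ) * (Complex.exp (-Complex.I * ((inner ℝ (z j).2 ξ : ℝ) : ℂ)) *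
        Complex.exp (Complex.I * ((z j).1 : ℂ) * (‖ξ‖ : ℂ)))‖ ^ 2 * (1 + ‖ξ‖) ^ (-1 - 2 * H))) with hG
  have hGm : Measurable G := by
    simp only [hG]
    have : Continuous (fun ξ : EuclideanSpace ℝ (Fin N) => ‖∑ j, (c j : ℂ) * (Complex.exp (-Complex.I * ((inner ℝ (z j).2 ξ : ℝ) : ℂ)) *
        Complex.exp (Complex.I * ((z j).1 : ℂ) * (‖ξ‖ : ℂ)))‖) := by fun_prop
    have := this.measurable
    fun_prop
  have h1 : ∫⁻ ξ, G ξ ≤ ∫⁻ ξ : EuclideanSpace ℝ (Fin N), ENNReal.ofReal (hfun ξ) *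
      ∫⁻ τ : ℝ, ENNReal.ofReal (‖∑ j, (c j : ℂ) * Gker N (z j).1 (z j).2 τ ξ‖ ^ 2 * |τ| ^ (1 - 2 * H)) := by
    refine lintegral_mono_ae ?_
    filter_upwards [ae_ne_zero_euclid N hN] with ξ hξ
    exact mul_le_mul' (ENNReal.ofReal_le_ofReal (hflow ξ hξ)) (hB N n z c ξ hξ hz)
  refine le_trans ?_ h1
  rw [lintegral_polar volume G hGm, ← lintegral_const_mul' _ _ (by simp)]
  refine lintegral_mono fun w => ?_
  have hw : ‖(w : EuclideanSpace ℝ (Fin N))‖ = 1 := by simp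
  rw [← qf_lintegral _ hα]
  have h2 := lintegral_even (fun ρ => ENNReal.ofReal (‖es (pr (w : EuclideanSpace ℝ (Fin N)) z) c ρ‖ ^ 2 * mw (alphaExp N H β) ρ))
    (fun x => by rw [es_neg, mw_neg])
  refine (mul_le_mul_right h2 _).trans ?_
  have h22 : ENNReal.ofReal (c₁*κ₁*8⁻¹*2⁻¹) * 2 = ENNReal.ofReal (c₁*κ₁*8⁻¹*2⁻¹*2) := by
    rw [ENNReal.ofReal_mul (q := 2) (by positivity)]; simp
  rw [← mul_assoc, h22, ← lintegral_const_mul' _ _ (by simp)]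
  refine setLIntegral_mono' measurableSet_Ioi fun r hr => ?_
  have hr' : 0 < r := hr
  have hnr : ‖r • (w : EuclideanSpace ℝ (Fin N))‖ = r := by rw [norm_smul, hw, mul_one, Real.norm_eq_abs, abs_of_pos hr']
  have hes : ∑ j, (c j : ℂ) * (Complex.exp (-Complex.I * ((inner ℝ (z j).2 (r • (w : EuclideanSpace ℝ (Fin N))) : ℝ) : ℂ)) *
        Complex.exp (Complex.I * ((z j).1 : ℂ) * (r : ℂ))) = es (pr (w : EuclideanSpace ℝ (Fin N)) z) c r := by
    unfold es
    refine Finset.sum_congr rfl fun j _ => ?_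
    rw [← Complex.exp_add, inner_smul_right]
    congr 2
    simp only [pr]; push_cast; ring
  simp only [hG]
  rw [hnr, hes, ← ENNReal.ofReal_mul (by positivity), ← ENNReal.ofReal_mul (by positivity), ← ENNReal.ofReal_mul (by positivity)]
  apply ENNReal.ofReal_le_ofReal
  simp only [finrank_euclideanSpace, Fintype.card_fin]
  have := weight_cmp N hN H β hH1 hH2 hβlow r hr'
  calc _ = c₁ * κ₁ * ‖es (pr (w : EuclideanSpace ℝ (Fin N)) z) c r‖ ^ 2 * (8⁻¹ * mw (alphaExp N H β) r) := by ring
    _ ≤ c₁ * κ₁ * ‖es (pr (w : EuclideanSpace ℝ (Fin N)) z) c r‖ ^ 2 * (r ^ (N - 1) * (r ^ (-β) * (1 + r) ^ (-1 - 2 * H))) := by gcongr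
    _ = _ := by ring

open MeasureTheory Set
open scoped ENNReal

lemma mp_cons {X : Type*} [MeasurableSpace X] {n : ℕ} (μ : Fin (n+1) → Measure X) [∀ i, SigmaFinite (μ i)] :
    MeasurePreserving (fun y : X × (Fin n → X) => (Fin.cons y.1 y.2 : Fin (n+1) → X))
      ((μ 0).prod (Measure.pi fun i : Fin n => μ i.succ)) (Measure.pi μ) := by
  have h := (measurePreserving_piFinSuccAbove μ 0).symm
  have e : (fun y : X × (Fin n → X) => (Fin.cons y.1 y.2 : Fin (n+1) → X)) =
      (MeasurableEquiv.piFinSuccAbove (fun _ : Fin (n + 1) => X) 0).symm := by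
    funext y
    simp [MeasurableEquiv.piFinSuccAbove, Fin.insertNthEquiv, Fin.insertNth_zero']
  rw [e]
  simpa using h

lemma lintegral_cons {X : Type*} [MeasurableSpace X] {n : ℕ} (μ : Fin (n+1) → Measure X) [∀ i, SigmaFinite (μ i)]
    (F : (Fin (n+1) → X) → ℝ≥0∞) (hF : Measurable F) :
    ∫⁻ x, F x ∂(Measure.pi μ) = ∫⁻ x, (∫⁻ y, F (Fin.cons x y) ∂(Measure.pi fun i : Fin n => μ i.succ)) ∂(μ 0) := by
  rw [← (mp_cons μ).lintegral_comp hF, lintegral_prod]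
  exact (hF.comp (mp_cons μ).measurable).aemeasurable

lemma lintegral_pi_prod {X : Type*} [MeasurableSpace X] : ∀ (n : ℕ) (μ : Fin n → Measure X) [∀ i, SigmaFinite (μ i)]
    (G : Fin n → X → ℝ≥0∞), (∀ i, Measurable (G i)) →
    ∫⁻ x, ∏ i, G i (x i) ∂(Measure.pi μ) = ∏ i, ∫⁻ x, G i x ∂(μ i)
  | 0, μ, _, G, hG => by simp
  | (n+1), μ, _, G, hG => by
    have hm : Measurable (fun x : Fin (n+1) → X => ∏ i, G i (x i)) :=
      Finset.measurable_fun_prod _ fun i _ => (hG i).comp (measurable_pi_apply i)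
    have hm' : Measurable (fun x : Fin n → X => ∏ i : Fin n, G i.succ (x i)) :=
      Finset.measurable_fun_prod _ fun i _ => (hG i.succ).comp (measurable_pi_apply i)
    rw [lintegral_cons μ _ hm]
    simp only [Fin.prod_univ_succ, Fin.cons_zero, Fin.cons_succ]
    have : ∀ x, ∫⁻ y : Fin n → X, G 0 x * ∏ i : Fin n, G i.succ (y i) ∂(Measure.pi fun i : Fin n => μ i.succ)
        = G 0 x * ∏ i : Fin n, ∫⁻ x, G i.succ x ∂(μ i.succ) := by
      intro x
      rw [lintegral_const_mul _ hm',
        lintegral_pi_prod n (fun i => μ i.succ) (fun i => G i.succ) (fun i => hG _)]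
    simp_rw [this]
    rw [lintegral_mul_const _ (hG 0)]

lemma lintegral_flip_prod (m : ℕ) : ∀ (n : ℕ) (F : Fin m → (Fin n → ℝ) → ℝ≥0∞), (∀ k, Measurable (F k)) →
    ∫⁻ ξ : Fin n → Fin m → ℝ, ∏ k, F k (fun j => ξ j k) = ∏ k, ∫⁻ c, F k c
  | 0, F, hF => by
    rw [volume_pi, Measure.pi_of_empty _ (fun j => j.elim0), lintegral_dirac]
    refine Finset.prod_congr rfl fun k _ => ?_
    rw [volume_pi, Measure.pi_of_empty _ (fun j => j.elim0), lintegral_dirac]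
    congr 1; funext j; exact j.elim0
  | (n+1), F, hF => by
    have hm : Measurable (fun ξ : Fin (n+1) → Fin m → ℝ => ∏ k, F k (fun j => ξ j k)) :=
      Finset.measurable_fun_prod _ fun k _ => (hF k).comp (by fun_prop)
    rw [volume_pi, lintegral_cons (fun _ : Fin (n+1) => (volume : Measure (Fin m → ℝ))) _ hm]
    have hc : ∀ x : ℝ, Measurable (fun c : Fin n → ℝ => (Fin.cons x c : Fin (n+1) → ℝ)) := by
      intro x
      exact (mp_cons (fun _ : Fin (n+1) => (volume : Measure ℝ))).measurable.comp measurable_prodMk_left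
    have e : ∀ (x : Fin m → ℝ) (y : Fin n → Fin m → ℝ) (k : Fin m),
        (fun j => (Fin.cons x y : Fin (n+1) → Fin m → ℝ) j k) = Fin.cons (x k) (fun j => y j k) := by
      intro x y k; funext j
      refine Fin.cases ?_ (fun i => ?_) j <;> simp
    simp only [e]
    have ih : ∀ x : Fin m → ℝ, ∫⁻ y : Fin n → Fin m → ℝ, ∏ k, F k (Fin.cons (x k) (fun j => y j k)) ∂(Measure.pi fun _ => volume)
        = ∏ k, ∫⁻ c : Fin n → ℝ, F k (Fin.cons (x k) c) := by
      intro x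
      exact lintegral_flip_prod m n (fun k c => F k (Fin.cons (x k) c)) (fun k => (hF k).comp (hc _))
    simp_rw [ih]
    rw [volume_pi, lintegral_pi_prod m (fun _ => volume) (fun k x => ∫⁻ c : Fin n → ℝ, F k (Fin.cons x c))]
    · refine Finset.prod_congr rfl fun k _ => ?_
      exact (lintegral_cons (fun _ : Fin (n+1) => (volume : Measure ℝ)) _ (hF k)).symm
    · intro k
      have : Measurable (fun y : ℝ × (Fin n → ℝ) => F k (Fin.cons y.1 y.2)) :=
        (hF k).comp (mp_cons (fun _ : Fin (n+1) => (volume : Measure ℝ))).measurable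
      exact this.lintegral_prod_right'

lemma lintegral_pi_map {X Y : Type*} [MeasurableSpace X] [MeasurableSpace Y] (μ : Measure X) (ν : Measure Y) [SigmaFinite μ] [SigmaFinite ν]
    (L : X → Y) (hL : Measurable L) (c : ℝ≥0∞) (hc : c ≠ ∞) (h : μ.map L = c • ν) (n : ℕ) (Φ : (Fin n → Y) → ℝ≥0∞) (hΦ : Measurable Φ) :
    ∫⁻ z, Φ (fun j => L (z j)) ∂(Measure.pi fun _ : Fin n => μ) = c ^ n * ∫⁻ y, Φ y ∂(Measure.pi fun _ : Fin n => ν) := by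
  have hs : SigmaFinite (c • ν) := by
    lift c to NNReal using hc
    exact inferInstanceAs (SigmaFinite (c • ν))
  have hs' : SigmaFinite (μ.map L) := by rw [h]; exact hs
  have h1 : (Measure.pi fun _ : Fin n => μ).map (fun z j => L (z j)) = c ^ n • Measure.pi fun _ : Fin n => ν := by
    rw [Measure.pi_map_pi (μ := fun _ : Fin n => μ) (f := fun _ => L) (fun _ => hL.aemeasurable)]
    refine Measure.pi_eq fun s hs => ?_
    simp [h, Finset.prod_mul_distrib]
  have hm : Measurable (fun (z : Fin n → X) j => L (z j)) := by fun_prop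
  rw [← lintegral_map hΦ hm, h1, lintegral_smul_measure]
  rfl

open MeasureTheory Set
open scoped ENNReal

lemma Kc_even (α x : ℝ) : Kc α (-x) = Kc α x := by
  unfold Kc
  congr 1; funext ρ; simp [Real.cos_neg]

lemma qf_continuous (α : ℝ) (hα : 0 < α) (n : ℕ) :
    Continuous (fun q : (Fin n → ℝ) × (Fin n → ℝ) => qf α q.1 q.2) := by
  unfold qf
  have := Kc_continuous α hα
  fun_prop

/-- the basic frequency integral -/
noncomputable def Jf (α γ κ : ℝ) (n d : ℕ) (p : Fin n → ℝ) : ℝ≥0∞ :=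
  ∫⁻ ξ : Fin n → Fin d → ℝ, ENNReal.ofReal ((∏ j, (∑ k, ξ j k ^ 2) ^ (γ / 2)) *
    Real.exp (-(κ * ∑ k, qf α p (fun j => ξ j k))))

lemma rpow_exp_le (θ s S : ℝ) (hθ0 : 0 ≤ θ) (hθ1 : θ ≤ 1) (hs : 0 < s) (hS : 0 ≤ S) :
    S ^ θ * Real.exp (-(s * S)) ≤ s ^ (-θ) := by
  have h1 : (s * S) ^ θ ≤ Real.exp (s * S) := by
    have h0 : 0 ≤ s * S := by positivity
    calc (s * S) ^ θ ≤ 1 + s * S := by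
          rcases le_total (s * S) 1 with h | h
          · have := Real.rpow_le_one h0 h hθ0
            linarith
          · have := Real.rpow_le_rpow_of_exponent_le h hθ1
            rw [Real.rpow_one] at this
            linarith
      _ ≤ _ := by have := Real.add_one_le_exp (s * S); linarith
  rw [Real.mul_rpow hs.le hS] at h1
  rw [Real.rpow_neg hs.le, Real.exp_neg, ← div_eq_mul_inv, div_le_iff₀ (Real.exp_pos _), ← div_eq_inv_mul,
    le_div_iff₀ (by positivity)]
  linarith

lemma gauss_qf (α : ℝ) (hα : 0 < α) (κ κ₁ : ℝ) (hκ : 0 < κ) (hκ₁ : 0 < κ₁) (n : ℕ) (p g : Fin n → ℝ) (hg : ∀ j, 0 < g j)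
    (h : ∀ (j : Fin n) (c : Fin n → ℝ), (∀ l, j < l → c l = 0) → κ₁ * (c j ^ 2 * g j ^ (2 * α)) ≤ qf α p c) :
    ∫⁻ c : Fin n → ℝ, ENNReal.ofReal (Real.exp (-(κ * qf α p c))) ≤
      ∏ j, ENNReal.ofReal (√(Real.pi / (κ * κ₁)) * g j ^ (-α)) := by
  have e : ∀ c : Fin n → ℝ, κ * qf α p c = ∑ i, ∑ l, c i * c l * (κ * Kc α (p i - p l)) := by
    intro c
    unfold qf
    rw [Finset.mul_sum]
    refine Finset.sum_congr rfl fun i _ => ?_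
    rw [Finset.mul_sum]
    refine Finset.sum_congr rfl fun l _ => ?_
    ring
  have := gauss_det n (fun i l => κ * Kc α (p i - p l)) (fun j => κ * κ₁ * g j ^ (2 * α))
    (fun i j => by rw [← Kc_even, neg_sub]) (fun j => by have := hg j; positivity) (by
      intro j c hc
      rw [← e]
      calc _ = κ * (κ₁ * (c j ^ 2 * g j ^ (2 * α))) := by ring
        _ ≤ _ := by gcongr; exact h j c hc)
  simp only [← e] at this
  refine this.trans (le_of_eq ?_)
  refine Finset.prod_congr rfl fun j _ => ?_
  congr 1
  have hgj := hg j
  rw [← div_div, div_eq_mul_inv _ (g j ^ (2 * α)), Real.sqrt_mul' _ (by positivity), ← Real.rpow_neg hgj.le,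
    Real.sqrt_eq_rpow (g j ^ _), ← Real.rpow_mul hgj.le]
  congr 2; ring

lemma J_bound (α γ κ D : ℝ) (d : ℕ) (hα : 0 < α) (hα1 : α < 1) (hγ0 : 0 ≤ γ) (hγ1 : γ ≤ 1) (hκ : 0 < κ) (hD : 0 < D) :
    ∃ C : ℝ, 0 < C ∧ ∀ (n : ℕ) (p g δ : Fin n → ℝ), (∀ j, 0 < g j) → (∀ j, g j ≤ D) → (∀ j, 0 < δ j) → (∀ j, δ j ≤ D) →
      (∀ j l, |p l - p j| ≤ D) → (∀ j l, l < j → g j ≤ |p l - p j|) → (∀ j l, l ≠ j → δ j ≤ |p l - p j|) →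
      Jf α γ κ n d p ≤ ENNReal.ofReal (∏ j, (C * (n : ℝ) ^ (γ / 2) * δ j ^ (-(α * γ)) * g j ^ (-(α * d)))) := by
  obtain ⟨κ₁, hκ₁, hsl⟩ := slnd1 α hα hα1 D hD
  refine ⟨(2 / (κ * κ₁)) ^ (γ / 2) * √(Real.pi / (κ / 2 * κ₁)) ^ d, by positivity, ?_⟩
  intro n p g δ hg hgD hδ hδD hpD hgp hδp
  rcases Nat.eq_zero_or_pos n with hn | hn
  · subst hn
    have : ∀ ξ : Fin 0 → Fin d → ℝ, Real.exp (-(κ * ∑ k, qf α p (fun j => ξ j k))) = 1 := by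
      intro ξ; simp [qf]
    unfold Jf
    simp only [this]
    simp [volume_pi]
  have hn' : (0:ℝ) < n := by exact_mod_cast hn
  have hc1 : ∀ (c : Fin n → ℝ) j, κ₁ * (c j ^ 2 * δ j ^ (2 * α)) ≤ qf α p c := fun c j =>
    hsl n p c j (δ j) (hδ j) (hδD j) (fun l => hpD j l) (fun l hl _ => hδp j l hl)
  have hc2 : ∀ (c : Fin n → ℝ), κ₁ / n * ∑ j, (c j ^ 2 * δ j ^ (2 * α)) ≤ qf α p c := by
    intro c
    have := Finset.sum_le_sum (s := Finset.univ) fun j _ => hc1 c j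
    rw [← Finset.mul_sum, Finset.sum_const, Finset.card_univ, Fintype.card_fin, nsmul_eq_mul] at this
    rw [div_mul_eq_mul_div, div_le_iff₀ hn']
    linarith
  have hgs := gauss_qf α hα (κ / 2) κ₁ (by positivity) hκ₁ n p g hg (by
    intro j c hc
    refine hsl n p c j (g j) (hg j) (hgD j) (fun l => hpD j l) (fun l hl hcl => ?_)
    refine hgp j l (lt_of_le_of_ne (not_lt.1 fun h => hcl (hc l h)) hl))
  set s : Fin n → ℝ := fun j => κ * κ₁ / 2 / n * δ j ^ (2 * α) with hs
  have hspos : ∀ j, 0 < s j := fun j => by have := hδ j; simp only [hs]; positivity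
  have hpt : ∀ ξ : Fin n → Fin d → ℝ, (∏ j, (∑ k, ξ j k ^ 2) ^ (γ / 2)) * Real.exp (-(κ * ∑ k, qf α p (fun j => ξ j k)))
      ≤ (∏ j, s j ^ (-(γ / 2))) * ∏ k, Real.exp (-(κ / 2 * qf α p (fun j => ξ j k))) := by
    intro ξ
    have e1 : -(κ * ∑ k, qf α p (fun j => ξ j k)) ≤ ∑ j, -(s j * ∑ k, ξ j k ^ 2) + ∑ k, -(κ / 2 * qf α p (fun j => ξ j k)) := by
      have := Finset.sum_le_sum (s := Finset.univ) fun (k : Fin d) _ => hc2 (fun j => ξ j k)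
      rw [← Finset.mul_sum, Finset.sum_comm] at this
      simp only [← Finset.sum_mul] at this
      rw [Finset.sum_neg_distrib, Finset.sum_neg_distrib, ← Finset.mul_sum]
      have e2 : ∑ j, s j * ∑ k, ξ j k ^ 2 = κ / 2 * (κ₁ / n * ∑ j, (∑ k, ξ j k ^ 2) * δ j ^ (2 * α)) := by
        simp only [hs, Finset.mul_sum (s := (Finset.univ : Finset (Fin n)))]
        refine Finset.sum_congr rfl fun j _ => ?_
        ring
      rw [e2]
      have := mul_le_mul_of_nonneg_left this (by positivity : 0 ≤ κ / 2)
      linarith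
    calc _ ≤ (∏ j, (∑ k, ξ j k ^ 2) ^ (γ / 2)) * ((∏ j, Real.exp (-(s j * ∑ k, ξ j k ^ 2))) * ∏ k, Real.exp (-(κ / 2 * qf α p (fun j => ξ j k)))) := by
          rw [← Real.exp_sum, ← Real.exp_sum, ← Real.exp_add]
          refine mul_le_mul_of_nonneg_left (Real.exp_le_exp.2 e1) (Finset.prod_nonneg fun j _ => by positivity)
      _ = (∏ j, ((∑ k, ξ j k ^ 2) ^ (γ / 2) * Real.exp (-(s j * ∑ k, ξ j k ^ 2)))) * ∏ k, Real.exp (-(κ / 2 * qf α p (fun j => ξ j k))) := by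
          rw [Finset.prod_mul_distrib, mul_assoc]
      _ ≤ _ := by
          refine mul_le_mul_of_nonneg_right (Finset.prod_le_prod (fun j _ => by positivity) fun j _ => ?_) (Finset.prod_nonneg fun j _ => by positivity)
          exact rpow_exp_le _ _ _ (by linarith) (by linarith) (hspos j) (Finset.sum_nonneg fun k _ => sq_nonneg _)
  have hqm : Measurable (fun c : Fin n → ℝ => ENNReal.ofReal (Real.exp (-(κ / 2 * qf α p c)))) := by
    have : Continuous (fun c : Fin n → ℝ => qf α p c) := (qf_continuous α hα n).comp (by fun_prop : Continuous fun c : Fin n → ℝ => (p, c))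
    exact (by fun_prop : Continuous (fun c : Fin n → ℝ => (Real.exp (-(κ / 2 * qf α p c))))).measurable.ennreal_ofReal
  have hS0 : 0 ≤ ∏ j, s j ^ (-(γ / 2)) := Finset.prod_nonneg fun j _ => Real.rpow_nonneg (hspos j).le _
  calc Jf α γ κ n d p ≤ ∫⁻ ξ : Fin n → Fin d → ℝ, ENNReal.ofReal (∏ j, s j ^ (-(γ / 2))) *
        ∏ k, ENNReal.ofReal (Real.exp (-(κ / 2 * qf α p (fun j => ξ j k)))) := by
        refine lintegral_mono fun ξ => (ENNReal.ofReal_le_ofReal (hpt ξ)).trans (le_of_eq ?_)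
        rw [ENNReal.ofReal_mul hS0, ENNReal.ofReal_prod_of_nonneg (fun k _ => (Real.exp_pos _).le)]
    _ = ENNReal.ofReal (∏ j, s j ^ (-(γ / 2))) * ∏ k : Fin d, ∫⁻ c : Fin n → ℝ, ENNReal.ofReal (Real.exp (-(κ / 2 * qf α p c))) := by
        rw [lintegral_const_mul' _ _ (by simp),
          lintegral_flip_prod d n (fun _ c => ENNReal.ofReal (Real.exp (-(κ / 2 * qf α p c)))) (fun _ => hqm)]
    _ ≤ ENNReal.ofReal (∏ j, s j ^ (-(γ / 2))) * ∏ k : Fin d, ∏ j, ENNReal.ofReal (√(Real.pi / (κ / 2 * κ₁)) * g j ^ (-α)) := by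
        gcongr
    _ = ENNReal.ofReal ((∏ j, s j ^ (-(γ / 2))) * ∏ j, (√(Real.pi / (κ / 2 * κ₁)) * g j ^ (-α)) ^ d) := by
        rw [Finset.prod_const, Finset.card_univ, Fintype.card_fin, ← ENNReal.ofReal_prod_of_nonneg, ← ENNReal.ofReal_pow,
          ← ENNReal.ofReal_mul hS0, Finset.prod_pow]
        · exact Finset.prod_nonneg fun j _ => by have := hg j; positivity
        · exact fun j _ => by have := hg j; positivity
    _ = _ := by
        rw [← Finset.prod_mul_distrib]
        congr 1
        refine Finset.prod_congr rfl fun j _ => ?_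
        have hgj := hg j
        have hdj := hδ j
        have e1 : s j ^ (-(γ / 2)) = (2 / (κ * κ₁)) ^ (γ / 2) * (n : ℝ) ^ (γ / 2) * δ j ^ (-(α * γ)) := by
          rw [Real.rpow_neg (hspos j).le, ← Real.inv_rpow (hspos j).le]
          have : (s j)⁻¹ = (2 / (κ * κ₁)) * n * (δ j ^ (2 * α))⁻¹ := by
            simp only [hs]; field_simp
          rw [this, Real.mul_rpow (by positivity) (by positivity), Real.mul_rpow (by positivity) (by positivity),
            ← Real.rpow_neg hdj.le, ← Real.rpow_mul hdj.le]
          congr 2; ring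
        have e2 : (g j ^ (-α)) ^ d = g j ^ (-(α * d)) := by
          rw [← Real.rpow_natCast, ← Real.rpow_mul hgj.le]; congr 1; ring
        rw [e1, mul_pow, e2]; ring

open MeasureTheory Set
open scoped ENNReal

lemma mp_perm {X : Type*} [MeasurableSpace X] (μ : Measure X) [SigmaFinite μ] {n : ℕ} (σ : Equiv.Perm (Fin n)) :
    MeasurePreserving (fun f : Fin n → X => fun j => f (σ j)) (Measure.pi fun _ => μ) (Measure.pi fun _ => μ) := by
  refine ⟨by fun_prop, (Measure.pi_eq fun s hs => ?_).symm⟩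
  rw [Measure.map_apply (by fun_prop) (MeasurableSet.univ_pi hs)]
  have : (fun f : Fin n → X => fun j => f (σ j)) ⁻¹' (univ.pi s) = univ.pi (fun j => s (σ.symm j)) := by
    ext f
    simp only [mem_preimage, mem_pi, mem_univ, true_imp_iff]
    constructor
    · intro h j; simpa using h (σ.symm j)
    · intro h j; simpa using h (σ j)
  rw [this, Measure.pi_pi]
  exact Equiv.prod_comp σ.symm (fun j => μ (s j))

lemma mp_perm_vol {X : Type*} [MeasureSpace X] [SigmaFinite (volume : Measure X)] {n : ℕ} (σ : Equiv.Perm (Fin n)) :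
    MeasurePreserving (fun f : Fin n → X => fun j => f (σ j)) volume volume := mp_perm volume σ

lemma Jf_measurable (α γ κ : ℝ) (hα : 0 < α) (hγ : 0 ≤ γ) (n d : ℕ) : Measurable (Jf α γ κ n d) := by
  have h := qf_continuous α hα n
  have h1 : Continuous (fun q : (Fin n → ℝ) × (Fin n → Fin d → ℝ) => (∏ j, (∑ k, q.2 j k ^ 2) ^ (γ / 2)) *
    Real.exp (-(κ * ∑ k, qf α q.1 (fun j => q.2 j k)))) := by
    have h2 : ∀ k, Continuous (fun q : (Fin n → ℝ) × (Fin n → Fin d → ℝ) => qf α q.1 (fun j => q.2 j k)) := by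
      intro k
      exact h.comp (by fun_prop : Continuous fun q : (Fin n → ℝ) × (Fin n → Fin d → ℝ) => (q.1, fun j => q.2 j k))
    refine Continuous.mul (continuous_finsetProd _ fun j _ => ?_) (by fun_prop)
    exact Continuous.rpow_const (by fun_prop) (fun _ => Or.inr (by linarith))
  exact (h1.measurable.ennreal_ofReal).lintegral_prod_right'

lemma Jf_perm (α γ κ : ℝ) (hα : 0 < α) (hγ : 0 ≤ γ) (n d : ℕ) (p : Fin n → ℝ) (σ : Equiv.Perm (Fin n)) :
    Jf α γ κ n d (fun j => p (σ j)) = Jf α γ κ n d p := by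
  unfold Jf
  rw [← (mp_perm_vol (X := Fin d → ℝ) σ).lintegral_comp]
  · refine lintegral_congr fun ξ => ?_
    congr 2
    · exact Equiv.prod_comp σ (fun j => (∑ k, ξ j k ^ 2) ^ (γ / 2))
    · congr 3
      refine Finset.sum_congr rfl fun k _ => ?_
      unfold qf
      rw [← Equiv.sum_comp σ (fun j => ∑ l, ξ j k * ξ l k * Kc α (p j - p l))]
      refine Finset.sum_congr rfl fun j _ => ?_
      rw [← Equiv.sum_comp σ (fun l => ξ (σ j) k * ξ l k * Kc α (p (σ j) - p l))]
  · have h := qf_continuous α hα n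
    have h2 : ∀ k, Continuous (fun q : (Fin n → Fin d → ℝ) => qf α (fun j => p (σ j)) (fun j => q j k)) := by
      intro k
      exact h.comp (by fun_prop : Continuous fun q : (Fin n → Fin d → ℝ) => ((fun j => p (σ j)), fun j => q j k))
    have : Continuous (fun q : (Fin n → Fin d → ℝ) => (∏ j, (∑ k, q j k ^ 2) ^ (γ / 2)) *
        Real.exp (-(κ * ∑ k, qf α (fun j => p (σ j)) (fun j => q j k)))) := by
      refine Continuous.mul (continuous_finsetProd _ fun j _ => ?_) (by fun_prop)
      exact Continuous.rpow_const (by fun_prop) (fun _ => Or.inr (by linarith))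
    exact this.measurable.ennreal_ofReal

lemma ae_injective (n : ℕ) : ∀ᵐ p : Fin n → ℝ, Function.Injective p := by
  have : ∀ᵐ p : Fin n → ℝ, ∀ i j : Fin n, i ≠ j → p i ≠ p j := by
    rw [ae_all_iff]; intro i
    rw [ae_all_iff]; intro j
    by_cases hij : i = j
    · simp [hij]
    have h := Measure.addHaar_submodule (volume : Measure (Fin n → ℝ))
      (LinearMap.ker ((LinearMap.proj i : (Fin n → ℝ) →ₗ[ℝ] ℝ) - LinearMap.proj j)) (by
        intro h
        have : (Pi.single i 1 : Fin n → ℝ) ∈ (⊤ : Submodule ℝ (Fin n → ℝ)) := trivial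
        rw [← h, LinearMap.mem_ker] at this
        simp [Ne.symm hij] at this)
    rw [ae_iff]
    refine measure_mono_null ?_ h
    intro p hp
    simp only [mem_ofPred_eq, not_forall, not_not] at hp
    obtain ⟨_, hp⟩ := hp
    simp [hp]
  filter_upwards [this] with p hp i j hij
  by_contra h
  exact hp i j h hij

lemma measurableSet_strictMono (n : ℕ) : MeasurableSet {p : Fin n → ℝ | StrictMono p} := by
  have : {p : Fin n → ℝ | StrictMono p} = ⋂ i : Fin n, ⋂ j : Fin n, {p | i < j → p i < p j} := by
    ext p; simp [StrictMono]
  rw [this]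
  refine MeasurableSet.iInter fun i => MeasurableSet.iInter fun j => ?_
  by_cases h : i < j
  · simp only [h, true_imp_iff]
    exact measurableSet_lt (by fun_prop) (by fun_prop)
  · simp [h]

lemma sort_bound (n : ℕ) (F : (Fin n → ℝ) → ℝ≥0∞) (hF : Measurable F) (hs : ∀ p (σ : Equiv.Perm (Fin n)), F (fun j => p (σ j)) = F p)
    (S : Set ℝ) (hS : MeasurableSet S) :
    ∫⁻ p in univ.pi (fun _ : Fin n => S), F p ≤ (n.factorial : ℝ≥0∞) * ∫⁻ p in univ.pi (fun _ : Fin n => S) ∩ {p | StrictMono p}, F p := by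
  set B := univ.pi (fun _ : Fin n => S) with hB
  have hm : MeasurableSet (B ∩ {p | StrictMono p}) := (MeasurableSet.univ_pi fun _ => hS).inter (measurableSet_strictMono n)
  set A : Equiv.Perm (Fin n) → Set (Fin n → ℝ) := fun σ => (fun f : Fin n → ℝ => fun j => f (σ j)) ⁻¹' (B ∩ {p | StrictMono p}) with hA
  have h1 : B ≤ᵐ[volume] ⋃ σ, A σ := by
    filter_upwards [ae_injective n] with p hp hpB
    refine mem_iUnion.2 ⟨Tuple.sort p, ?_, ?_⟩
    · rw [hB, mem_univ_pi]
      exact fun j => hpB _ trivial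
    · exact (Tuple.monotone_sort p).strictMono_of_injective (hp.comp (Tuple.sort p).injective)
  calc ∫⁻ p in B, F p ≤ ∫⁻ p in ⋃ σ, A σ, F p := lintegral_mono_set' h1
    _ ≤ ∑' σ, ∫⁻ p in A σ, F p := lintegral_iUnion_le _ _
    _ = ∑' σ : Equiv.Perm (Fin n), ∫⁻ p in B ∩ {p | StrictMono p}, F p := by
        refine tsum_congr fun σ => ?_
        rw [← (mp_perm_vol (X := ℝ) σ).setLIntegral_comp_preimage hm hF]
        simp only [hs, hA]
    _ = _ := by
        rw [tsum_fintype, Finset.sum_const, Finset.card_univ, Fintype.card_perm, Fintype.card_fin, nsmul_eq_mul]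

/-- consecutive gaps, starting from a base point -/
noncomputable def gap {n : ℕ} (lo : ℝ) (p : Fin n → ℝ) (k : Fin n) : ℝ := p k - (Fin.cons lo p : Fin (n+1) → ℝ) k.castSucc

lemma gap_cons_succ {n : ℕ} (lo x : ℝ) (q : Fin n → ℝ) (k : Fin n) :
    gap lo (Fin.cons x q : Fin (n+1) → ℝ) k.succ = gap x q k := by
  unfold gap
  rw [← Fin.succ_castSucc, Fin.cons_succ, Fin.cons_succ]

lemma gap_zero {n : ℕ} (lo : ℝ) (p : Fin (n+1) → ℝ) : gap lo p 0 = p 0 - lo := by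
  simp [gap]

lemma gap_succ {n : ℕ} (lo : ℝ) (p : Fin (n+1) → ℝ) (i : Fin n) : gap lo p i.succ = p i.succ - p i.castSucc := by
  unfold gap
  rw [← Fin.succ_castSucc, Fin.cons_succ]

lemma gap_sum {n : ℕ} (lo : ℝ) (p : Fin (n+1) → ℝ) : ∑ k, gap lo p k = p (Fin.last n) - lo := by
  have h1 := Fin.sum_univ_succ (Fin.cons lo p : Fin (n+2) → ℝ)
  have h2 := Fin.sum_univ_castSucc (Fin.cons lo p : Fin (n+2) → ℝ)
  simp only [Fin.cons_zero, Fin.cons_succ] at h1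
  rw [← Fin.succ_last, Fin.cons_succ] at h2
  unfold gap
  rw [Finset.sum_sub_distrib]
  linarith

lemma gap_measurable {n : ℕ} (lo : ℝ) (k : Fin n) : Measurable (fun p : Fin n → ℝ => gap lo p k) := by
  cases n with
  | zero => exact k.elim0
  | succ n =>
    refine Fin.cases ?_ (fun i => ?_) k
    · simp only [gap_zero]; fun_prop
    · simp only [gap_succ]; fun_prop

lemma chain_int (ψ : ℝ → ℝ≥0∞) (hψ : Measurable ψ) : ∀ (n : ℕ) (lo : ℝ),
    ∫⁻ p : Fin n → ℝ, ∏ k, ψ (gap lo p k) = (∫⁻ x, ψ x) ^ n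
  | 0, lo => by simp [volume_pi]
  | (n+1), lo => by
    have hm : ∀ (n : ℕ) (lo : ℝ), Measurable (fun p : Fin n → ℝ => ∏ k, ψ (gap lo p k)) := fun n lo =>
      Finset.measurable_fun_prod _ fun k _ => hψ.comp (gap_measurable lo k)
    rw [volume_pi, lintegral_cons _ _ (hm (n+1) lo)]
    simp only [Fin.prod_univ_succ, gap_cons_succ, gap_zero, Fin.cons_zero]
    have : ∀ x : ℝ, ∫⁻ y : Fin n → ℝ, ψ (x - lo) * ∏ k, ψ (gap x y k) ∂(Measure.pi fun _ => volume) = ψ (x - lo) * (∫⁻ x, ψ x) ^ n := by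
      intro x
      rw [lintegral_const_mul _ (hm n x)]
      congr 1
      exact chain_int ψ hψ n x
    simp_rw [this]
    have hm2 : Measurable (fun x : ℝ => ψ (x - lo)) := hψ.comp (by fun_prop)
    rw [lintegral_mul_const _ hm2, lintegral_sub_right_eq_self ψ lo, pow_succ, mul_comm]

open MeasureTheory Set
open scoped ENNReal

/-- the gap weight -/
noncomputable def Psi (a b y : ℝ) : ℝ≥0∞ :=
  (Ioi (0:ℝ)).indicator (fun y => ENNReal.ofReal (y ^ (-a) * (1 + y ^ (-b)) ^ 2 * Real.exp (-y))) y

lemma Psi_measurable (a b : ℝ) : Measurable (Psi a b) := by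
  unfold Psi
  exact Measurable.indicator (by fun_prop) measurableSet_Ioi

lemma Psi_int (a b : ℝ) (hb : 0 ≤ b) (hab : a + 2 * b < 1) : ∫⁻ y, Psi a b y < ∞ := by
  unfold Psi
  rw [lintegral_indicator measurableSet_Ioi]
  have h1 := Real.GammaIntegral_convergent (s := 1 - a) (by linarith)
  have h2 := Real.GammaIntegral_convergent (s := 1 - a - 2 * b) (by linarith)
  have h3 : IntegrableOn (fun y : ℝ => 2 * (Real.exp (-y) * y ^ (1 - a - 1)) + 2 * (Real.exp (-y) * y ^ (1 - a - 2 * b - 1))) (Ioi 0) :=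
    (h1.const_mul 2).add (h2.const_mul 2)
  refine lt_of_le_of_lt ?_ h3.lintegral_lt_top
  refine setLIntegral_mono' measurableSet_Ioi fun y hy => ENNReal.ofReal_le_ofReal ?_
  have hy' : 0 < y := hy
  have e1 : y ^ (1 - a - 2 * b - 1) = y ^ (-a) * (y ^ (-b)) ^ 2 := by
    rw [← Real.rpow_natCast, ← Real.rpow_mul hy'.le, ← Real.rpow_add hy']; congr 1; push_cast; ring
  have e2 : y ^ (1 - a - 1) = y ^ (-a) := by congr 1; ring
  rw [e1, e2]
  have h4 : (1 + y ^ (-b)) ^ 2 ≤ 2 + 2 * (y ^ (-b)) ^ 2 := by nlinarith [sq_nonneg (1 - y ^ (-b))]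
  calc _ ≤ y ^ (-a) * (2 + 2 * (y ^ (-b)) ^ 2) * Real.exp (-y) := by gcongr
    _ = _ := by ring

lemma Psi_scale (a b lam : ℝ) (hl : 0 < lam) : ∫⁻ x, Psi a b (lam * x) = ENNReal.ofReal lam⁻¹ * ∫⁻ x, Psi a b x := by
  rw [← lintegral_map (f := Psi a b) (Psi_measurable a b) (measurable_const_mul lam), Real.map_volume_mul_left hl.ne', lintegral_smul_measure,
    abs_of_pos (by positivity)]
  rfl

lemma delta_prod {m : ℕ} (lam b : ℝ) (hl : 0 < lam) (hb : 0 ≤ b) (g δ : Fin (m+1) → ℝ) (hg : ∀ j, 0 < g j)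
    (hlast : δ (Fin.last m) = g (Fin.last m)) (hcast : ∀ i : Fin m, δ i.castSucc = min (g i.castSucc) (g i.succ)) :
    ∏ j, (lam * δ j) ^ (-b) ≤ ∏ j, (1 + (lam * g j) ^ (-b)) ^ 2 := by
  have hpos : ∀ j, 0 < (lam * g j) ^ (-b) := fun j => by have := hg j; positivity
  have h1 : ∏ j, (lam * δ j) ^ (-b) ≤ (∏ i : Fin m, (1 + (lam * g i.castSucc) ^ (-b)) * (1 + (lam * g i.succ) ^ (-b))) * (1 + (lam * g (Fin.last m)) ^ (-b)) := by
    rw [Fin.prod_univ_castSucc]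
    refine mul_le_mul (Finset.prod_le_prod (fun i _ => ?_) fun i _ => ?_) ?_ ?_ ?_
    · rw [hcast]; have := hg i.castSucc; have := hg i.succ; positivity
    · rw [hcast]
      have h1 := hpos i.castSucc
      have h2 := hpos i.succ
      rcases min_choice (g i.castSucc) (g i.succ) with h | h <;> rw [h] <;> nlinarith
    · rw [hlast]; linarith
    · rw [hlast]; exact (hpos _).le
    · exact Finset.prod_nonneg fun i _ => by have := hpos i.castSucc; have := hpos i.succ; positivity
  refine h1.trans ?_
  rw [Finset.prod_mul_distrib, Finset.prod_pow]
  have e1 := Fin.prod_univ_castSucc (fun j => (1 + (lam * g j) ^ (-b)))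
  have e2 := Fin.prod_univ_succ (fun j => (1 + (lam * g j) ^ (-b)))
  have h3 : ∏ i : Fin m, (1 + (lam * g i.succ) ^ (-b)) ≤ ∏ j, (1 + (lam * g j) ^ (-b)) := by
    rw [e2]
    refine le_mul_of_one_le_left (Finset.prod_nonneg fun i _ => by have := hpos i.succ; positivity) ?_
    linarith [hpos 0]
  have h4 : 0 ≤ ∏ j, (1 + (lam * g j) ^ (-b)) := Finset.prod_nonneg fun i _ => by have := hpos i; positivity
  calc _ = (∏ j, (1 + (lam * g j) ^ (-b))) * ∏ i : Fin m, (1 + (lam * g i.succ) ^ (-b)) := by rw [e1]; ring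
    _ ≤ (∏ j, (1 + (lam * g j) ^ (-b))) * ∏ j, (1 + (lam * g j) ^ (-b)) := by gcongr
    _ = _ := by ring

lemma J_sorted (α γ κ Rm q : ℝ) (d : ℕ) (hα : 0 < α) (hα1 : α < 1) (hγ0 : 0 ≤ γ) (hγ1 : γ ≤ 1) (hκ : 0 < κ) (hRm : 0 < Rm) (hq : 0 < q) :
    ∃ C : ℝ, 0 < C ∧ ∀ (m : ℕ) (p : Fin (m+1) → ℝ) (lo R : ℝ), 0 < R → R ≤ Rm → StrictMono p → (∀ k, p k ∈ Icc (lo + R) (lo + 2 * R)) →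
      (Jf α γ κ (m+1) d p) ^ q ≤
        ENNReal.ofReal ((C * ((m+1 : ℕ) : ℝ) ^ (γ / 2 * q) * (((m+1 : ℕ) : ℝ) / R) ^ (α * d * q + α * γ * q)) ^ (m+1)) *
          ∏ k, Psi (α * d * q) (α * γ * q) (((m+1 : ℕ) : ℝ) / R * gap lo p k) := by
  obtain ⟨C, hC, hJ⟩ := J_bound α γ κ (2 * Rm) d hα hα1 hγ0 hγ1 hκ (by positivity)
  refine ⟨C ^ q * Real.exp 2, by positivity, ?_⟩
  intro m p lo R hR hRRm hp hpI
  set n : ℝ := ((m+1 : ℕ) : ℝ) with hn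
  have hnpos : 0 < n := by rw [hn]; positivity
  set lam : ℝ := n / R with hlam
  have hl : 0 < lam := by positivity
  set g : Fin (m+1) → ℝ := gap lo p with hgdef
  have hg0 : g 0 = p 0 - lo := gap_zero lo p
  have hgs : ∀ i : Fin m, g i.succ = p i.succ - p i.castSucc := fun i => gap_succ lo p i
  have hg : ∀ j, 0 < g j := by
    intro j
    refine Fin.cases ?_ (fun i => ?_) j
    · rw [hg0]; linarith [(hpI 0).1]
    · rw [hgs]; linarith [hp (Fin.castSucc_lt_succ (i := i))]
  have hgD : ∀ j, g j ≤ 2 * Rm := by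
    intro j
    refine Fin.cases ?_ (fun i => ?_) j
    · rw [hg0]; linarith [(hpI 0).2]
    · rw [hgs]; linarith [(hpI i.succ).2, (hpI i.castSucc).1]
  set δ : Fin (m+1) → ℝ := fun j => Fin.lastCases (motive := fun _ => ℝ) (g (Fin.last m)) (fun i => min (g i.castSucc) (g i.succ)) j with hδdef
  have hlast : δ (Fin.last m) = g (Fin.last m) := by simp [hδdef]
  have hcast : ∀ i : Fin m, δ i.castSucc = min (g i.castSucc) (g i.succ) := by intro i; simp [hδdef]
  have hδg : ∀ j, δ j ≤ g j := by
    intro j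
    refine Fin.lastCases ?_ (fun i => ?_) j
    · rw [hlast]
    · rw [hcast]; exact min_le_left _ _
  have hδ : ∀ j, 0 < δ j := by
    intro j
    refine Fin.lastCases ?_ (fun i => ?_) j
    · rw [hlast]; exact hg _
    · rw [hcast]; exact lt_min (hg _) (hg _)
  have hgp : ∀ j l, l < j → g j ≤ |p l - p j| := by
    intro j l hlj
    rw [abs_sub_comm, abs_of_pos (sub_pos.2 (hp hlj))]
    revert hlj
    refine Fin.cases ?_ (fun i => ?_) j
    · intro h; exact absurd h (Fin.not_lt_zero _)
    · intro h
      rw [hgs]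
      have := hp.monotone (Fin.le_castSucc_iff.2 h)
      linarith
  have hδp : ∀ j l, l ≠ j → δ j ≤ |p l - p j| := by
    intro j l hlj
    rcases lt_or_gt_of_ne hlj with h | h
    · exact (hδg j).trans (hgp j l h)
    · rw [abs_of_pos (sub_pos.2 (hp h))]
      revert h
      refine Fin.lastCases ?_ (fun i => ?_) j
      · intro h; exact absurd h (not_lt.2 (Fin.le_last _))
      · intro h
        rw [hcast]
        refine (min_le_right _ _).trans ?_
        rw [hgs]
        have := hp.monotone (Fin.castSucc_lt_iff_succ_le.1 h)
        linarith
  have hpD : ∀ j l, |p l - p j| ≤ 2 * Rm := by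
    intro j l
    rw [abs_le]
    constructor <;> linarith [(hpI l).1, (hpI l).2, (hpI j).1, (hpI j).2]
  have hJ' := hJ (m+1) p g δ hg hgD hδ (fun j => (hδg j).trans (hgD j)) hpD hgp hδp
  set a := α * d * q with ha
  set b := α * γ * q with hb
  have hb0 : 0 ≤ b := by positivity
  have hsum : ∑ j, lam * g j ≤ 2 * n := by
    rw [← Finset.mul_sum, hgdef, gap_sum]
    have : p (Fin.last m) - lo ≤ 2 * R := by linarith [(hpI (Fin.last m)).2]
    calc _ ≤ lam * (2 * R) := by gcongr
      _ = _ := by rw [hlam]; field_simp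
  have hexp : (1:ℝ) ≤ ∏ j : Fin (m+1), (Real.exp 2 * Real.exp (-(lam * g j))) := by
    rw [Finset.prod_mul_distrib, Finset.prod_const, Finset.card_univ, Fintype.card_fin, ← Real.exp_nat_mul, ← Real.exp_sum, ← Real.exp_add, ← hn]
    apply Real.one_le_exp
    rw [Finset.sum_neg_distrib]; linarith
  have hfac : ∀ j, (C * n ^ (γ / 2) * δ j ^ (-(α * γ)) * g j ^ (-(α * d))) ^ q =
      (C ^ q * n ^ (γ / 2 * q) * lam ^ (a + b)) * ((lam * δ j) ^ (-b) * (lam * g j) ^ (-a)) := by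
    intro j
    have h1 := hg j
    have h2 := hδ j
    rw [Real.mul_rpow (by positivity) (by positivity), Real.mul_rpow (by positivity) (by positivity), Real.mul_rpow (by positivity) (by positivity),
      ← Real.rpow_mul hnpos.le, ← Real.rpow_mul h2.le, ← Real.rpow_mul h1.le, Real.mul_rpow hl.le h2.le, Real.mul_rpow hl.le h1.le,
      show -(α * γ) * q = -b by rw [hb]; ring, show -(α * d) * q = -a by rw [ha]; ring, Real.rpow_add hl, Real.rpow_neg hl.le b, Real.rpow_neg hl.le a]
    have := Real.rpow_pos_of_pos hl a
    have := Real.rpow_pos_of_pos hl b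
    field_simp
  have hreal : (∏ j, (C * n ^ (γ / 2) * δ j ^ (-(α * γ)) * g j ^ (-(α * d)))) ^ q ≤
      (C ^ q * Real.exp 2 * n ^ (γ / 2 * q) * lam ^ (a + b)) ^ (m+1) *
       ∏ j, ((lam * g j) ^ (-a) * (1 + (lam * g j) ^ (-b)) ^ 2 * Real.exp (-(lam * g j))) := by
    rw [← Real.finsetProd_rpow _ _ (fun j _ => by have := hg j; have := hδ j; positivity)]
    simp only [hfac]
    rw [Finset.prod_mul_distrib, Finset.prod_const, Finset.card_univ, Fintype.card_fin, Finset.prod_mul_distrib]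
    have hd := delta_prod lam b hl hb0 g δ hg hlast hcast
    have ha0 : 0 ≤ ∏ j, (lam * g j) ^ (-a) := Finset.prod_nonneg fun j _ => by have := hg j; positivity
    have hm0 : 0 ≤ ∏ j, (1 + (lam * g j) ^ (-b)) ^ 2 := Finset.prod_nonneg fun j _ => by positivity
    calc _ ≤ (C ^ q * n ^ (γ / 2 * q) * lam ^ (a + b)) ^ (m+1) * ((∏ j, (1 + (lam * g j) ^ (-b)) ^ 2) * ∏ j, (lam * g j) ^ (-a)) * 1 := by
          rw [mul_one]; gcongr
      _ ≤ (C ^ q * n ^ (γ / 2 * q) * lam ^ (a + b)) ^ (m+1) * ((∏ j, (1 + (lam * g j) ^ (-b)) ^ 2) * ∏ j, (lam * g j) ^ (-a)) *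
            ∏ j : Fin (m+1), (Real.exp 2 * Real.exp (-(lam * g j))) := by gcongr
      _ = _ := by
          simp only [Finset.prod_mul_distrib, Finset.prod_const, Finset.card_univ, Fintype.card_fin]
          ring
  calc (Jf α γ κ (m+1) d p) ^ q ≤ (ENNReal.ofReal (∏ j, (C * n ^ (γ / 2) * δ j ^ (-(α * γ)) * g j ^ (-(α * d))))) ^ q := by
        gcongr
    _ = ENNReal.ofReal ((∏ j, (C * n ^ (γ / 2) * δ j ^ (-(α * γ)) * g j ^ (-(α * d)))) ^ q) := by
        rw [ENNReal.ofReal_rpow_of_nonneg _ hq.le]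
        exact Finset.prod_nonneg fun j _ => by have := hg j; have := hδ j; positivity
    _ ≤ _ := ENNReal.ofReal_le_ofReal hreal
    _ = _ := by
        rw [ENNReal.ofReal_mul (by positivity), ENNReal.ofReal_prod_of_nonneg (fun j _ => by have := hg j; positivity)]
        congr 1
        refine Finset.prod_congr rfl fun j _ => ?_
        rw [Psi, indicator_of_mem]
        exact mul_pos hl (hg j)

lemma J_int (α γ κ Rm q : ℝ) (d : ℕ) (hα : 0 < α) (hα1 : α < 1) (hγ0 : 0 ≤ γ) (hγ1 : γ ≤ 1) (hκ : 0 < κ) (hRm : 0 < Rm) (hq : 0 < q)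
    (hab : α * d * q + 2 * (α * γ * q) < 1) :
    ∃ C : ℝ, 0 < C ∧ ∀ (n : ℕ) (lo R : ℝ), 1 ≤ n → 0 < R → R ≤ Rm →
      ∫⁻ p in univ.pi (fun _ : Fin n => Icc lo (lo + R)), (Jf α γ κ n d p) ^ q ≤
        ENNReal.ofReal (n.factorial * (C * (n : ℝ) ^ (γ / 2 * q) * ((n : ℝ) / R) ^ (α * d * q + α * γ * q - 1)) ^ n) := by
  obtain ⟨C, hC, hJ⟩ := J_sorted α γ κ Rm q d hα hα1 hγ0 hγ1 hκ hRm hq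
  have hK := Psi_int (α * d * q) (α * γ * q) (by positivity) hab
  set K := ∫⁻ y, Psi (α * d * q) (α * γ * q) y with hKdef
  refine ⟨C * (K.toReal + 1), by positivity, ?_⟩
  intro n lo R hn hR hRRm
  obtain ⟨m, rfl⟩ : ∃ m, n = m + 1 := ⟨n - 1, by omega⟩
  have hn0 : (0:ℝ) < ((m+1 : ℕ) : ℝ) := by positivity
  set lam : ℝ := ((m+1 : ℕ) : ℝ) / R with hlam
  have hl : 0 < lam := by positivity
  refine (sort_bound (m+1) (fun p => (Jf α γ κ (m+1) d p) ^ q) ((Jf_measurable α γ κ hα hγ0 (m+1) d).pow_const q)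
    (fun p σ => by rw [Jf_perm α γ κ hα hγ0]) (Icc lo (lo + R)) measurableSet_Icc).trans ?_
  rw [ENNReal.ofReal_mul (by positivity), ENNReal.ofReal_natCast]
  refine mul_le_mul_right ?_ _
  set A := (C * ((m+1 : ℕ) : ℝ) ^ (γ / 2 * q) * lam ^ (α * d * q + α * γ * q)) with hA
  have hA0 : 0 ≤ A := by positivity
  calc _ ≤ ∫⁻ p in univ.pi (fun _ : Fin (m+1) => Icc lo (lo + R)) ∩ {p | StrictMono p}, ENNReal.ofReal (A ^ (m+1)) *
          ∏ k, Psi (α * d * q) (α * γ * q) (lam * gap (lo - R) p k) := by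
        refine setLIntegral_mono' ((MeasurableSet.univ_pi fun _ => measurableSet_Icc).inter (measurableSet_strictMono _)) fun p hp => ?_
        refine hJ m p (lo - R) R hR hRRm hp.2 fun k => ?_
        have := hp.1 k trivial
        exact ⟨by linarith [this.1], by linarith [this.2]⟩
    _ ≤ ∫⁻ p, ENNReal.ofReal (A ^ (m+1)) * ∏ k, Psi (α * d * q) (α * γ * q) (lam * gap (lo - R) p k) := setLIntegral_le_lintegral _ _
    _ = ENNReal.ofReal (A ^ (m+1)) * (ENNReal.ofReal lam⁻¹ * K) ^ (m+1) := by
        rw [lintegral_const_mul' _ _ (by simp)]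
        rw [chain_int (fun x => Psi (α * d * q) (α * γ * q) (lam * x)) ((Psi_measurable _ _).comp (by fun_prop)), Psi_scale _ _ _ hl]
    _ ≤ ENNReal.ofReal (A ^ (m+1)) * (ENNReal.ofReal lam⁻¹ * ENNReal.ofReal (K.toReal + 1)) ^ (m+1) := by
        gcongr
        rw [← ENNReal.ofReal_toReal hK.ne]
        exact ENNReal.ofReal_le_ofReal (by simp)
    _ = _ := by
        rw [← ENNReal.ofReal_mul (by positivity), ← ENNReal.ofReal_pow (by positivity), ← ENNReal.ofReal_mul (by positivity), ← mul_pow]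
        congr 2
        rw [hA, Real.rpow_sub hl, Real.rpow_one]
        ring

open MeasureTheory Set
open scoped ENNReal

/-- the frame matrix -/
noncomputable def frM {N : ℕ} (w : Fin (N+1) → Metric.sphere (0 : EuclideanSpace ℝ (Fin N)) 1) : Matrix (Fin (N+1)) (Fin (N+1)) ℝ :=
  Matrix.of fun i => Fin.cons 1 (fun k => -((w i : EuclideanSpace ℝ (Fin N)) k))

lemma frM_det_continuous (N : ℕ) : Continuous (fun w : Fin (N+1) → Metric.sphere (0 : EuclideanSpace ℝ (Fin N)) 1 => (frM w).det) := by
  refine Continuous.matrix_det ?_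
  refine continuous_matrix fun i j => ?_
  unfold frM
  refine Fin.cases ?_ (fun k => ?_) j
  · simp only [Matrix.of_apply, Fin.cons_zero]; fun_prop
  · simp only [Matrix.of_apply, Fin.cons_succ]; fun_prop

lemma frM_exists (N : ℕ) (hN : 1 ≤ N) : ∃ w : Fin (N+1) → Metric.sphere (0 : EuclideanSpace ℝ (Fin N)) 1, (frM w).det ≠ 0 := by
  set i0 : Fin N := ⟨0, hN⟩ with hi0
  refine ⟨Fin.cons ⟨-EuclideanSpace.single i0 1, by simp⟩ (fun k => ⟨EuclideanSpace.single k 1, by simp⟩), ?_⟩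
  intro h
  obtain ⟨v, hv, hv0⟩ := Matrix.exists_mulVec_eq_zero_iff.2 h
  apply hv
  have h0 := congrFun hv0 0
  have hs : ∀ k : Fin N, v 0 - v k.succ = 0 := by
    intro k
    have := congrFun hv0 k.succ
    simp only [frM, Matrix.mulVec, dotProduct, Fin.sum_univ_succ, Matrix.of_apply, Fin.cons_zero, Fin.cons_succ, Pi.zero_apply] at this
    simp at this
    linarith
  simp only [frM, Matrix.mulVec, dotProduct, Fin.sum_univ_succ, Matrix.of_apply, Fin.cons_zero, Fin.cons_succ, Pi.zero_apply] at h0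
  simp at h0
  have h1 := hs i0
  have hv00 : v 0 = 0 := by linarith
  funext j
  refine Fin.cases ?_ (fun k => ?_) j
  · exact hv00
  · have := hs k
    simp only [Pi.zero_apply]; linarith

lemma exists_frame (N : ℕ) (hN : 1 ≤ N) : ∃ (P : Measure (Fin (N+1) → Metric.sphere (0 : EuclideanSpace ℝ (Fin N)) 1)) (c M : ℝ),
    IsProbabilityMeasure P ∧ 0 < c ∧ 0 < M ∧ (∀ᵐ w ∂P, c ≤ |(frM w).det|) ∧
    ∀ (i : Fin (N+1)) (f : Metric.sphere (0 : EuclideanSpace ℝ (Fin N)) 1 → ℝ≥0∞), Measurable f →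
      ∫⁻ w, f (w i) ∂P ≤ ENNReal.ofReal M * ∫⁻ x, f x ∂(volume : Measure (EuclideanSpace ℝ (Fin N))).toSphere := by
  have : Nonempty (Fin N) := ⟨⟨0, hN⟩⟩
  obtain ⟨w₀, hw₀⟩ := frM_exists N hN
  set σ := (volume : Measure (EuclideanSpace ℝ (Fin N))).toSphere with hσ
  set c := |(frM w₀).det| / 2 with hc
  have hc0 : 0 < c := by have := abs_pos.2 hw₀; positivity
  set W := {w : Fin (N+1) → Metric.sphere (0 : EuclideanSpace ℝ (Fin N)) 1 | c < |(frM w).det|} with hW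
  have hWo : IsOpen W := isOpen_lt continuous_const (frM_det_continuous N).abs
  set Pi := Measure.pi (fun _ : Fin (N+1) => σ) with hPi
  have hop : σ.IsOpenPosMeasure := by rw [hσ]; infer_instance
  have hop2 : Pi.IsOpenPosMeasure := by rw [hPi]; exact Measure.pi.isOpenPosMeasure _
  have hWpos : Pi W ≠ 0 := by
    refine (hWo.measure_pos Pi ⟨w₀, ?_⟩).ne'
    change c < _
    have := abs_pos.2 hw₀
    rw [hc]; linarith
  set Mn := (Pi W)⁻¹ * (σ univ) ^ N with hMn
  have hMtop : Mn ≠ ∞ := ENNReal.mul_ne_top (ENNReal.inv_ne_top.2 hWpos) (ENNReal.pow_ne_top (measure_ne_top _ _))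
  refine ⟨ProbabilityTheory.cond Pi W, c, Mn.toReal + 1, ProbabilityTheory.cond_isProbabilityMeasure hWpos, hc0, by positivity, ?_, ?_⟩
  · have := ProbabilityTheory.ae_cond_mem (μ := Pi) hWo.measurableSet
    filter_upwards [this] with w hw
    exact le_of_lt hw
  · intro i f hf
    have h1 : ∫⁻ w, f (w i) ∂Pi = (σ univ) ^ N * ∫⁻ x, f x ∂σ := by
      have := lintegral_pi_prod (N+1) (fun _ => σ) (fun j x => if j = i then f x else 1) (fun j => by
        by_cases h : j = i
        · simpa [h] using hf
        · simp [h])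
      have e : ∀ w : Fin (N+1) → Metric.sphere (0 : EuclideanSpace ℝ (Fin N)) 1, ∏ j, (if j = i then f (w j) else 1) = f (w i) := by
        intro w; simp
      simp only [e] at this
      rw [hPi, this, ← Finset.mul_prod_erase Finset.univ _ (Finset.mem_univ i), mul_comm]
      congr 1
      · rw [Finset.prod_congr rfl (g := fun _ => σ univ)]
        · rw [Finset.prod_const, Finset.card_erase_of_mem (Finset.mem_univ i)]; simp
        · intro j hj
          simp [Finset.ne_of_mem_erase hj]
      · simp
    calc ∫⁻ w, f (w i) ∂(ProbabilityTheory.cond Pi W) = (Pi W)⁻¹ * ∫⁻ w in W, f (w i) ∂Pi := by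
          rw [ProbabilityTheory.cond, lintegral_smul_measure]; rfl
      _ ≤ (Pi W)⁻¹ * ∫⁻ w, f (w i) ∂Pi := by exact mul_le_mul_right (setLIntegral_le_lintegral _ _) _
      _ = Mn * ∫⁻ x, f x ∂σ := by rw [h1, hMn, mul_assoc]
      _ ≤ _ := by
          gcongr
          rw [← ENNReal.ofReal_toReal hMtop]
          exact ENNReal.ofReal_le_ofReal (by simp)

lemma jensen_exp {Ω : Type*} [MeasurableSpace Ω] (P : Measure Ω) [IsProbabilityMeasure P] (f : Ω → ℝ) (hf : Measurable f) (hf0 : ∀ x, 0 ≤ f x)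
    (X : ℝ) (hX : 0 ≤ X) (h : ∫⁻ x, ENNReal.ofReal (f x) ∂P ≤ ENNReal.ofReal X) :
    ENNReal.ofReal (Real.exp (-X)) ≤ ∫⁻ x, ENNReal.ofReal (Real.exp (-f x)) ∂P := by
  have hInt0 : Integrable f P := by
    refine ⟨hf.aestronglyMeasurable, ?_⟩
    rw [hasFiniteIntegral_iff_ofReal (Filter.Eventually.of_forall hf0)]
    exact lt_of_le_of_lt h ENNReal.ofReal_lt_top
  have hle : ∫ x, f x ∂P ≤ X := by
    rw [← ofReal_integral_eq_lintegral_ofReal hInt0 (Filter.Eventually.of_forall hf0)] at h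
    exact (ENNReal.ofReal_le_ofReal_iff hX).1 h
  have hexp : Integrable (fun x => Real.exp (-f x)) P := by
    refine Integrable.mono' (integrable_const (1:ℝ)) (by fun_prop) (Filter.Eventually.of_forall fun x => ?_)
    rw [Real.norm_eq_abs, abs_of_pos (Real.exp_pos _)]
    exact Real.exp_le_one_iff.2 (by linarith [hf0 x])
  rw [← ofReal_integral_eq_lintegral_ofReal hexp (Filter.Eventually.of_forall fun x => (Real.exp_pos _).le)]
  apply ENNReal.ofReal_le_ofReal
  have h2 : Integrable (fun x => Real.exp (-X) * (1 + X - f x)) P := ((integrable_const (1 + X)).sub hInt0).const_mul _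
  calc Real.exp (-X) ≤ Real.exp (-X) * (1 + X - ∫ x, f x ∂P) := by
        refine le_mul_of_one_le_right (Real.exp_pos _).le (by linarith)
    _ = ∫ x, Real.exp (-X) * (1 + X - f x) ∂P := by
        rw [integral_const_mul, integral_sub (integrable_const _) hInt0]; simp
    _ ≤ _ := by
        refine integral_mono h2 hexp fun x => ?_
        have e : Real.exp (-f x) = Real.exp (-X) * Real.exp (X - f x) := by rw [← Real.exp_add]; congr 1; ring
        rw [e]
        have := Real.add_one_le_exp (X - f x)
        exact mul_le_mul_of_nonneg_left (by linarith) (Real.exp_pos _).le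

lemma Qvar_nonneg (N : ℕ) (hN : 1 ≤ N) (H β : ℝ) (hfun : EuclideanSpace ℝ (Fin N) → ℝ)
    (c₁ : ℝ) (hc₁ : 0 < c₁) (hflow : ∀ ξ : EuclideanSpace ℝ (Fin N), ξ ≠ 0 → c₁ * ‖ξ‖ ^ (-β) ≤ hfun ξ)
    {n : ℕ} (z : Fin n → ℝ × EuclideanSpace ℝ (Fin N)) (c : Fin n → ℝ) : 0 ≤ Qvar N H hfun z c := by
  unfold Qvar
  refine integral_nonneg fun τ => integral_nonneg_of_ae ?_
  filter_upwards [ae_ne_zero_euclid N hN] with ξ hξ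
  have : 0 ≤ hfun ξ := le_trans (by positivity) (hflow ξ hξ)
  simp only [Pi.zero_apply]
  positivity

lemma pr_continuous (N n : ℕ) : Continuous (fun q : EuclideanSpace ℝ (Fin N) × (Fin n → ℝ × EuclideanSpace ℝ (Fin N)) => pr q.1 q.2) := by
  unfold pr
  fun_prop

lemma cov_frame (N : ℕ) (w : Fin (N+1) → Metric.sphere (0 : EuclideanSpace ℝ (Fin N)) 1) (hw : (frM w).det ≠ 0) :
    Measure.map (fun z : ℝ × EuclideanSpace ℝ (Fin N) => fun i => z.1 - inner ℝ z.2 (w i : EuclideanSpace ℝ (Fin N))) volume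
      = ENNReal.ofReal |((frM w).det)⁻¹| • (volume : Measure (Fin (N+1) → ℝ)) := by
  have h1 : MeasurePreserving (fun z : ℝ × EuclideanSpace ℝ (Fin N) => (Fin.cons z.1 (WithLp.ofLp z.2) : Fin (N+1) → ℝ)) volume volume := by
    have ha := mp_cons (fun _ : Fin (N+1) => (volume : Measure ℝ))
    have hb : MeasurePreserving (Prod.map id (@WithLp.ofLp 2 (Fin N → ℝ)) : ℝ × EuclideanSpace ℝ (Fin N) → ℝ × (Fin N → ℝ))
      (volume.prod volume) (volume.prod volume) :=
      (MeasurePreserving.id _).prod (PiLp.volume_preserving_ofLp (Fin N))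
    exact ha.comp hb
  rw [← Real.map_matrix_volume_pi_eq_smul_volume_pi hw, ← h1.map_eq, Measure.map_map (LinearMap.continuous_of_finiteDimensional _).measurable h1.measurable]
  congr 1
  funext z i
  simp only [Function.comp, Matrix.toLin'_apply, frM, Matrix.mulVec, dotProduct, Fin.sum_univ_succ, Matrix.of_apply, Fin.cons_zero, Fin.cons_succ, PiLp.inner_apply]
  simp [sub_eq_add_neg]

open MeasureTheory Set
open scoped ENNReal

lemma exp_frame (N : ℕ) (hN : 1 ≤ N) (H β : ℝ) (hH1 : 1 / 2 ≤ H) (hH2 : H < 1)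
    (hβN : β < N) (hβlow : (N : ℝ) - 2 * H - 1 < β)
    (hfun : EuclideanSpace ℝ (Fin N) → ℝ) (hmeas : Measurable hfun)
    (c₁ c₂ : ℝ) (hc₁ : 0 < c₁) (hc₁₂ : c₁ ≤ c₂)
    (hflow : ∀ ξ : EuclideanSpace ℝ (Fin N), ξ ≠ 0 → c₁ * ‖ξ‖ ^ (-β) ≤ hfun ξ)
    (hfup : ∀ ξ : EuclideanSpace ℝ (Fin N), ξ ≠ 0 → hfun ξ ≤ c₂ * ‖ξ‖ ^ (-β)) (Ta : ℝ) (hTa : 0 < Ta) :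
    ∃ (P : Measure (Fin (N+1) → Metric.sphere (0 : EuclideanSpace ℝ (Fin N)) 1)) (c κ : ℝ),
    IsProbabilityMeasure P ∧ 0 < c ∧ 0 < κ ∧ (∀ᵐ w ∂P, c ≤ |(frM w).det|) ∧
    ∀ (n d : ℕ) (z : Fin n → ℝ × EuclideanSpace ℝ (Fin N)) (ξ : Fin n → Fin d → ℝ), (∀ j, Ta ≤ (z j).1) →
      ENNReal.ofReal (∏ k, Real.exp (-(1 / 2) * Qvar N H hfun z (fun j => ξ j k))) ≤
      ∫⁻ w, ∏ i, ENNReal.ofReal (Real.exp (-(κ * ∑ k, qf (alphaExp N H β) (pr (w i : EuclideanSpace ℝ (Fin N)) z) (fun j => ξ j k)))) ∂P := by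
  obtain ⟨κ, hκ, hQ⟩ := Q_polar N hN H β hH1 hH2 hβN hβlow hfun hmeas c₁ c₂ hc₁ hc₁₂ hflow hfup Ta hTa
  obtain ⟨P, c, M, hP, hc, hM, hdet, hmarg⟩ := exists_frame N hN
  have hα : 0 < alphaExp N H β := by unfold alphaExp; linarith
  set α := alphaExp N H β with hαdef
  set κ' := κ / (2 * M * (N+1)) with hκ'
  have hκ'0 : 0 < κ' := by positivity
  refine ⟨P, c, κ', hP, hc, hκ'0, hdet, ?_⟩
  intro n d z ξ hz
  have hcont : ∀ k, Continuous (fun x : Metric.sphere (0 : EuclideanSpace ℝ (Fin N)) 1 => qf α (pr (x : EuclideanSpace ℝ (Fin N)) z) (fun j => ξ j k)) := by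
    intro k
    have h1 : Continuous (fun x : Metric.sphere (0 : EuclideanSpace ℝ (Fin N)) 1 => pr (x : EuclideanSpace ℝ (Fin N)) z) :=
      (pr_continuous N n).comp (by fun_prop : Continuous fun x : Metric.sphere (0 : EuclideanSpace ℝ (Fin N)) 1 => ((x : EuclideanSpace ℝ (Fin N)), z))
    exact (qf_continuous α hα n).comp (h1.prodMk continuous_const)
  set f : (Fin (N+1) → Metric.sphere (0 : EuclideanSpace ℝ (Fin N)) 1) → ℝ := fun w =>
    ∑ i, κ' * ∑ k, qf α (pr (w i : EuclideanSpace ℝ (Fin N)) z) (fun j => ξ j k) with hf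
  have hterm0 : ∀ (x : Metric.sphere (0 : EuclideanSpace ℝ (Fin N)) 1), 0 ≤ κ' * ∑ k, qf α (pr (x : EuclideanSpace ℝ (Fin N)) z) (fun j => ξ j k) :=
    fun x => mul_nonneg hκ'0.le (Finset.sum_nonneg fun k _ => qf_nonneg α hα _ _)
  have htm : Measurable (fun x : Metric.sphere (0 : EuclideanSpace ℝ (Fin N)) 1 => κ' * ∑ k, qf α (pr (x : EuclideanSpace ℝ (Fin N)) z) (fun j => ξ j k)) := by
    have : Continuous (fun x : Metric.sphere (0 : EuclideanSpace ℝ (Fin N)) 1 => κ' * ∑ k, qf α (pr (x : EuclideanSpace ℝ (Fin N)) z) (fun j => ξ j k)) :=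
      continuous_const.mul (continuous_finsetSum _ fun k _ => hcont k)
    exact this.measurable
  have hQ0 : ∀ k, 0 ≤ Qvar N H hfun z (fun j => ξ j k) := fun k => Qvar_nonneg N hN H β hfun c₁ hc₁ hflow z _
  have hkey : ∫⁻ w, ENNReal.ofReal (f w) ∂P ≤ ENNReal.ofReal (∑ k, 1 / 2 * Qvar N H hfun z (fun j => ξ j k)) := by
    have e1 : ∀ w, ENNReal.ofReal (f w) = ∑ i, ENNReal.ofReal (κ' * ∑ k, qf α (pr (w i : EuclideanSpace ℝ (Fin N)) z) (fun j => ξ j k)) :=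
      fun w => ENNReal.ofReal_sum_of_nonneg fun i _ => hterm0 (w i)
    simp only [e1]
    rw [lintegral_finsetSum]
    swap
    · intro i _
      exact (htm.comp (measurable_pi_apply i)).ennreal_ofReal
    have h2 : ∫⁻ x, ENNReal.ofReal (κ' * ∑ k, qf α (pr (x : EuclideanSpace ℝ (Fin N)) z) (fun j => ξ j k)) ∂(volume : Measure (EuclideanSpace ℝ (Fin N))).toSphere
        ≤ ENNReal.ofReal (1 / (2 * M * (N+1)) * ∑ k, Qvar N H hfun z (fun j => ξ j k)) := by
      have e2 : ∀ x : Metric.sphere (0 : EuclideanSpace ℝ (Fin N)) 1, ENNReal.ofReal (κ' * ∑ k, qf α (pr (x : EuclideanSpace ℝ (Fin N)) z) (fun j => ξ j k))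
          = ENNReal.ofReal κ' * ∑ k, ENNReal.ofReal (qf α (pr (x : EuclideanSpace ℝ (Fin N)) z) (fun j => ξ j k)) := by
        intro x
        rw [ENNReal.ofReal_mul hκ'0.le, ENNReal.ofReal_sum_of_nonneg fun k _ => qf_nonneg α hα _ _]
      simp only [e2]
      rw [lintegral_const_mul' _ _ (by simp), lintegral_finsetSum _ (fun k _ => (hcont k).measurable.ennreal_ofReal),
        show κ' = 1 / (2 * M * (N+1)) * κ by rw [hκ']; ring, ENNReal.ofReal_mul (by positivity), ENNReal.ofReal_mul (by positivity),
        ENNReal.ofReal_sum_of_nonneg fun k _ => hQ0 k, mul_assoc, Finset.mul_sum]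
      refine mul_le_mul_right (Finset.sum_le_sum fun k _ => ?_) _
      exact hQ n z _ hz
    calc _ ≤ ∑ i : Fin (N+1), ENNReal.ofReal M * ENNReal.ofReal (1 / (2 * M * (N+1)) * ∑ k, Qvar N H hfun z (fun j => ξ j k)) := by
          refine Finset.sum_le_sum fun i _ => ?_
          exact (hmarg i _ htm.ennreal_ofReal).trans (mul_le_mul_right h2 _)
      _ = _ := by
          rw [Finset.sum_const, Finset.card_univ, Fintype.card_fin, nsmul_eq_mul, ← ENNReal.ofReal_natCast, ← ENNReal.ofReal_mul hM.le,
            ← ENNReal.ofReal_mul (by positivity), ← Finset.mul_sum]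
          congr 1
          push_cast
          field_simp
  have hj := jensen_exp P f (by
      refine Finset.measurable_fun_sum _ fun i _ => ?_
      exact htm.comp (measurable_pi_apply i)) (fun w => Finset.sum_nonneg fun i _ => hterm0 (w i)) _
      (Finset.sum_nonneg fun k _ => by have := hQ0 k; positivity) hkey
  have e3 : ∏ k, Real.exp (-(1 / 2) * Qvar N H hfun z (fun j => ξ j k)) = Real.exp (-∑ k, 1 / 2 * Qvar N H hfun z (fun j => ξ j k)) := by
    rw [← Real.exp_sum, ← Finset.sum_neg_distrib]
    congr 1
    refine Finset.sum_congr rfl fun k _ => ?_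
    ring
  rw [e3]
  refine hj.trans (le_of_eq (lintegral_congr fun w => ?_))
  rw [← ENNReal.ofReal_prod_of_nonneg (fun i _ => (Real.exp_pos _).le), ← Real.exp_sum, Finset.sum_neg_distrib]

lemma inc_bound (d : ℕ) (γ : ℝ) (hγ0 : 0 < γ) (hγ1 : γ ≤ 1) (ξ : Fin d → ℝ) (v w : EuclideanSpace ℝ (Fin d)) :
    ‖Complex.exp (-Complex.I * ((∑ k, ξ k * v k : ℝ) : ℂ)) - Complex.exp (-Complex.I * ((∑ k, ξ k * w k : ℝ) : ℂ))‖ ≤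
      2 * ‖v - w‖ ^ γ * (∑ k, ξ k ^ 2) ^ (γ / 2) := by
  set a := ∑ k, ξ k * v k
  set b := ∑ k, ξ k * w k
  have e : ∀ x : ℝ, -Complex.I * (x : ℂ) = Complex.I * ((-x : ℝ) : ℂ) := by intro x; push_cast; ring
  rw [e, e]
  have h1 := exp_diff_le (-a) (-b)
  have h2 := exp_diff_le_two (-a) (-b)
  have h3 : |-a - -b| ≤ ‖v - w‖ * √(∑ k, ξ k ^ 2) := by
    have e1 : -a - -b = -∑ k, ξ k * (v - w) k := by
      simp only [a, b, PiLp.sub_apply, mul_sub, Finset.sum_sub_distrib]; ring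
    rw [e1, abs_neg, EuclideanSpace.norm_eq, ← Real.sqrt_mul (by positivity), ← Real.sqrt_sq_eq_abs]
    apply Real.sqrt_le_sqrt
    have := Finset.sum_mul_sq_le_sq_mul_sq Finset.univ ξ (fun k => (v - w) k)
    simp only [Real.norm_eq_abs, sq_abs]
    linarith
  have hx0 : 0 ≤ |-a - -b| := abs_nonneg _
  have h4 : ‖Complex.exp (Complex.I * ((-a : ℝ) : ℂ)) - Complex.exp (Complex.I * ((-b : ℝ) : ℂ))‖ ≤ 2 * |-a - -b| ^ γ := by
    rcases le_total (|-a - -b|) 1 with h | h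
    · have h5 : |-a - -b| ≤ |-a - -b| ^ γ := by
        rcases hx0.eq_or_lt with h0 | h0
        · rw [← h0, Real.zero_rpow hγ0.ne']
        · have := Real.rpow_le_rpow_of_exponent_ge h0 h hγ1
          rwa [Real.rpow_one] at this
      linarith
    · have := Real.one_le_rpow h hγ0.le
      linarith
  refine h4.trans ?_
  have h5 := Real.rpow_le_rpow hx0 h3 hγ0.le
  rw [Real.mul_rpow (by positivity) (by positivity), Real.sqrt_eq_rpow, ← Real.rpow_mul (by positivity), show 1 / 2 * γ = γ / 2 by ring] at h5
  linarith

lemma holder_frame (α γ κ : ℝ) (hα : 0 < α) (hγ : 0 ≤ γ) (N n d : ℕ) (p : Fin (N+1) → Fin n → ℝ) :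
    ∫⁻ ξ : Fin n → Fin d → ℝ, ENNReal.ofReal (∏ j, (∑ k, ξ j k ^ 2) ^ (γ / 2)) *
      ∏ i, ENNReal.ofReal (Real.exp (-(κ * ∑ k, qf α (p i) (fun j => ξ j k)))) ≤
    ∏ i, (Jf α γ (κ * (N+1)) n d (p i)) ^ (1 / ((N:ℝ)+1)) := by
  set q : ℝ := 1 / ((N:ℝ)+1) with hq
  have hq0 : 0 < q := by positivity
  have hqN : q * ((N:ℝ)+1) = 1 := by rw [hq]; field_simp
  have hm : ∀ i, Measurable (fun ξ : Fin n → Fin d → ℝ => ENNReal.ofReal ((∏ j, (∑ k, ξ j k ^ 2) ^ (γ / 2)) *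
    Real.exp (-(κ * (N+1) * ∑ k, qf α (p i) (fun j => ξ j k))))) := by
    intro i
    have h := qf_continuous α hα n
    have h2 : ∀ k, Continuous (fun q : (Fin n → Fin d → ℝ) => qf α (p i) (fun j => q j k)) := by
      intro k
      exact h.comp (by fun_prop : Continuous fun q : (Fin n → Fin d → ℝ) => ((p i), fun j => q j k))
    have : Continuous (fun q : (Fin n → Fin d → ℝ) => (∏ j, (∑ k, q j k ^ 2) ^ (γ / 2)) *
        Real.exp (-(κ * (N+1) * ∑ k, qf α (p i) (fun j => q j k)))) := by
      refine Continuous.mul (continuous_finsetProd _ fun j _ => ?_) (by fun_prop)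
      exact Continuous.rpow_const (by fun_prop) (fun _ => Or.inr (by linarith))
    exact this.measurable.ennreal_ofReal
  have hH := ENNReal.lintegral_prod_norm_pow_le (μ := (volume : Measure (Fin n → Fin d → ℝ))) Finset.univ (fun i _ => (hm i).aemeasurable) (p := fun _ => q)
    (by rw [Finset.sum_const, Finset.card_univ, Fintype.card_fin, nsmul_eq_mul, mul_comm]; push_cast; exact hqN) (fun i _ => hq0.le)
  refine le_trans (le_of_eq (lintegral_congr fun ξ => ?_)) hH
  have hS0 : 0 ≤ ∏ j, (∑ k, ξ j k ^ 2) ^ (γ / 2) := Finset.prod_nonneg fun j _ => by positivity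
  have e : ∀ i, ENNReal.ofReal ((∏ j, (∑ k, ξ j k ^ 2) ^ (γ / 2)) * Real.exp (-(κ * (N+1) * ∑ k, qf α (p i) (fun j => ξ j k)))) ^ q
      = ENNReal.ofReal ((∏ j, (∑ k, ξ j k ^ 2) ^ (γ / 2)) ^ q) * ENNReal.ofReal (Real.exp (-(κ * ∑ k, qf α (p i) (fun j => ξ j k)))) := by
    intro i
    rw [ENNReal.ofReal_rpow_of_nonneg (by positivity) hq0.le, Real.mul_rpow hS0 (Real.exp_pos _).le, ← Real.exp_mul, ENNReal.ofReal_mul (by positivity)]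
    congr 3
    linear_combination (-κ * ∑ k, qf α (p i) (fun j => ξ j k)) * hqN
  simp only [e]
  rw [Finset.prod_mul_distrib, Finset.prod_const, Finset.card_univ, Fintype.card_fin, ← ENNReal.ofReal_pow (by positivity),
    ← Real.rpow_natCast, ← Real.rpow_mul hS0]
  push_cast
  rw [hqN, Real.rpow_one]

open MeasureTheory Set
open scoped ENNReal

/-- the box -/
def bx (N : ℕ) (ia ib : ℝ) (ja jb : Fin N → ℝ) : Set (ℝ × EuclideanSpace ℝ (Fin N)) :=
  {p | p.1 ∈ Icc ia ib ∧ ∀ i, p.2 i ∈ Icc (ja i) (jb i)}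

lemma bx_meas (N : ℕ) (ia ib : ℝ) (ja jb : Fin N → ℝ) : MeasurableSet (bx N ia ib ja jb) := by
  have h : bx N ia ib ja jb = (Prod.fst ⁻¹' Icc ia ib) ∩ ⋂ i, (fun p : ℝ × EuclideanSpace ℝ (Fin N) => p.2 i) ⁻¹' Icc (ja i) (jb i) := by
    ext p; simp [bx]
  rw [h]
  refine IsClosed.measurableSet ?_
  refine (isClosed_Icc.preimage continuous_fst).inter (isClosed_iInter fun i => isClosed_Icc.preimage ?_)
  fun_prop

lemma pr_range (N : ℕ) (r ia ib : ℝ) (hr : 0 < r) (ja jb : Fin N → ℝ) (h1 : ib - ia ≤ r) (h2 : ∀ i, jb i - ja i ≤ r)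
    (w : EuclideanSpace ℝ (Fin N)) (hw : ‖w‖ = 1) (p : ℝ × EuclideanSpace ℝ (Fin N)) (hp : p ∈ bx N ia ib ja jb) :
    p.1 - inner ℝ p.2 w ∈ Icc (ia - ∑ k, ja k * w k - N * r) (ia - ∑ k, ja k * w k - N * r + (2 * N + 1) * r) := by
  obtain ⟨ha, hb⟩ := hp
  have hin : inner ℝ p.2 w = ∑ k, ja k * w k + ∑ k, (p.2 k - ja k) * w k := by
    rw [← Finset.sum_add_distrib, PiLp.inner_apply]
    refine Finset.sum_congr rfl fun k _ => ?_
    simp; ring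
  have hs : |∑ k, (p.2 k - ja k) * w k| ≤ N * r := by
    refine (Finset.abs_sum_le_sum_abs _ _).trans ?_
    calc ∑ k, |(p.2 k - ja k) * w k| ≤ ∑ k : Fin N, r := by
          refine Finset.sum_le_sum fun k _ => ?_
          have hwk : |w k| ≤ 1 := by
            have := PiLp.norm_apply_le w k
            rw [hw] at this; simpa using this
          have hk := hb k
          have h3 : |p.2 k - ja k| ≤ r := by
            rw [abs_le]; constructor <;> linarith [hk.1, hk.2, h2 k]
          rw [abs_mul]
          calc _ ≤ r * 1 := mul_le_mul h3 hwk (abs_nonneg _) hr.le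
            _ = r := mul_one r
      _ = N * r := by simp
  rw [abs_le] at hs
  rw [hin]
  constructor <;> linarith [ha.1, ha.2]

set_option maxHeartbeats 1000000 in
lemma fixed_frame (α γ κ q : ℝ) (hα : 0 < α) (hγ : 0 ≤ γ) (hq : 0 ≤ q) (N d n : ℕ) (r ia ib : ℝ) (hr : 0 < r) (ja jb : Fin N → ℝ)
    (h1 : ib - ia ≤ r) (h2 : ∀ i, jb i - ja i ≤ r) (c : ℝ) (hc : 0 < c)
    (w : Fin (N+1) → Metric.sphere (0 : EuclideanSpace ℝ (Fin N)) 1) (hw : c ≤ |(frM w).det|) (B : ℝ≥0∞)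
    (hB : ∀ lo : ℝ, ∫⁻ p in univ.pi (fun _ : Fin n => Icc lo (lo + (2 * N + 1) * r)), (Jf α γ κ n d p) ^ q ≤ B) :
    ∫⁻ z in univ.pi (fun _ : Fin n => bx N ia ib ja jb), ∏ i, (Jf α γ κ n d (pr (w i : EuclideanSpace ℝ (Fin N)) z)) ^ q
      ≤ ENNReal.ofReal c⁻¹ ^ n * B ^ (N+1) := by
  have hdet : (frM w).det ≠ 0 := by
    intro h; rw [h] at hw; simp at hw; linarith
  set lo : Fin (N+1) → ℝ := fun i => ia - ∑ k, ja k * (w i : EuclideanSpace ℝ (Fin N)) k - N * r with hlo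
  set S : Fin (N+1) → Set (Fin n → ℝ) := fun i => univ.pi (fun _ : Fin n => Icc (lo i) (lo i + (2 * N + 1) * r)) with hS
  have hSm : ∀ i, MeasurableSet (S i) := fun i => MeasurableSet.univ_pi fun _ => measurableSet_Icc
  set G : Fin (N+1) → (Fin n → ℝ) → ℝ≥0∞ := fun i => (S i).indicator (fun p => (Jf α γ κ n d p) ^ q) with hG
  have hGm : ∀ i, Measurable (G i) := fun i => ((Jf_measurable α γ κ hα hγ n d).pow_const q).indicator (hSm i)
  have hGB : ∀ i, ∫⁻ p, G i p ≤ B := by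
    intro i
    rw [hG]; dsimp only
    rw [lintegral_indicator (hSm i)]
    exact hB (lo i)
  set L : ℝ × EuclideanSpace ℝ (Fin N) → Fin (N+1) → ℝ := fun z i => z.1 - inner ℝ z.2 (w i : EuclideanSpace ℝ (Fin N)) with hL
  have hLm : Measurable L := by
    refine measurable_pi_lambda _ fun i => ?_
    exact (by fun_prop : Continuous fun z : ℝ × EuclideanSpace ℝ (Fin N) => z.1 - inner ℝ z.2 (w i : EuclideanSpace ℝ (Fin N))).measurable
  set Φ : (Fin n → Fin (N+1) → ℝ) → ℝ≥0∞ := fun y => ∏ i, G i (fun j => y j i) with hΦ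
  have hΦm : Measurable Φ := by
    refine Finset.measurable_prod _ fun i _ => (hGm i).comp ?_
    fun_prop
  calc _ ≤ ∫⁻ z in univ.pi (fun _ : Fin n => bx N ia ib ja jb), Φ (fun j => L (z j)) := by
        refine setLIntegral_mono' (MeasurableSet.univ_pi fun _ => bx_meas _ _ _ _ _) fun z hz => ?_
        refine Finset.prod_le_prod' fun i _ => ?_
        have hmem : pr (w i : EuclideanSpace ℝ (Fin N)) z ∈ S i := by
          intro j _
          exact pr_range N r ia ib hr ja jb h1 h2 _ (by simp) (z j) (hz j (mem_univ _))
        have : (fun j => L (z j) i) = pr (w i : EuclideanSpace ℝ (Fin N)) z := rfl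
        rw [this, hG]; dsimp only
        rw [indicator_of_mem hmem]
    _ ≤ ∫⁻ z : Fin n → ℝ × EuclideanSpace ℝ (Fin N), Φ (fun j => L (z j)) := setLIntegral_le_lintegral _ _
    _ = ENNReal.ofReal |((frM w).det)⁻¹| ^ n * ∫⁻ y, Φ y :=
        lintegral_pi_map volume volume L hLm _ ENNReal.ofReal_ne_top (cov_frame N w hdet) n Φ hΦm
    _ = ENNReal.ofReal |((frM w).det)⁻¹| ^ n * ∏ i, ∫⁻ p, G i p := by
        rw [hΦ, lintegral_flip_prod (N+1) n G hGm]
    _ ≤ ENNReal.ofReal c⁻¹ ^ n * B ^ (N+1) := by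
        refine mul_le_mul' ?_ ?_
        · refine pow_le_pow_left' (ENNReal.ofReal_le_ofReal ?_) n
          rw [abs_inv]; exact inv_anti₀ hc hw
        · calc _ ≤ ∏ _i : Fin (N+1), B := Finset.prod_le_prod' fun i _ => hGB i
            _ = _ := by simp

lemma swap_abs {Z X W : Type*} [MeasurableSpace Z] [MeasurableSpace X] [MeasurableSpace W] (μ : Measure Z) (ν : Measure X) (P : Measure W)
    [SFinite μ] [SFinite ν] [IsProbabilityMeasure P] (A : X → ℝ≥0∞) (hA : ∀ x, A x ≠ ∞) (E : Z → X → W → ℝ≥0∞)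
    (hm : Measurable fun q : (Z × W) × X => A q.2 * E q.1.1 q.2 q.1.2) (K : ℝ≥0∞)
    (hK : ∀ᵐ w ∂P, ∫⁻ z, ∫⁻ x, A x * E z x w ∂ν ∂μ ≤ K) :
    ∫⁻ z, ∫⁻ x, A x * (∫⁻ w, E z x w ∂P) ∂ν ∂μ ≤ K := by
  have hInt0 : Measurable (fun q : Z × W => ∫⁻ x, A x * E q.1 x q.2 ∂ν) := hm.lintegral_prod_right'
  have e1 : ∀ z, ∫⁻ x, A x * (∫⁻ w, E z x w ∂P) ∂ν = ∫⁻ w, (∫⁻ x, A x * E z x w ∂ν) ∂P := by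
    intro z
    have hm2 : Measurable (fun q : X × W => A q.1 * E z q.1 q.2) :=
      hm.comp (by fun_prop : Measurable fun q : X × W => ((z, q.2), q.1))
    rw [← lintegral_lintegral_swap hm2.aemeasurable]
    refine lintegral_congr fun x => ?_
    rw [← lintegral_const_mul' _ _ (hA x)]
  rw [lintegral_congr e1, lintegral_lintegral_swap hInt0.aemeasurable]
  calc _ ≤ ∫⁻ _w, K ∂P := lintegral_mono_ae hK
    _ = K := by simp

set_option maxHeartbeats 1000000 in
lemma swap_bound (N n d : ℕ) (α γ κ : ℝ) (hα : 0 < α) (hγ : 0 ≤ γ) (A : Set (Fin n → ℝ × EuclideanSpace ℝ (Fin N)))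
    (P : Measure (Fin (N+1) → Metric.sphere (0 : EuclideanSpace ℝ (Fin N)) 1)) [IsProbabilityMeasure P] (K : ℝ≥0∞)
    (hK : ∀ᵐ w ∂P, ∫⁻ z in A, ∏ i, (Jf α γ (κ * (N+1)) n d (pr (w i : EuclideanSpace ℝ (Fin N)) z)) ^ (1/((N:ℝ)+1)) ≤ K) :
    ∫⁻ z in A, ∫⁻ ξ : Fin n → Fin d → ℝ, ENNReal.ofReal (∏ j, (∑ k, ξ j k ^ 2) ^ (γ / 2)) *
      ∫⁻ w, ∏ i, ENNReal.ofReal (Real.exp (-(κ * ∑ k, qf α (pr (w i : EuclideanSpace ℝ (Fin N)) z) (fun j => ξ j k)))) ∂P ≤ K := by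
  set F : (Fin n → ℝ × EuclideanSpace ℝ (Fin N)) → (Fin n → Fin d → ℝ) → (Fin (N+1) → Metric.sphere (0 : EuclideanSpace ℝ (Fin N)) 1) → ℝ≥0∞ :=
    fun z ξ w => ENNReal.ofReal (∏ j, (∑ k, ξ j k ^ 2) ^ (γ / 2)) * ∏ i, ENNReal.ofReal (Real.exp (-(κ * ∑ k, qf α (pr (w i : EuclideanSpace ℝ (Fin N)) z) (fun j => ξ j k)))) with hF
  have hS : Continuous (fun ξ : Fin n → Fin d → ℝ => ∏ j, (∑ k, ξ j k ^ 2) ^ (γ / 2)) := by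
    refine continuous_finsetProd _ fun j _ => ?_
    refine Continuous.rpow_const (by fun_prop) fun x => Or.inr (by positivity)
  have hE : ∀ i : Fin (N+1), Continuous (fun q : ((Fin n → ℝ × EuclideanSpace ℝ (Fin N)) × (Fin (N+1) → Metric.sphere (0 : EuclideanSpace ℝ (Fin N)) 1)) × (Fin n → Fin d → ℝ) =>
      Real.exp (-(κ * ∑ k, qf α (pr (q.1.2 i : EuclideanSpace ℝ (Fin N)) q.1.1) (fun j => q.2 j k)))) := by
    intro i
    have h1 : Continuous (fun q : ((Fin n → ℝ × EuclideanSpace ℝ (Fin N)) × (Fin (N+1) → Metric.sphere (0 : EuclideanSpace ℝ (Fin N)) 1)) × (Fin n → Fin d → ℝ) =>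
        pr (q.1.2 i : EuclideanSpace ℝ (Fin N)) q.1.1) := by
      have h0 : Continuous (fun q : ((Fin n → ℝ × EuclideanSpace ℝ (Fin N)) × (Fin (N+1) → Metric.sphere (0 : EuclideanSpace ℝ (Fin N)) 1)) × (Fin n → Fin d → ℝ) =>
        ((q.1.2 i : EuclideanSpace ℝ (Fin N)), q.1.1)) := by fun_prop
      exact (pr_continuous N n).comp h0
    have h2 : ∀ k : Fin d, Continuous (fun q : ((Fin n → ℝ × EuclideanSpace ℝ (Fin N)) × (Fin (N+1) → Metric.sphere (0 : EuclideanSpace ℝ (Fin N)) 1)) × (Fin n → Fin d → ℝ) =>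
        qf α (pr (q.1.2 i : EuclideanSpace ℝ (Fin N)) q.1.1) (fun j => q.2 j k)) := by
      intro k
      have h3 : Continuous (fun q : ((Fin n → ℝ × EuclideanSpace ℝ (Fin N)) × (Fin (N+1) → Metric.sphere (0 : EuclideanSpace ℝ (Fin N)) 1)) × (Fin n → Fin d → ℝ) =>
        (fun j => q.2 j k)) := by fun_prop
      exact (qf_continuous α hα n).comp (h1.prodMk h3)
    exact Real.continuous_exp.comp (continuous_const.mul (continuous_finsetSum _ fun k _ => h2 k)).neg
  have hFm : Measurable (fun q : ((Fin n → ℝ × EuclideanSpace ℝ (Fin N)) × (Fin (N+1) → Metric.sphere (0 : EuclideanSpace ℝ (Fin N)) 1)) × (Fin n → Fin d → ℝ) =>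
      F q.1.1 q.2 q.1.2) := by
    refine Measurable.mul ?_ (Finset.measurable_prod _ fun i _ => (hE i).measurable.ennreal_ofReal)
    exact (hS.comp continuous_snd).measurable.ennreal_ofReal
  refine swap_abs (volume.restrict A) volume P _ (fun x => ENNReal.ofReal_ne_top) _ hFm K ?_
  filter_upwards [hK] with w hw
  refine le_trans (lintegral_mono fun z => ?_) hw
  exact holder_frame α γ κ hα hγ N n d (fun i => pr (w i : EuclideanSpace ℝ (Fin N)) z)

open MeasureTheory Set
open scoped ENNReal

lemma fact_pow (n : ℕ) (hn : 1 ≤ n) (e : ℝ) : ((n:ℝ) ^ e) ^ n ≤ Real.exp |e| ^ n * (n.factorial : ℝ) ^ e := by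
  have hn0 : (0:ℝ) < n := by exact_mod_cast hn
  have hf0 : (0:ℝ) < n.factorial := by exact_mod_cast n.factorial_pos
  have h1 : (n:ℝ) ^ n ≤ Real.exp n * n.factorial := by
    have := Real.pow_div_factorial_le_exp (n:ℝ) hn0.le n
    rwa [div_le_iff₀ hf0] at this
  have h2 : (n.factorial : ℝ) ≤ (n:ℝ) ^ n := by exact_mod_cast Nat.factorial_le_pow n
  have h3 : ((n:ℝ) ^ e) ^ n = ((n:ℝ) ^ n) ^ e := by
    rw [← Real.rpow_natCast, ← Real.rpow_natCast, ← Real.rpow_mul hn0.le, ← Real.rpow_mul hn0.le, mul_comm]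
  have h4 : Real.exp |e| ^ n = Real.exp n ^ |e| := by
    rw [← Real.exp_nat_mul, ← Real.exp_mul]
  rw [h3, h4]
  rcases le_total 0 e with he | he
  · rw [abs_of_nonneg he, ← Real.mul_rpow (Real.exp_pos _).le hf0.le]
    exact Real.rpow_le_rpow (by positivity) h1 he
  · calc ((n:ℝ) ^ n) ^ e ≤ (n.factorial : ℝ) ^ e := Real.rpow_le_rpow_of_nonpos hf0 h2 he
      _ ≤ _ := by
        refine le_mul_of_one_le_left (by positivity) ?_
        exact Real.one_le_rpow (Real.one_le_exp hn0.le) (abs_nonneg _)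

lemma final_arith (N d n : ℕ) (hn : 1 ≤ n) (α γ c C V r : ℝ) (hc : 0 < c) (hC : 0 < C) (hV : 0 ≤ V) (hr : 0 < r) :
    (2 * V ^ γ) ^ n * (c⁻¹ ^ n * ((n.factorial : ℝ) * (C * (n:ℝ) ^ (γ / 2 * (1/((N:ℝ)+1))) *
      ((n:ℝ) / ((2 * N + 1) * r)) ^ (α * d * (1/((N:ℝ)+1)) + α * γ * (1/((N:ℝ)+1)) - 1)) ^ n) ^ (N+1)) ≤
    (2 * c⁻¹ * C ^ (N+1) * (2 * N + 1 : ℝ) ^ (1 + N - α * (d + γ)) * Real.exp |γ / 2 - (1 + N - α * (d + γ))|) ^ n *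
      V ^ ((n:ℝ) * γ) * (n.factorial : ℝ) ^ (α * d + (1/2 + α) * γ) * r ^ ((n:ℝ) * (1 + N - α * (d + γ))) := by
  have hn0 : (0:ℝ) < n := by exact_mod_cast hn
  have hf0 : (0:ℝ) < n.factorial := by exact_mod_cast n.factorial_pos
  have hN0 : (0:ℝ) < 2 * N + 1 := by positivity
  have hN1 : (N:ℝ) + 1 ≠ 0 := by positivity
  set m : ℝ := 1 + N - α * (d + γ) with hm
  set e : ℝ := γ / 2 - m with he
  have t1 : ((n:ℝ) ^ (γ / 2 * (1/((N:ℝ)+1)))) ^ (N+1) = (n:ℝ) ^ (γ/2) := by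
    rw [← Real.rpow_natCast, ← Real.rpow_mul hn0.le]; congr 1; push_cast; field_simp
  have t2 : (((n:ℝ) / ((2 * N + 1) * r)) ^ (α * d * (1/((N:ℝ)+1)) + α * γ * (1/((N:ℝ)+1)) - 1)) ^ (N+1)
      = (n:ℝ) ^ (-m) * ((2 * N + 1) ^ m * r ^ m) := by
    rw [← Real.rpow_natCast, ← Real.rpow_mul (by positivity)]
    have : (α * d * (1/((N:ℝ)+1)) + α * γ * (1/((N:ℝ)+1)) - 1) * ((N+1 : ℕ) : ℝ) = -m := by
      rw [hm]; push_cast; field_simp; ring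
    rw [this, Real.div_rpow hn0.le (by positivity), Real.rpow_neg (by positivity : 0 ≤ (2 * (N:ℝ) + 1) * r), Real.mul_rpow hN0.le hr.le, div_inv_eq_mul]
  have t3 : (n:ℝ) ^ (γ/2) * (n:ℝ) ^ (-m) = (n:ℝ) ^ e := by
    rw [← Real.rpow_add hn0]; rfl
  have t4 : V ^ ((n:ℝ) * γ) = (V ^ γ) ^ n := by
    rw [mul_comm, Real.rpow_mul hV, Real.rpow_natCast]
  have t5 : r ^ ((n:ℝ) * m) = (r ^ m) ^ n := by
    rw [mul_comm, Real.rpow_mul hr.le, Real.rpow_natCast]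
  have t6 : (n.factorial : ℝ) ^ (α * d + (1/2 + α) * γ) = (n.factorial : ℝ) ^ (N+1) * (n.factorial : ℝ) ^ e := by
    rw [← Real.rpow_natCast, ← Real.rpow_add hf0]; congr 1; rw [he, hm]; push_cast; ring
  rw [t4, t5, t6]
  calc _ = (2 * c⁻¹ * C ^ (N+1) * (2 * N + 1 : ℝ) ^ m) ^ n * (V ^ γ) ^ n * (n.factorial : ℝ) ^ (N+1) * (r ^ m) ^ n * ((n:ℝ) ^ e) ^ n := by
        rw [← t3, mul_pow (n.factorial : ℝ) _ (N+1), ← pow_mul, mul_comm n (N+1), pow_mul _ (N+1) n, mul_pow (C * _) _ (N+1), mul_pow C _ (N+1), t1, t2]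
        simp only [mul_pow]; ring
    _ ≤ (2 * c⁻¹ * C ^ (N+1) * (2 * N + 1 : ℝ) ^ m) ^ n * (V ^ γ) ^ n * (n.factorial : ℝ) ^ (N+1) * (r ^ m) ^ n * (Real.exp |e| ^ n * (n.factorial : ℝ) ^ e) := by
        refine mul_le_mul_of_nonneg_left (fact_pow n hn e) ?_
        have := Real.rpow_nonneg hV γ
        positivity
    _ = _ := by rw [mul_pow _ (Real.exp |e|) n]; ring

open MeasureTheory Set
open scoped ENNReal

/-- Proposition 4.10(ii) in integral form: the moment bound for the increments of the
local time in the space variable,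
`E[(L(v,I) − L(w,I))ⁿ] ≤ Cⁿ |v−w|^{nγ} (n!)^{αd + (1/2+α)γ} r^{n(1+N−α(d+γ))}`,
written via the Fourier-analytic integral expression for these moments. -/
theorem local_time_increment_moment_estimate
    (N : ℕ) (hN : 1 ≤ N) (H β : ℝ) (hH1 : 1 / 2 ≤ H) (hH2 : H < 1)
    (hβ0 : 0 < β) (hβN : β < N)
    (hβlow : (N : ℝ) - 2 * H - 1 < β) (hβup : β < (N : ℝ) - 2 * H + 1)
    (hfun : EuclideanSpace ℝ (Fin N) → ℝ) (hmeas : Measurable hfun)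
    (c₁ c₂ : ℝ) (hc₁ : 0 < c₁) (hc₁₂ : c₁ ≤ c₂)
    (hflow : ∀ ξ : EuclideanSpace ℝ (Fin N), ξ ≠ 0 → c₁ * ‖ξ‖ ^ (-β) ≤ hfun ξ)
    (hfup : ∀ ξ : EuclideanSpace ℝ (Fin N), ξ ≠ 0 → hfun ξ ≤ c₂ * ‖ξ‖ ^ (-β))
    (d : ℕ) (hd : 1 ≤ d) (hαd : alphaExp N H β * d < 1 + N)
    (γ : ℝ) (hγ0 : 0 < γ)
    (hγ : γ < min ((1 / 2) * ((1 + N) / alphaExp N H β - d)) 1)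
    (Ta Tb : ℝ) (hTa : 0 < Ta) (Xa Xb : Fin N → ℝ) :
    ∃ C r₀ : ℝ, 0 < C ∧ 0 < r₀ ∧
      ∀ r : ℝ, 0 < r → r ≤ r₀ →
        ∀ (ia ib : ℝ) (ja jb : Fin N → ℝ),
          {p : ℝ × EuclideanSpace ℝ (Fin N) |
              p.1 ∈ Icc ia ib ∧ ∀ i, p.2 i ∈ Icc (ja i) (jb i)} ⊆
            {p : ℝ × EuclideanSpace ℝ (Fin N) |
              p.1 ∈ Icc Ta Tb ∧ ∀ i, p.2 i ∈ Icc (Xa i) (Xb i)} →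
          ib - ia ≤ r → (∀ i, jb i - ja i ≤ r) →
          ∀ v w : EuclideanSpace ℝ (Fin d),
            ∀ n : ℕ, 2 ≤ n →
              (∫⁻ z in Set.univ.pi (fun _ : Fin n =>
                  {p : ℝ × EuclideanSpace ℝ (Fin N) |
                    p.1 ∈ Icc ia ib ∧ ∀ i, p.2 i ∈ Icc (ja i) (jb i)}),
                ∫⁻ ξb : Fin n → Fin d → ℝ,
                  ENNReal.ofReal
                    ((∏ j,
                        ‖Complex.exp (-Complex.I * ((∑ k, ξb j k * v k : ℝ) : ℂ)) -
                          Complex.exp (-Complex.I * ((∑ k, ξb j k * w k : ℝ) : ℂ))‖) *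
                      ∏ k, Real.exp (-(1 / 2) * Qvar N H hfun z (fun j => ξb j k)))) ≤
                ENNReal.ofReal (C ^ n * ‖v - w‖ ^ ((n : ℝ) * γ) *
                    (n.factorial : ℝ) ^
                      (alphaExp N H β * d + (1 / 2 + alphaExp N H β) * γ) *
                  r ^ ((n : ℝ) * (1 + N - alphaExp N H β * (d + γ)))) := by
  have hα : 0 < alphaExp N H β := by unfold alphaExp; linarith
  have hα1 : alphaExp N H β < 1 := by unfold alphaExp; linarith
  have hγ1 : γ ≤ 1 := (hγ.le.trans (min_le_right _ _))
  have hγ2 : γ < (1 / 2) * ((1 + N) / alphaExp N H β - d) := hγ.trans_le (min_le_left _ _)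
  obtain ⟨P, c, κ, hP, hc, hκ, hdet, hexp⟩ := exp_frame N hN H β hH1 hH2 hβN hβlow hfun hmeas c₁ c₂ hc₁ hc₁₂ hflow hfup Ta hTa
  set α := alphaExp N H β with hαdef
  have hN1 : (0:ℝ) < (N:ℝ) + 1 := by positivity
  have hab : α * d * (1/((N:ℝ)+1)) + 2 * (α * γ * (1/((N:ℝ)+1))) < 1 := by
    have h1 : 2 * γ + d < (1 + N) / α := by linarith
    rw [lt_div_iff₀ hα] at h1
    have : α * d * (1/((N:ℝ)+1)) + 2 * (α * γ * (1/((N:ℝ)+1))) = (α * d + 2 * (α * γ)) / ((N:ℝ)+1) := by ring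
    rw [this, div_lt_one hN1]; linarith
  obtain ⟨C, hC, hJ⟩ := J_int α γ (κ * (N+1)) (2 * N + 1) (1/((N:ℝ)+1)) d hα hα1 hγ0.le hγ1 (by positivity) (by positivity) (by positivity) hab
  refine ⟨2 * c⁻¹ * C ^ (N+1) * (2 * N + 1 : ℝ) ^ (1 + N - α * (d + γ)) * Real.exp |γ / 2 - (1 + N - α * (d + γ))|, 1, ?_, one_pos, ?_⟩
  rotate_left
  · intro r hr hr1 ia ib ja jb hsub hi hj v w n hn
    have hn1 : 1 ≤ n := by omega
    refine le_trans ?_ (ENNReal.ofReal_le_ofReal (final_arith N d n hn1 α γ c C ‖v - w‖ r hc hC (norm_nonneg _) hr))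
    set B : ℝ := (n.factorial : ℝ) * (C * (n:ℝ) ^ (γ / 2 * (1/((N:ℝ)+1))) *
      ((n:ℝ) / ((2 * N + 1) * r)) ^ (α * d * (1/((N:ℝ)+1)) + α * γ * (1/((N:ℝ)+1)) - 1)) ^ n with hB
    have hB0 : 0 ≤ B := by positivity
    have hV0 : 0 ≤ 2 * ‖v - w‖ ^ γ := by positivity
    have hmain := swap_bound N n d α γ κ hα hγ0.le (univ.pi fun _ : Fin n => bx N ia ib ja jb) P
      (ENNReal.ofReal c⁻¹ ^ n * ENNReal.ofReal B ^ (N+1)) (by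
        filter_upwards [hdet] with w' hw'
        refine fixed_frame α γ (κ * (N+1)) _ hα hγ0.le (by positivity) N d n r ia ib hr ja jb hi hj c hc w' hw' _ fun lo => ?_
        exact hJ n lo ((2 * N + 1) * r) hn1 (by positivity) (by nlinarith))
    have hrhs : ENNReal.ofReal ((2 * ‖v - w‖ ^ γ) ^ n * (c⁻¹ ^ n * B ^ (N+1))) =
        ENNReal.ofReal ((2 * ‖v - w‖ ^ γ) ^ n) * (ENNReal.ofReal c⁻¹ ^ n * ENNReal.ofReal B ^ (N+1)) := by
      rw [ENNReal.ofReal_mul (by positivity), ENNReal.ofReal_mul (by positivity), ENNReal.ofReal_pow (by positivity) n, ENNReal.ofReal_pow (by positivity) n, ENNReal.ofReal_pow hB0]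
    rw [hrhs]
    refine le_trans ?_ (mul_le_mul_right hmain _)
    rw [← lintegral_const_mul' _ _ ENNReal.ofReal_ne_top]
    refine setLIntegral_mono' (MeasurableSet.univ_pi fun _ => bx_meas N ia ib ja jb) fun z hz => ?_
    rw [← lintegral_const_mul' _ _ ENNReal.ofReal_ne_top]
    refine lintegral_mono fun ξ => ?_
    have hzT : ∀ j, Ta ≤ (z j).1 := fun j => (hsub (hz j (mem_univ _))).1.1
    have h1 := hexp n d z ξ hzT
    rw [← mul_assoc, ENNReal.ofReal_mul (Finset.prod_nonneg fun _ _ => norm_nonneg _), ← ENNReal.ofReal_mul (pow_nonneg hV0 n)]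
    refine mul_le_mul' (ENNReal.ofReal_le_ofReal ?_) h1
    calc _ ≤ ∏ j, (2 * ‖v - w‖ ^ γ * (∑ k, ξ j k ^ 2) ^ (γ / 2)) :=
          Finset.prod_le_prod (fun _ _ => norm_nonneg _) fun j _ => inc_bound d γ hγ0 hγ1 (ξ j) v w
      _ = _ := by rw [Finset.prod_mul_distrib]; simp
  · positivity
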